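/- arXiv:1608.08152 — 4 statements merged into one kernel-verified Lean document; each statement's English description precedes it below -/
import Mathlib

section
/- Let G be a supersolvable group and let V be an irreducible representation of G over ℂ, i.e. a simple module over the monoid algebra ℂ[G]. Then V is monomial if and only if V has finite weight. -/
open scoped TensorProduct

/-- A group is supersolvable if it has a finite chain of subgroups, each normal in `G`,
going from `⊤` down to `⊥`, with each successive quotient cyclic (equivalently, each
step is generated over the next one by a single element). -/
def IsSupersolvable (G : Type*) [Group G] : Prop :=
  ∃ (k : ℕ) (N : ℕ → Subgroup G),
    N 0 = ⊤ ∧ N (k + 1) = ⊥ ∧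
    (∀ i, N (i + 1) ≤ N i) ∧
    (∀ i, (N i).Normal) ∧
    (∀ i ≤ k, ∃ g : G, N i = N (i + 1) ⊔ Subgroup.closure {g})

/-- `Ind_H^G χ = ℂ[G] ⊗_{ℂ[H]} ℂ_χ`, realized as the quotient of `ℂ[G]` by the left
`ℂ[G]`-submodule generated by the elements `h - χ(h)·1` for `h ∈ H`. -/
noncomputable abbrev IndChar {G : Type*} [Group G] (H : Subgroup G) (χ : H →* ℂˣ) :=
  MonoidAlgebra ℂ G ⧸ Submodule.span (MonoidAlgebra ℂ G)
    {x : MonoidAlgebra ℂ G | ∃ h : H,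
      x = MonoidAlgebra.single (h : G) (1 : ℂ) - (χ h : ℂ) • (1 : MonoidAlgebra ℂ G)}

/-- The weight space `V_H(χ) = {v ∈ V | h • v = χ(h) v for all h ∈ H}` of a
`ℂ[G]`-module `V`. -/
def weightSpace {G : Type*} [Group G] (H : Subgroup G) (χ : H →* ℂˣ)
    (V : Type*) [AddCommGroup V] [Module ℂ V] [Module (MonoidAlgebra ℂ G) V]
    [IsScalarTower ℂ (MonoidAlgebra ℂ G) V] : Submodule ℂ V where
  carrier := {v | ∀ h : H, (MonoidAlgebra.single (h : G) (1 : ℂ)) • v = (χ h : ℂ) • v}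
  add_mem' := fun ha hb h => by rw [smul_add, ha h, hb h, smul_add]
  zero_mem' := fun h => by simp
  smul_mem' := fun c v hv h => by rw [smul_comm, hv h, smul_comm]

/-- A `ℂ[G]`-module is monomial if it is isomorphic, as a `ℂ[G]`-module, to a
representation induced from a character of some subgroup. -/
def IsMonomial (G : Type*) [Group G] (V : Type*) [AddCommGroup V]
    [Module (MonoidAlgebra ℂ G) V] : Prop :=
  ∃ (H : Subgroup G) (χ : H →* ℂˣ),
    Nonempty (V ≃ₗ[MonoidAlgebra ℂ G] IndChar H χ)

/-- A `ℂ[G]`-module has finite weight if some weight space `V_H(χ)` is nonzero and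
finite-dimensional over `ℂ`. -/
def HasFiniteWeight (G : Type*) [Group G] (V : Type*) [AddCommGroup V] [Module ℂ V]
    [Module (MonoidAlgebra ℂ G) V] [IsScalarTower ℂ (MonoidAlgebra ℂ G) V] : Prop :=
  ∃ (H : Subgroup G) (χ : H →* ℂˣ),
    weightSpace H χ V ≠ ⊥ ∧ FiniteDimensional ℂ (weightSpace H χ V)

/-! ### Cyclic series -/

namespace SupersolvableRep

open Subgroup

/-- An ascending normal series with cyclic factors. -/
structure CyclicSeries (G : Type*) [Group G] (n : ℕ) (M : ℕ → Subgroup G) : Prop where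
  zero : M 0 = ⊥
  top : M n = ⊤
  mono : Monotone M
  normal : ∀ i, (M i).Normal
  step : ∀ i, ∃ b, M (i + 1) = M i ⊔ zpowers b

section Groups

variable {G : Type*} [Group G] {n : ℕ} {M : ℕ → Subgroup G}

/-- The intersection of a subgroup with one step of a cyclic series is cyclic over the
intersection with the previous step. -/
theorem CyclicSeries.exists_generator (hM : CyclicSeries G n M) (T : Subgroup G) (i : ℕ) :
    ∃ b ∈ T ⊓ M (i + 1), ∀ x ∈ T ⊓ M (i + 1), ∃ e : ℤ, ∃ c ∈ T ⊓ M i, x = b ^ e * c := by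
  obtain ⟨g, hg⟩ := hM.step i
  have := hM.normal i
  let π := QuotientGroup.mk' (M i)
  have hle : (T ⊓ M (i + 1)).map π ≤ zpowers (π g) := by
    rintro _ ⟨x, hx, rfl⟩
    have hx2 : x ∈ M i ⊔ zpowers g := hg ▸ hx.2
    have : π x ∈ (M i ⊔ zpowers g).map π := ⟨x, hx2, rfl⟩
    rw [Subgroup.map_sup, MonoidHom.map_zpowers] at this
    have h0 : (M i).map π = ⊥ := by
      rw [Subgroup.map_eq_bot_iff, QuotientGroup.ker_mk']
    rwa [h0, bot_sup_eq] at this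
  have hc : IsCyclic ((T ⊓ M (i + 1)).map π) := Subgroup.isCyclic_of_le hle
  rw [Subgroup.isCyclic_iff_exists_zpowers_eq_top] at hc
  obtain ⟨y, hy⟩ := hc
  have hy' : y ∈ (T ⊓ M (i + 1)).map π := hy ▸ mem_zpowers y
  obtain ⟨b, hb, rfl⟩ := hy'
  refine ⟨b, hb, fun x hx => ?_⟩
  have : π x ∈ zpowers (π b) := hy ▸ ⟨x, hx, rfl⟩
  obtain ⟨e, he⟩ := this
  refine ⟨e, (b ^ e)⁻¹ * x, ⟨T.mul_mem (T.inv_mem (T.zpow_mem hb.1 _)) hx.1, ?_⟩, by group⟩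
  refine QuotientGroup.eq.1 (?_ : π (b ^ e) = π x)
  simpa using he

theorem CyclicSeries.fg_inf (hM : CyclicSeries G n M) (T : Subgroup G) (i : ℕ) :
    (T ⊓ M i).FG := by
  induction i with
  | zero => rw [hM.zero, inf_bot_eq]; exact Subgroup.FG.bot
  | succ i ih =>
    obtain ⟨b, hb, h⟩ := hM.exists_generator T i
    have : T ⊓ M (i + 1) = (T ⊓ M i) ⊔ zpowers b := by
      apply le_antisymm
      · intro x hx
        obtain ⟨e, c, hc, rfl⟩ := h x hx
        exact mul_mem (mem_sup_right (zpow_mem (mem_zpowers b) _)) (mem_sup_left hc)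
      · exact sup_le (inf_le_inf_left _ (hM.mono i.le_succ)) (by simpa using hb)
    rw [this]
    exact ih.sup ⟨{b}, by simp [zpowers_eq_closure]⟩

theorem CyclicSeries.fg (hM : CyclicSeries G n M) (T : Subgroup G) : T.FG := by
  simpa [hM.top] using hM.fg_inf T n

theorem CyclicSeries.wellFoundedGT (hM : CyclicSeries G n M) :
    WellFoundedGT (Subgroup G) := by
  rw [wellFoundedGT_iff_monotone_chain_condition]
  intro a
  obtain ⟨S, hS⟩ := hM.fg (⨆ i, a i)
  have hmem : ∀ s ∈ S, ∃ k, s ∈ a k := fun s hs => by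
    rw [← Subgroup.mem_iSup_of_directed a.monotone.directed_le, ← hS]
    exact subset_closure hs
  choose! k hk using hmem
  refine ⟨S.sup k, fun m hm => le_antisymm (a.monotone hm) ?_⟩
  refine (le_iSup a m).trans ?_
  rw [← hS, closure_le]
  exact fun s hs => a.monotone (Finset.le_sup hs) (hk s hs)

theorem CyclicSeries.countable (hM : CyclicSeries G n M) : Countable G := by
  have key : ∀ i, (M i : Set G).Countable := fun i => by
    induction i with
    | zero => simp [hM.zero]
    | succ i ih =>
      obtain ⟨b, -, h⟩ := hM.exists_generator ⊤ i
      refine ((Set.countable_univ (α := ℤ)).prod ih |>.image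
        (fun p : ℤ × G => b ^ p.1 * p.2)).mono ?_
      intro x hx
      obtain ⟨e, c, hc, rfl⟩ := h x ⟨trivial, hx⟩
      exact ⟨(e, c), ⟨trivial, hc.2⟩, rfl⟩
  rw [← Set.countable_univ_iff]
  simpa [hM.top] using key n

theorem CyclicSeries.subgroupOf (hM : CyclicSeries G n M) (Γ : Subgroup G) :
    CyclicSeries Γ n (fun i => (M i).subgroupOf Γ) where
  zero := by simp [hM.zero]
  top := by simp [hM.top]
  mono := fun i j h x hx => hM.mono h hx
  normal i := by have := hM.normal i; infer_instance
  step i := by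
    obtain ⟨b, hb, h⟩ := hM.exists_generator Γ i
    refine ⟨⟨b, hb.1⟩, le_antisymm (fun x hx => ?_) (sup_le ?_ ?_)⟩
    · obtain ⟨e, c, hc, hx⟩ := h x ⟨x.2, hx⟩
      have : x = (⟨b, hb.1⟩ : Γ) ^ e * ⟨c, hc.1⟩ := Subtype.ext (by simpa using hx)
      rw [this]
      exact mul_mem (mem_sup_right (zpow_mem (mem_zpowers _) _)) (mem_sup_left hc.2)
    · exact fun x hx => hM.mono i.le_succ hx
    · rw [zpowers_le]
      exact hb.2

/-- The elements of `G` acting trivially on all the factors of a series. -/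
def factorCentralizer (n : ℕ) (M : ℕ → Subgroup G) (hM : ∀ i, (M i).Normal) : Subgroup G where
  carrier := {g | ∀ i < n, ∀ x ∈ M (i + 1), g * x * g⁻¹ * x⁻¹ ∈ M i}
  one_mem' := fun i _ x _ => by simp
  mul_mem' := fun {a b} ha hb i hi x hx => by
    have h1 := ha i hi (b * x * b⁻¹) ((hM (i + 1)).conj_mem x hx b)
    have h2 := mul_mem h1 (hb i hi x hx)
    convert h2 using 1
    group
  inv_mem' := fun {a} ha i hi x hx => by
    have h1 := ha i hi (a⁻¹ * x * a) (by
      simpa using (hM (i + 1)).conj_mem x hx a⁻¹)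
    have h2 := inv_mem h1
    convert h2 using 1
    group

theorem factorCentralizer_normal (hM : ∀ i, (M i).Normal) :
    (factorCentralizer n M hM).Normal where
  conj_mem g hg y i hi x hx := by
    have h1 := hg i hi (y⁻¹ * x * y) (by simpa using (hM (i + 1)).conj_mem x hx y⁻¹)
    have h2 := (hM i).conj_mem _ h1 y
    convert h2 using 1
    group

theorem CyclicSeries.finiteIndex_factorCentralizer (hM : CyclicSeries G n M) :
    (factorCentralizer n M hM.normal).FiniteIndex := by
  have := hM.normal
  let π := fun i => QuotientGroup.mk' (M i)
  let C := fun i => (M (i + 1)).map (π i)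
  have hC : ∀ i, (C i).Normal := fun i =>
    (hM.normal (i + 1)).map _ (QuotientGroup.mk'_surjective _)
  have hcyc : ∀ i, IsCyclic (C i) := fun i => by
    obtain ⟨b, hb, h⟩ := hM.exists_generator ⊤ i
    refine Subgroup.isCyclic_of_le (H' := zpowers (π i b)) ?_
    rintro _ ⟨x, hx, rfl⟩
    obtain ⟨e, c, hc, rfl⟩ := h x ⟨trivial, hx⟩
    have : π i c = 1 := (QuotientGroup.eq_one_iff c).2 hc.2
    rw [map_mul, this, mul_one, map_zpow]
    exact zpow_mem (mem_zpowers _) _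
  let ψ : ∀ i, G →* MulAut (C i) := fun i => (MulAut.conjNormal (H := C i)).comp (π i)
  have hfin : ∀ i, Finite (MulAut (C i)) := fun i => by
    have e := IsCyclic.mulAutMulEquiv (C i)
    have : Finite (ZMod (Nat.card (C i)))ˣ := by
      rcases h : Nat.card (C i) with _ | m
      · exact inferInstanceAs (Finite ℤˣ)
      · infer_instance
    exact Finite.of_equiv _ e.toEquiv.symm
  have hker : ∀ i : Fin n, (ψ i).ker.FiniteIndex := fun i =>
    Subgroup.finiteIndex_ker _
  have := Subgroup.finiteIndex_iInf hker
  refine Subgroup.finiteIndex_of_le (H := ⨅ i : Fin n, (ψ i).ker) ?_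
  intro g hg i hi x hx
  have h1 : g ∈ (ψ i).ker := (Subgroup.mem_iInf.1 hg) ⟨i, hi⟩
  have h2 := DFunLike.congr_fun ((ψ i).mem_ker.1 h1) ⟨π i x, x, hx, rfl⟩
  have h3 := congrArg Subtype.val h2
  simp only [ψ, MonoidHom.comp_apply, MulAut.conjNormal_apply, MulAut.one_apply] at h3
  rw [← QuotientGroup.eq_one_iff]
  rw [← eq_mul_inv_iff_mul_eq] at h3
  change π i (g * x * g⁻¹ * x⁻¹) = 1
  rw [map_mul, map_mul, map_mul, map_inv, map_inv, h3]
  group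

end Groups

end SupersolvableRep

/-! ### Subgroups of finite index in central extensions -/

namespace SupersolvableRep

open Subgroup

section Isolator

variable {Γ : Type*} [Group Γ] {n : ℕ} {M : ℕ → Subgroup Γ}

theorem map_conjNormal_of_central_series (h0 : M 0 = ⊥) (hn : M n = ⊤)
    (hc : ∀ i < n, ∀ g, ∀ x ∈ M (i + 1), g * x * g⁻¹ * x⁻¹ ∈ M i)
    (F : Subgroup Γ) [F.Normal] [F.FiniteIndex] (ψ : F →* Multiplicative ℤ) (g : Γ) (f : F) :
    ψ (MulAut.conjNormal g f) = ψ f := by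
  have key : ∀ j ≤ n, ∀ f : F, (f : Γ) ∈ M j → ∀ g : Γ, ψ (MulAut.conjNormal g f) = ψ f := by
    intro j
    induction j with
    | zero =>
      intro _ f hf g
      have : f = 1 := Subtype.ext (by simpa [h0] using hf)
      simp [this]
    | succ j ih =>
      intro hj f hf g
      let c : F := MulAut.conjNormal g f * f⁻¹
      have hcM : (c : Γ) ∈ M j := by
        simpa [c] using hc j (by omega) g f hf
      have hcf : MulAut.conjNormal g f = c * f := by simp [c]
      have hpow : ∀ i : ℕ, ψ (MulAut.conjNormal (g ^ i) f) = ψ c ^ i * ψ f := by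
        intro i
        induction i with
        | zero => simp
        | succ i ihi =>
          rw [pow_succ, map_mul, MulAut.mul_apply, hcf, map_mul, map_mul, ihi,
            ih (by omega) c hcM, pow_succ', mul_assoc]
      obtain ⟨m, hm, hmF⟩ := F.exists_pow_mem_of_index_ne_zero FiniteIndex.index_ne_zero g
      have h1 : MulAut.conjNormal (g ^ m) f = ⟨g ^ m, hmF.2⟩ * f * ⟨g ^ m, hmF.2⟩⁻¹ :=
        Subtype.ext (by rw [MulAut.conjNormal_apply]; rfl)
      have h2 := hpow m
      rw [h1, map_mul, map_mul, map_inv, mul_right_comm, mul_inv_cancel, one_mul,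
        right_eq_mul] at h2
      have h3 : ψ c = 1 := by
        have := (pow_eq_one_iff_left (M := Multiplicative ℤ) (by omega : m ≠ 0)).1 h2
        exact this
      rw [hcf, map_mul, h3, one_mul]
  exact key n le_rfl f (hn ▸ mem_top _) g

theorem eq_one_of_central_series (h0 : M 0 = ⊥) (hn : M n = ⊤)
    (hc : ∀ i < n, ∀ g, ∀ x ∈ M (i + 1), g * x * g⁻¹ * x⁻¹ ∈ M i)
    {H : Subgroup Γ} {x : Γ} {k : ℕ} (hk : k ≠ 0) (hx : x ^ k ∈ H) (hH : H ⊔ zpowers x = ⊤)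
    (F : Subgroup Γ) [F.Normal] [F.FiniteIndex] (ψ : F →* Multiplicative ℤ)
    (hψ : ∀ f : F, (f : Γ) ∈ H → ψ f = 1) (f : F) : ψ f = 1 := by
  classical
  have hfin : Finite (Γ ⧸ F) := F.finite_quotient_of_finiteIndex
  have hinv := map_conjNormal_of_central_series h0 hn hc F ψ
  have hconj : ∀ (q y : Γ) (hy : y ∈ F) (hqy : q⁻¹ * y * q ∈ F),
      ψ ⟨q⁻¹ * y * q, hqy⟩ = ψ ⟨y, hy⟩ := by
    intro q y hy hqy
    rw [← hinv q⁻¹ ⟨y, hy⟩]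
    congr 1
    exact Subtype.ext (by simp)
  have hmem : ∀ q y : Γ, q⁻¹ * y * q ∈ F → y ∈ F := fun q y h => by
    have := (inferInstance : F.Normal).conj_mem _ h q
    convert this using 1
    group
  have hTH : ∀ h ∈ H, MonoidHom.transfer ψ h = 1 := by
    intro h hh
    have : Fintype (Quotient (MulAction.orbitRel (zpowers h) (Γ ⧸ F))) := Fintype.ofFinite _
    rw [MonoidHom.transfer_eq_prod_quotient_orbitRel_zpowers_quot]
    refine Finset.prod_eq_one fun q _ => ?_
    generalize_proofs _ hp
    rw [hconj _ _ (hmem _ _ hp)]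
    exact hψ _ (H.pow_mem hh _)
  have hTx : MonoidHom.transfer ψ x = 1 := by
    have := hTH _ hx
    rw [map_pow] at this
    exact (pow_eq_one_iff_left (M := Multiplicative ℤ) hk).1 this
  have hT : ∀ y, MonoidHom.transfer ψ y = 1 := by
    intro y
    have hle : H ⊔ zpowers x ≤ (MonoidHom.transfer ψ).ker :=
      sup_le (fun h hh => hTH h hh) (by simpa using hTx)
    exact hle (hH ▸ mem_top y)
  have h1 := hT f
  have : Fintype (Quotient (MulAction.orbitRel (zpowers (f : Γ)) (Γ ⧸ F))) := Fintype.ofFinite _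
  rw [MonoidHom.transfer_eq_prod_quotient_orbitRel_zpowers_quot] at h1
  have h2 : ∏ q : Quotient (MulAction.orbitRel (zpowers (f : Γ)) (Γ ⧸ F)),
      ψ f ^ Function.minimalPeriod ((f : Γ) • ·) q.out = 1 := by
    rw [← h1]
    refine Finset.prod_congr rfl fun q _ => ?_
    generalize_proofs _ hp
    rw [hconj _ _ (hmem _ _ hp), ← map_pow]
    rfl
  rw [Finset.prod_pow_eq_pow_sum] at h2
  refine (pow_eq_one_iff_left (M := Multiplicative ℤ) ?_).1 h2
  refine (Finset.sum_pos (fun q _ => ?_) ⟨Quotient.mk _ ((1 : Γ) : Γ ⧸ F), Finset.mem_univ _⟩).ne'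
  exact Nat.pos_of_ne_zero (NeZero.ne _)

theorem finiteIndex_of_central_series (h0 : M 0 = ⊥) (hn : M n = ⊤) (hmono : Monotone M)
    (hnorm : ∀ i, (M i).Normal) (hstep : ∀ i, ∃ b, M (i + 1) = M i ⊔ zpowers b)
    (hc : ∀ i < n, ∀ g, ∀ x ∈ M (i + 1), g * x * g⁻¹ * x⁻¹ ∈ M i)
    {H : Subgroup Γ} {x : Γ} {k : ℕ} (hk : k ≠ 0) (hx : x ^ k ∈ H) (hH : H ⊔ zpowers x = ⊤) :
    H.FiniteIndex := by
  have key : ∀ j ≤ n, (H ⊔ M j).FiniteIndex → H.FiniteIndex := by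
    intro j
    induction j with
    | zero => intro _ h; simpa [h0] using h
    | succ j ih =>
      intro hj hfi
      refine ih (by omega) ?_
      set L := H ⊔ M j with hL
      set F := H ⊔ M (j + 1) with hF
      have hLF : L ≤ F := sup_le_sup_left (hmono j.le_succ) _
      have hFN : F ≤ normalizer (L : Set Γ) := by
        refine sup_le (le_sup_left.trans le_normalizer) ?_
        have hsub : ∀ y ∈ M (j + 1), ∀ h ∈ L, y * h * y⁻¹ ∈ L := by
          intro y hy h hh
          have h1 : h⁻¹ * y⁻¹ * h * y ∈ M j := by
            have := hc j (by omega) h⁻¹ y⁻¹ (inv_mem hy)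
            simpa using this
          have h2 : y * h * y⁻¹ = h * (y * (h⁻¹ * y⁻¹ * h * y)⁻¹ * y⁻¹)⁻¹⁻¹ := by group
          rw [h2, inv_inv]
          refine mul_mem hh (mem_sup_right ((hnorm j).conj_mem _ (inv_mem h1) _))
        intro y hy
        rw [mem_normalizer_iff]
        refine fun h => ⟨hsub y hy h, fun hh => ?_⟩
        have := hsub y⁻¹ (inv_mem hy) _ hh
        convert this using 1
        group
      have hnormal : (L.subgroupOf F).Normal := (normal_subgroupOf_iff_le_normalizer hLF).2 hFN
      by_contra hinf
      obtain ⟨b, hb⟩ := hstep j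
      have hbF : b ∈ F := mem_sup_right (hb ▸ mem_sup_right (mem_zpowers b))
      have hcyc : IsCyclic (F ⧸ L.subgroupOf F) := by
        let π := QuotientGroup.mk' (L.subgroupOf F)
        refine ⟨⟨π ⟨b, hbF⟩, fun q => ?_⟩⟩
        obtain ⟨y, rfl⟩ := QuotientGroup.mk'_surjective _ q
        let K : Subgroup Γ := ((zpowers (π ⟨b, hbF⟩)).comap π).map F.subtype
        have hLK : L ≤ K := fun l hl => ⟨⟨l, hLF hl⟩, by
          have : π ⟨l, hLF hl⟩ = 1 := (QuotientGroup.eq_one_iff _).2 hl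
          simp only [SetLike.mem_coe, mem_comap, this]
          exact one_mem _, rfl⟩
        have hFK : F ≤ K := by
          rw [hF, hb, ← sup_assoc]
          refine sup_le hLK ?_
          rw [zpowers_le]
          exact ⟨⟨b, hbF⟩, mem_zpowers (π ⟨b, hbF⟩), rfl⟩
        obtain ⟨z, hz, hzy⟩ := hFK y.2
        have : z = y := Subtype.ext hzy
        exact this ▸ hz
      have hQ : Infinite (F ⧸ L.subgroupOf F) := by
        by_contra hQ
        rw [not_infinite_iff_finite] at hQ
        refine hinf ⟨?_⟩
        rw [← relIndex_mul_index hLF]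
        exact mul_ne_zero (Nat.card_pos (α := F ⧸ L.subgroupOf F)).ne' hfi.index_ne_zero
      let φ : F →* Multiplicative ℤ :=
        (intCyclicMulEquiv (G := F ⧸ L.subgroupOf F)).symm.toMonoidHom.comp
          (QuotientGroup.mk' (L.subgroupOf F))
      have hφ : ∀ f, φ f = 1 ↔ (f : Γ) ∈ L := fun f => by
        simp only [φ, MonoidHom.comp_apply, MulEquiv.coe_toMonoidHom, map_eq_one_iff _ (MulEquiv.injective _)]
        exact QuotientGroup.eq_one_iff f
      have := eq_one_of_central_series h0 hn hc hk hx hH F.normalCore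
        (φ.comp (inclusion F.normalCore_le))
        (fun f hf => (hφ _).2 (mem_sup_left hf))
      refine hinf (finiteIndex_of_le (H := F.normalCore) fun f hf => ?_)
      exact (hφ _).1 (this ⟨f, hf⟩)
  refine key n le_rfl ?_
  rw [hn, sup_top_eq]
  infer_instance

end Isolator

theorem CyclicSeries.relIndex_ne_zero_of_pow_mem {G : Type*} [Group G] {n : ℕ}
    {M : ℕ → Subgroup G} (hM : CyclicSeries G n M)
    {H : Subgroup G} (hH : H ≤ factorCentralizer n M hM.normal) {x : G}
    (hx : x ∈ factorCentralizer n M hM.normal) {k : ℕ} (hk : k ≠ 0) (hxk : x ^ k ∈ H) :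
    H.relIndex (H ⊔ zpowers x) ≠ 0 := by
  set Γ := H ⊔ zpowers x with hΓ
  have hΓN : Γ ≤ factorCentralizer n M hM.normal := sup_le hH (by simpa using hx)
  have hxΓ : x ∈ Γ := mem_sup_right (mem_zpowers x)
  have hs := hM.subgroupOf Γ
  refine (finiteIndex_of_central_series hs.zero hs.top hs.mono hs.normal hs.step
    (fun i hi g y hy => hΓN g.2 i hi y hy) (H := H.subgroupOf Γ) (x := ⟨x, hxΓ⟩) hk hxk
    ?_).index_ne_zero
  rw [eq_top_iff]
  intro y _
  have hle : Γ ≤ (H.subgroupOf Γ ⊔ zpowers (⟨x, hxΓ⟩ : Γ)).map Γ.subtype := by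
    refine sup_le (fun h hh => ⟨⟨h, mem_sup_left hh⟩, mem_sup_left hh, rfl⟩) ?_
    rw [zpowers_le]
    exact ⟨⟨x, hxΓ⟩, mem_sup_right (mem_zpowers _), rfl⟩
  obtain ⟨z, hz, hzy⟩ := hle y.2
  have : z = y := Subtype.ext hzy
  exact this ▸ hz

end SupersolvableRep

/-! ### Stabilizers, orbits and locally finite parts -/

namespace SupersolvableRep

open Subgroup

section Conj

variable {G : Type*} [Group G]

/-- The conjugate `g P g⁻¹` of a subgroup. -/
def cj (g : G) (P : Subgroup G) : Subgroup G := P.map (MulAut.conj g).toMonoidHom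

theorem mem_cj {g x : G} {P : Subgroup G} : x ∈ cj g P ↔ g⁻¹ * x * g ∈ P := by
  rw [cj, Subgroup.mem_map_equiv]
  simp

theorem cj_mul (g h : G) (P : Subgroup G) : cj (g * h) P = cj g (cj h P) := by
  ext x; simp [mem_cj, mul_assoc]

@[simp] theorem cj_one (P : Subgroup G) : cj 1 P = P := by
  ext x; simp [mem_cj]

theorem cj_eq_iff_mem_normalizer {g : G} {P : Subgroup G} :
    cj g P = P ↔ g ∈ normalizer (P : Set G) := by
  rw [mem_normalizer_iff'', SetLike.ext_iff]
  simp only [mem_cj]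
  exact forall_congr' fun x => iff_comm

theorem cj_mono (g : G) {P Q : Subgroup G} (h : P ≤ Q) : cj g P ≤ cj g Q :=
  Subgroup.map_mono h

theorem cj_normal (g : G) (N : Subgroup G) [hN : N.Normal] : cj g N = N := by
  rw [cj_eq_iff_mem_normalizer, normalizer_eq_top]; trivial

theorem cj_inv_le_iff {g : G} {P Q : Subgroup G} : cj g⁻¹ P ≤ Q ↔ P ≤ cj g Q := by
  constructor
  · intro h
    have := cj_mono g h
    rwa [← cj_mul, mul_inv_cancel, cj_one] at this
  · intro h
    have := cj_mono g⁻¹ h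
    rwa [← cj_mul, inv_mul_cancel, cj_one] at this

theorem relIndex_cj (g : G) (P Q : Subgroup G) : (cj g P).relIndex (cj g Q) = P.relIndex Q :=
  Subgroup.relIndex_map_map_of_injective _ _ (MulAut.conj g).injective

end Conj

variable {G V : Type*} [Group G] [AddCommGroup V] [Module ℂ V] (ρ : Representation ℂ G V)

/-- The stabilizer of a subspace. -/
def stab (Y : Submodule ℂ V) : Subgroup G where
  carrier := {g | Y.map (ρ g) = Y}
  one_mem' := by simp [Module.End.one_eq_id]
  mul_mem' := fun {a b} ha hb => by
    change Y.map (ρ (a * b)) = Y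
    rw [map_mul, Module.End.mul_eq_comp, Submodule.map_comp, hb, ha]
  inv_mem' := fun {a} (ha : Y.map (ρ a) = Y) => by
    change Y.map (ρ a⁻¹) = Y
    conv_lhs => rw [← ha]
    rw [← Submodule.map_comp, ← Module.End.mul_eq_comp, ← map_mul, inv_mul_cancel, map_one,
      Module.End.one_eq_id, Submodule.map_id]

variable {ρ}

theorem rep_mul_apply (g h : G) (v : V) : ρ (g * h) v = ρ g (ρ h v) := by
  rw [map_mul, Module.End.mul_apply]

@[simp] theorem rep_inv_apply_self (g : G) (v : V) : ρ g⁻¹ (ρ g v) = v := by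
  rw [← rep_mul_apply, inv_mul_cancel, map_one, Module.End.one_apply]

@[simp] theorem rep_apply_inv_self (g : G) (v : V) : ρ g (ρ g⁻¹ v) = v := by
  rw [← rep_mul_apply, mul_inv_cancel, map_one, Module.End.one_apply]

theorem rep_apply_eq_zero_iff (g : G) {v : V} : ρ g v = 0 ↔ v = 0 := by
  refine ⟨fun h => ?_, fun h => by simp [h]⟩
  rw [← rep_inv_apply_self (ρ := ρ) g v, h, map_zero]

theorem rep_map_map (g h : G) (Y : Submodule ℂ V) :
    (Y.map (ρ h)).map (ρ g) = Y.map (ρ (g * h)) := by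
  rw [map_mul, Module.End.mul_eq_comp, Submodule.map_comp]

@[simp] theorem rep_map_one (Y : Submodule ℂ V) : Y.map (ρ 1) = Y := by
  rw [map_one, Module.End.one_eq_id, Submodule.map_id]

theorem mem_rep_map {g : G} {Y : Submodule ℂ V} {v : V} : v ∈ Y.map (ρ g) ↔ ρ g⁻¹ v ∈ Y := by
  constructor
  · rintro ⟨y, hy, rfl⟩
    simpa using hy
  · intro h
    exact ⟨_, h, by simp⟩

theorem mem_stab {Y : Submodule ℂ V} {g : G} : g ∈ stab ρ Y ↔ Y.map (ρ g) = Y := Iff.rfl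

theorem apply_mem_of_mem_stab {Y : Submodule ℂ V} {g : G} (hg : g ∈ stab ρ Y) {v : V}
    (hv : v ∈ Y) : ρ g v ∈ Y := by
  rw [← mem_stab.1 hg]
  exact ⟨v, hv, rfl⟩

theorem le_stab_iff {Y : Submodule ℂ V} {P : Subgroup G} :
    P ≤ stab ρ Y ↔ ∀ p ∈ P, ∀ v ∈ Y, ρ p v ∈ Y := by
  refine ⟨fun h p hp v hv => apply_mem_of_mem_stab (h hp) hv, fun h p hp => ?_⟩
  rw [mem_stab]
  apply le_antisymm
  · rintro _ ⟨v, hv, rfl⟩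
    exact h p hp v hv
  · intro v hv
    exact mem_rep_map.2 (h _ (inv_mem hp) v hv)

theorem stab_inf_le (Y Z : Submodule ℂ V) : stab ρ Y ⊓ stab ρ Z ≤ stab ρ (Y ⊓ Z) :=
  le_stab_iff.2 fun _ hg _ hv =>
    ⟨apply_mem_of_mem_stab hg.1 hv.1, apply_mem_of_mem_stab hg.2 hv.2⟩

theorem stab_sup_le (Y Z : Submodule ℂ V) : stab ρ Y ⊓ stab ρ Z ≤ stab ρ (Y ⊔ Z) := by
  intro g hg
  rw [mem_stab, Submodule.map_sup, hg.1, hg.2]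

theorem mem_stab_map {Y : Submodule ℂ V} {g x : G} :
    x ∈ stab ρ (Y.map (ρ g)) ↔ g⁻¹ * x * g ∈ stab ρ Y := by
  rw [mem_stab, mem_stab, rep_map_map]
  constructor
  · intro h
    have := congrArg (Submodule.map (ρ g⁻¹)) h
    rwa [rep_map_map, rep_map_map, inv_mul_cancel, rep_map_one, ← mul_assoc] at this
  · intro h
    have := congrArg (Submodule.map (ρ g)) h
    rwa [rep_map_map, ← mul_assoc, ← mul_assoc, mul_inv_cancel, one_mul] at this

variable (ρ) in
/-- The span of the translates of a subspace under a subgroup. -/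
def orb (L : Subgroup G) (W : Submodule ℂ V) : Submodule ℂ V := ⨆ g : L, W.map (ρ g)

theorem map_le_orb {L : Subgroup G} (W : Submodule ℂ V) {g : G} (hg : g ∈ L) :
    W.map (ρ g) ≤ orb ρ L W := le_iSup (fun g : L => W.map (ρ g)) ⟨g, hg⟩

theorem le_orb (L : Subgroup G) (W : Submodule ℂ V) : W ≤ orb ρ L W :=
  (rep_map_one W).ge.trans (map_le_orb (ρ := ρ) W (one_mem L))

theorem orb_induction {L : Subgroup G} {W : Submodule ℂ V} {p : V → Prop}
    (hmap : ∀ g ∈ L, ∀ w ∈ W, p (ρ g w)) (hadd : ∀ u v, p u → p v → p (u + v)) (hz : p 0)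
    {u : V} (hu : u ∈ orb ρ L W) : p u := by
  refine Submodule.iSup_induction (motive := p) _ hu ?_ hz hadd
  rintro ⟨g, hg⟩ _ ⟨w, hw, rfl⟩
  exact hmap g hg w hw

theorem orb_le_iff {L : Subgroup G} {W Y : Submodule ℂ V} (hY : L ≤ stab ρ Y) :
    orb ρ L W ≤ Y ↔ W ≤ Y := by
  refine ⟨fun h => (le_orb L W).trans h, fun h => iSup_le fun g => ?_⟩
  exact (Submodule.map_mono h).trans (hY g.2).le

theorem normalizer_le_stab_orb {L Q : Subgroup G} {W : Submodule ℂ V} (hQ : Q ≤ stab ρ W)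
    (hL : Q ≤ normalizer (L : Set G)) : Q ≤ stab ρ (orb ρ L W) := by
  refine le_stab_iff.2 fun q hq v hv => ?_
  refine orb_induction (p := fun v => ρ q v ∈ orb ρ L W) (fun g hg w hw => ?_)
    (fun u v hu hv => by rw [map_add]; exact add_mem hu hv) (by simp) hv
  rw [← rep_mul_apply, show q * g = q * g * q⁻¹ * q by group, rep_mul_apply]
  exact map_le_orb W ((mem_normalizer_iff.1 (hL hq) g).1 hg)
    ⟨_, apply_mem_of_mem_stab (hQ hq) hw, rfl⟩

theorem le_stab_orb (L : Subgroup G) (W : Submodule ℂ V) : L ≤ stab ρ (orb ρ L W) := by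
  refine le_stab_iff.2 fun q hq v hv => ?_
  refine orb_induction (p := fun v => ρ q v ∈ orb ρ L W) (fun g hg w hw => ?_)
    (fun u v hu hv => by rw [map_add]; exact add_mem hu hv) (by simp) hv
  rw [← rep_mul_apply]
  exact map_le_orb W (mul_mem hq hg) ⟨_, hw, rfl⟩

variable (ρ) in
/-- The vectors on which a subgroup acts locally finitely. -/
def finPart (P : Subgroup G) : Submodule ℂ V where
  carrier := {v | ∃ Y : Submodule ℂ V, FiniteDimensional ℂ Y ∧ P ≤ stab ρ Y ∧ v ∈ Y}
  zero_mem' := ⟨⊥, inferInstance, le_stab_iff.2 (by simp), zero_mem _⟩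
  add_mem' := by
    rintro u v ⟨Y, _, hY, hu⟩ ⟨Z, _, hZ, hv⟩
    exact ⟨Y ⊔ Z, inferInstance, (le_inf hY hZ).trans (stab_sup_le Y Z),
      add_mem (Submodule.mem_sup_left hu) (Submodule.mem_sup_right hv)⟩
  smul_mem' := by
    rintro c v ⟨Y, h, hY, hv⟩
    exact ⟨Y, h, hY, Y.smul_mem c hv⟩

theorem le_finPart {P : Subgroup G} {Y : Submodule ℂ V} [h : FiniteDimensional ℂ Y]
    (hY : P ≤ stab ρ Y) : Y ≤ finPart ρ P := fun _ hv => ⟨Y, h, hY, hv⟩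

theorem finPart_anti {P Q : Subgroup G} (h : P ≤ Q) : finPart ρ Q ≤ finPart ρ P := by
  rintro v ⟨Y, hf, hY, hv⟩
  exact ⟨Y, hf, h.trans hY, hv⟩

theorem apply_mem_finPart_cj {P : Subgroup G} {v : V} (g : G) (hv : v ∈ finPart ρ P) :
    ρ g v ∈ finPart ρ (cj g P) := by
  obtain ⟨Y, hf, hY, hv⟩ := hv
  refine ⟨Y.map (ρ g), inferInstance, fun x hx => ?_, ⟨v, hv, rfl⟩⟩
  rw [mem_stab_map]
  exact hY (mem_cj.1 hx)

theorem apply_mem_finPart_cj_iff {P : Subgroup G} {v : V} (g : G) :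
    ρ g v ∈ finPart ρ (cj g P) ↔ v ∈ finPart ρ P := by
  refine ⟨fun h => ?_, apply_mem_finPart_cj g⟩
  have := apply_mem_finPart_cj g⁻¹ h
  rwa [rep_inv_apply_self, ← cj_mul, inv_mul_cancel, cj_one] at this

theorem map_finPart (g : G) (P : Subgroup G) :
    (finPart ρ P).map (ρ g) = finPart ρ (cj g P) := by
  ext v
  rw [mem_rep_map, ← apply_mem_finPart_cj_iff g, rep_apply_inv_self]

theorem normalizer_le_stab_finPart (P : Subgroup G) :
    normalizer (P : Set G) ≤ stab ρ (finPart ρ P) := by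
  intro g hg
  rw [mem_stab, map_finPart, cj_eq_iff_mem_normalizer.2 hg]

theorem finiteDimensional_orb {P Q : Subgroup G} (hPQ : P.relIndex Q ≠ 0) {Y : Submodule ℂ V}
    [FiniteDimensional ℂ Y] (hY : P ≤ stab ρ Y) : FiniteDimensional ℂ (orb ρ Q Y) := by
  have : (P.subgroupOf Q).FiniteIndex := ⟨hPQ⟩
  have hle : orb ρ Q Y ≤ ⨆ c : Q ⧸ P.subgroupOf Q, Y.map (ρ (c.out : Q)) := by
    refine iSup_le fun q => ?_
    refine le_trans (le_of_eq ?_) (le_iSup _ (q : Q ⧸ P.subgroupOf Q))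
    obtain ⟨p, hp⟩ := QuotientGroup.mk_out_eq_mul (P.subgroupOf Q) q
    have hp' : ((p : Q) : G) ∈ P := p.2
    rw [hp, Subgroup.coe_mul, ← rep_map_map, mem_stab.1 (hY hp')]
  exact Submodule.finiteDimensional_of_le hle

theorem finPart_le_of_relIndex_ne_zero {P Q : Subgroup G} (h : P.relIndex Q ≠ 0) :
    finPart ρ P ≤ finPart ρ Q := by
  rintro v ⟨Y, hf, hY, hv⟩
  exact ⟨orb ρ Q Y, finiteDimensional_orb h hY, le_stab_orb Q Y, le_orb Q Y hv⟩

theorem exists_finiteDimensional_of_le_finPart {P : Subgroup G} {Z : Submodule ℂ V}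
    [FiniteDimensional ℂ Z] (hZ : Z ≤ finPart ρ P) :
    ∃ Y : Submodule ℂ V, FiniteDimensional ℂ Y ∧ P ≤ stab ρ Y ∧ Z ≤ Y := by
  have hfg : Z.FG := (Submodule.fg_iff_finiteDimensional Z).2 inferInstance
  induction Z, hfg using Submodule.fg_induction with
  | singleton x =>
    obtain ⟨Y, hf, hY, hv⟩ := hZ (Submodule.mem_span_singleton_self x)
    exact ⟨Y, hf, hY, by simpa using hv⟩
  | sup Z₁ Z₂ h1 h2 ih1 ih2 =>
    have := (Submodule.fg_iff_finiteDimensional Z₁).1 h1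
    have := (Submodule.fg_iff_finiteDimensional Z₂).1 h2
    obtain ⟨Y, _, hY, hv⟩ := ih1 (le_sup_left.trans hZ)
    obtain ⟨Y', _, hY', hv'⟩ := ih2 (le_sup_right.trans hZ)
    exact ⟨Y ⊔ Y', inferInstance, (le_inf hY hY').trans (stab_sup_le _ _), sup_le_sup hv hv'⟩

theorem mem_finPart_sup {P Q : Subgroup G} (hQ : Q ≤ normalizer (P : Set G)) {v : V}
    (hP : v ∈ finPart ρ P) (hvQ : v ∈ finPart ρ Q) : v ∈ finPart ρ (P ⊔ Q) := by
  obtain ⟨Z, hf, hZ, hv⟩ := hvQ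
  have hst : Q ≤ stab ρ (Z ⊓ finPart ρ P) :=
    (le_inf hZ (hQ.trans (normalizer_le_stab_finPart P))).trans (stab_inf_le _ _)
  have : FiniteDimensional ℂ (Z ⊓ finPart ρ P : Submodule ℂ V) :=
    Submodule.finiteDimensional_of_le inf_le_left
  obtain ⟨Y, hfY, hY, hZY⟩ := exists_finiteDimensional_of_le_finPart
    (P := P) (Z := Z ⊓ finPart ρ P) inf_le_right
  refine ⟨orb ρ P (Z ⊓ finPart ρ P), Submodule.finiteDimensional_of_le ((orb_le_iff hY).2 hZY),
    sup_le (le_stab_orb _ _) (normalizer_le_stab_orb hst hQ), le_orb _ _ ⟨hv, hP⟩⟩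

end SupersolvableRep

/-! ### Blocks -/

namespace SupersolvableRep

open Subgroup

variable {G V : Type*} [Group G] [AddCommGroup V] [Module ℂ V]

/-- `W` is a block for `S ≤ L`: it is stable under `S` and there is a projection `π` onto `W`
killing the translates of `W` by the elements of `L` outside `S`. -/
structure IsBlock (ρ : Representation ℂ G V) (L S : Subgroup G) (W : Submodule ℂ V)
    (π : V →ₗ[ℂ] V) : Prop where
  le : S ≤ L
  stable : S ≤ stab ρ W
  proj_self : ∀ w ∈ W, π w = w
  proj_zero : ∀ g ∈ L, g ∉ S → ∀ w ∈ W, π (ρ g w) = 0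
  proj_mem : ∀ v, π v ∈ W

variable {ρ : Representation ℂ G V} {L S : Subgroup G} {W : Submodule ℂ V} {π : V →ₗ[ℂ] V}

theorem exists_isBlock (hle : S ≤ L) (hst : S ≤ stab ρ W)
    (hd : ∀ Z : Submodule ℂ V, Z ≤ W → Z ≤ ⨆ g : {g : G // g ∈ L ∧ g ∉ S}, W.map (ρ g) → Z = ⊥) :
    ∃ π, IsBlock ρ L S W π := by
  have hdis : Disjoint W (⨆ g : {g : G // g ∈ L ∧ g ∉ S}, W.map (ρ g)) := fun Z h1 h2 =>
    (hd Z h1 h2).le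
  obtain ⟨C, hC, hWC⟩ := hdis.symm.exists_isCompl
  refine ⟨W.projection C hWC.symm, hle, hst, fun w hw => ?_, fun g hg hgS w hw => ?_, fun v => ?_⟩
  · exact Submodule.projection_apply_of_mem_left _ hw
  · refine Submodule.projection_apply_of_mem_right _ (hC ?_)
    exact le_iSup (fun g : {g : G // g ∈ L ∧ g ∉ S} => W.map (ρ g)) ⟨g, hg, hgS⟩ ⟨w, hw, rfl⟩
  · exact Submodule.projection_apply_mem _ _

namespace IsBlock

theorem proj_apply (h : IsBlock ρ L S W π) {s : G} (hs : s ∈ S) {u : V} (hu : u ∈ orb ρ L W) :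
    π (ρ s u) = ρ s (π u) := by
  refine orb_induction (p := fun u => π (ρ s u) = ρ s (π u)) (fun g hg w hw => ?_)
    (fun u v hu hv => by simp [hu, hv]) (by simp) hu
  by_cases hgS : g ∈ S
  · rw [h.proj_self _ (apply_mem_of_mem_stab (h.stable hgS) hw),
      h.proj_self _ (apply_mem_of_mem_stab (h.stable hs)
        (apply_mem_of_mem_stab (h.stable hgS) hw))]
  · rw [h.proj_zero g hg hgS w hw, map_zero, ← rep_mul_apply,
      h.proj_zero _ (mul_mem (h.le hs) hg) (fun hsg => hgS ((S.mul_mem_cancel_left hs).1 hsg)) w hw]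

open Classical in
/-- The component of a vector in the translate of `W` attached to a coset. -/
noncomputable def component (ρ : Representation ℂ G V) (L S : Subgroup G) (π : V →ₗ[ℂ] V)
    (c : G ⧸ S) : V →ₗ[ℂ] V :=
  if c.out ∈ L then ρ c.out ∘ₗ π ∘ₗ ρ c.out⁻¹ else 0

theorem component_apply (h : IsBlock ρ L S W π) {g : G} (hg : g ∈ L) {u : V}
    (hu : u ∈ orb ρ L W) : component ρ L S π g u = ρ g (π (ρ g⁻¹ u)) := by
  obtain ⟨s, hs⟩ := QuotientGroup.mk_out_eq_mul S g
  have hmem : ((g : G ⧸ S)).out ∈ L := hs ▸ mul_mem hg (h.le s.2)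
  rw [component, if_pos hmem, LinearMap.comp_apply, LinearMap.comp_apply, hs, mul_inv_rev,
    rep_mul_apply (s : G)⁻¹, h.proj_apply (inv_mem s.2)
      (apply_mem_of_mem_stab (le_stab_orb L W (inv_mem hg)) hu), rep_mul_apply,
    rep_apply_inv_self]

theorem component_of_notMem (h : IsBlock ρ L S W π) {g : G} (hg : g ∉ L) :
    component ρ L S π g = 0 := by
  obtain ⟨s, hs⟩ := QuotientGroup.mk_out_eq_mul S g
  have hmem : ((g : G ⧸ S)).out ∉ L := fun hm => hg (by
    rw [hs] at hm
    exact (L.mul_mem_cancel_right (h.le s.2)).1 hm)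
  rw [component, if_neg hmem]

theorem finite_support_and_finsum (h : IsBlock ρ L S W π) {u : V} (hu : u ∈ orb ρ L W) :
    (Function.support fun c => component ρ L S π c u).Finite ∧
      ∑ᶠ c, component ρ L S π c u = u := by
  refine orb_induction (p := fun u => (Function.support fun c => component ρ L S π c u).Finite ∧
      ∑ᶠ c, component ρ L S π c u = u) (fun g hg w hw => ?_) (fun u v hu hv => ?_) (by simp) hu
  · have key : ∀ c, c ≠ (g : G ⧸ S) → component ρ L S π c (ρ g w) = 0 := by
      intro c hc
      induction c using QuotientGroup.induction_on with
      | H x =>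
        by_cases hx : x ∈ L
        · rw [h.component_apply hx (map_le_orb W hg ⟨w, hw, rfl⟩), ← rep_mul_apply,
            h.proj_zero _ (mul_mem (inv_mem hx) hg) (fun hS => hc (QuotientGroup.eq.2 hS)) w hw,
            map_zero]
        · rw [h.component_of_notMem hx, LinearMap.zero_apply]
    refine ⟨(Set.finite_singleton (g : G ⧸ S)).subset fun c hc => ?_, ?_⟩
    · by_contra hne
      exact hc (key c hne)
    · rw [finsum_eq_single _ (g : G ⧸ S) key,
        h.component_apply hg (map_le_orb W hg ⟨w, hw, rfl⟩), rep_inv_apply_self,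
        h.proj_self w hw]
  · constructor
    · refine (hu.1.union hv.1).subset fun c hc => ?_
      by_contra hne
      simp only [Set.mem_union, Function.mem_support, not_or, not_not] at hne
      exact hc (by simp [hne.1, hne.2])
    · simp only [map_add]
      rw [finsum_add_distrib hu.1 hv.1, hu.2, hv.2]

theorem eq_zero (h : IsBlock ρ L S W π) {u : V} (hu : u ∈ orb ρ L W)
    (hz : ∀ g ∈ L, π (ρ g⁻¹ u) = 0) : u = 0 := by
  rw [← (h.finite_support_and_finsum hu).2]
  refine finsum_eq_zero_of_forall_eq_zero fun c => ?_
  induction c using QuotientGroup.induction_on with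
  | H x =>
    by_cases hx : x ∈ L
    · rw [h.component_apply hx hu, hz x hx, map_zero]
    · rw [h.component_of_notMem hx, LinearMap.zero_apply]

theorem finite_cosets (h : IsBlock ρ L S W π) {Y : Submodule ℂ V} [FiniteDimensional ℂ Y]
    (hY : Y ≤ orb ρ L W) :
    {c : G ⧸ S | ∃ y ∈ Y, component ρ L S π c y ≠ 0}.Finite := by
  have hfg : Y.FG := (Submodule.fg_iff_finiteDimensional Y).2 inferInstance
  induction Y, hfg using Submodule.fg_induction with
  | singleton x =>
    refine (h.finite_support_and_finsum (hY (Submodule.mem_span_singleton_self x))).1.subset ?_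
    rintro c ⟨y, hy, hc⟩ h0
    obtain ⟨a, rfl⟩ := Submodule.mem_span_singleton.1 hy
    have h0' : component ρ L S π c x = 0 := h0
    exact hc (by rw [map_smul, h0', smul_zero])
  | sup Z₁ Z₂ h1 h2 ih1 ih2 =>
    have := (Submodule.fg_iff_finiteDimensional Z₁).1 h1
    have := (Submodule.fg_iff_finiteDimensional Z₂).1 h2
    refine ((ih1 (le_sup_left.trans hY)).union (ih2 (le_sup_right.trans hY))).subset ?_
    rintro c ⟨y, hy, hc⟩
    obtain ⟨a, ha, b, hb, rfl⟩ := Submodule.mem_sup.1 hy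
    by_contra hne
    simp only [Set.mem_union, Set.mem_ofPred_eq, not_or, not_exists, not_and, not_not] at hne
    exact hc (by rw [map_add, hne.1 a ha, hne.2 b hb, add_zero])

theorem exists_of_mem_finPart (h : IsBlock ρ L S W π) {v : V} (hv : v ∈ orb ρ L W) (hv0 : v ≠ 0)
    {H : Subgroup G} (hH : H ≤ L) (hvH : v ∈ finPart ρ H) :
    ∃ g ∈ L, π (ρ g⁻¹ v) ≠ 0 ∧ (cj g S).relIndex H ≠ 0 ∧
      π (ρ g⁻¹ v) ∈ finPart ρ (S ⊓ cj g⁻¹ H) := by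
  obtain ⟨Y, hf, hY, hvY⟩ := hvH
  have hYs : H ≤ stab ρ (Y ⊓ orb ρ L W) :=
    (le_inf hY (hH.trans (le_stab_orb L W))).trans (stab_inf_le _ _)
  have hfd : FiniteDimensional ℂ (Y ⊓ orb ρ L W : Submodule ℂ V) :=
    Submodule.finiteDimensional_of_le inf_le_left
  have hfin := h.finite_cosets (Y := Y ⊓ orb ρ L W) inf_le_right
  have hex : ∃ g ∈ L, π (ρ g⁻¹ v) ≠ 0 := by
    by_contra hne
    push Not at hne
    exact hv0 (h.eq_zero hv hne)
  obtain ⟨g, hg, hgv⟩ := hex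
  refine ⟨g, hg, hgv, ?_, ?_⟩
  · have horb : (MulAction.orbit H (g : G ⧸ S)).Finite := by
      refine hfin.subset ?_
      rintro _ ⟨x, rfl⟩
      refine ⟨ρ x v, apply_mem_of_mem_stab (hYs x.2) ⟨hvY, hv⟩, ?_⟩
      change component ρ L S π (((x : G) * g : G) : G ⧸ S) _ ≠ 0
      rw [h.component_apply (mul_mem (hH x.2) hg)
        (apply_mem_of_mem_stab (le_stab_orb L W (hH x.2)) hv), mul_inv_rev,
        rep_mul_apply g⁻¹, rep_inv_apply_self, Ne, rep_apply_eq_zero_iff]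
      exact hgv
    have hstab : (cj g S).subgroupOf H = MulAction.stabilizer H (g : G ⧸ S) := by
      ext x
      rw [mem_subgroupOf, mem_cj, MulAction.mem_stabilizer_iff, eq_comm (b := (g : G ⧸ S))]
      change _ ↔ ((g : G) : G ⧸ S) = (((x : G) * g : G) : G ⧸ S)
      rw [QuotientGroup.eq, mul_assoc]
    rw [relIndex, hstab]
    have : Finite (H ⧸ MulAction.stabilizer H (g : G ⧸ S)) := by
      have := horb.to_subtype
      exact Finite.of_equiv _ (MulAction.orbitEquivQuotientStabilizer H (g : G ⧸ S))
    exact (Nat.card_pos (α := H ⧸ MulAction.stabilizer H (g : G ⧸ S))).ne'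
  · refine ⟨(Y ⊓ orb ρ L W).map (π ∘ₗ ρ g⁻¹), inferInstance, ?_, v, ⟨hvY, hv⟩, rfl⟩
    refine le_stab_iff.2 ?_
    rintro s ⟨hs, hsH⟩ _ ⟨y, hy, rfl⟩
    replace hsH : g * s * g⁻¹ ∈ H := by
      have := mem_cj.1 (show s ∈ cj g⁻¹ H from hsH)
      rwa [inv_inv] at this
    refine ⟨ρ (g * s * g⁻¹) y, apply_mem_of_mem_stab (hYs hsH) hy, ?_⟩
    rw [LinearMap.comp_apply, LinearMap.comp_apply, ← h.proj_apply hs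
      (apply_mem_of_mem_stab (le_stab_orb L W (inv_mem hg)) hy.2), ← rep_mul_apply,
      ← rep_mul_apply]
    congr 3
    group

theorem trans (h : IsBlock ρ L S W π) {S₁ : Subgroup G} {W₁ : Submodule ℂ V} {π₁ : V →ₗ[ℂ] V}
    (h₁ : IsBlock ρ S S₁ W₁ π₁) (hW : W₁ ≤ W) : IsBlock ρ L S₁ W₁ (π₁ ∘ₗ π) where
  le := h₁.le.trans h.le
  stable := h₁.stable
  proj_self w hw := by rw [LinearMap.comp_apply, h.proj_self w (hW hw), h₁.proj_self w hw]
  proj_zero g hg hgS w hw := by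
    rw [LinearMap.comp_apply]
    by_cases hgS' : g ∈ S
    · rw [h.proj_self _ (apply_mem_of_mem_stab (h.stable hgS') (hW hw)),
        h₁.proj_zero g hgS' hgS w hw]
    · rw [h.proj_zero g hg hgS' w (hW hw), map_zero]
  proj_mem v := h₁.proj_mem _

theorem mono (h : IsBlock ρ L S W π) {L' : Subgroup G} (hS : S ≤ L') (hL : L' ≤ L) :
    IsBlock ρ L' S W π where
  le := hS
  stable := h.stable
  proj_self := h.proj_self
  proj_zero g hg := h.proj_zero g (hL hg)
  proj_mem := h.proj_mem

end IsBlock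

/-- A representation without proper nonzero stable subspaces. -/
def Irreducible (ρ : Representation ℂ G V) : Prop :=
  ∀ Y : Submodule ℂ V, ⊤ ≤ stab ρ Y → Y = ⊥ ∨ Y = ⊤

theorem Irreducible.orb_eq_top (hρ : Irreducible ρ) (hW : W ≠ ⊥) : orb ρ ⊤ W = ⊤ := by
  refine (hρ _ (le_stab_orb ⊤ W)).resolve_left fun h => hW ?_
  rw [eq_bot_iff, ← h]
  exact le_orb ⊤ W

theorem Irreducible.eq_of_le (hρ : Irreducible ρ) (h : IsBlock ρ ⊤ S W π)
    {W₁ : Submodule ℂ V} (h₁ : W₁ ≤ W) (hne : W₁ ≠ ⊥) (hst : S ≤ stab ρ W₁) : W₁ = W := by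
  refine le_antisymm h₁ fun w hw => ?_
  rw [← h.proj_self w hw]
  have hw' : w ∈ orb ρ ⊤ W₁ := by rw [hρ.orb_eq_top hne]; trivial
  refine orb_induction (p := fun u => π u ∈ W₁) (fun g hg w hw => ?_)
    (fun u v hu hv => by rw [map_add]; exact add_mem hu hv) (by simp) hw'
  by_cases hgS : g ∈ S
  · have := apply_mem_of_mem_stab (hst hgS) hw
    rwa [h.proj_self _ (h₁ this)]
  · rw [h.proj_zero g hg hgS w (h₁ hw)]
    exact zero_mem _

end SupersolvableRep

/-! ### Maximal locally finite subgroups -/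

namespace SupersolvableRep

open Subgroup

variable {G V : Type*} [Group G] [AddCommGroup V] [Module ℂ V]

/-- `P` is maximal among the subgroups of `N` acting locally finitely on a nonzero vector. -/
structure IsMaxFin (ρ : Representation ℂ G V) (N P : Subgroup G) : Prop where
  le : P ≤ N
  ne_bot : finPart ρ P ≠ ⊥
  eq_of_le : ∀ Q, P ≤ Q → Q ≤ N → finPart ρ Q ≠ ⊥ → Q = P

variable {ρ : Representation ℂ G V} {N P : Subgroup G}

theorem exists_isMaxFin [WellFoundedGT (Subgroup G)] [Nontrivial V] (ρ : Representation ℂ G V)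
    (N : Subgroup G) : ∃ P, IsMaxFin ρ N P := by
  have hbot : (⊥ : Subgroup G) ∈ {P : Subgroup G | P ≤ N ∧ finPart ρ P ≠ ⊥} := by
    refine ⟨bot_le, fun h => ?_⟩
    obtain ⟨v, hv⟩ := exists_ne (0 : V)
    have : v ∈ finPart ρ (⊥ : Subgroup G) :=
      ⟨ℂ ∙ v, inferInstance, bot_le, Submodule.mem_span_singleton_self v⟩
    rw [h] at this
    exact hv ((Submodule.mem_bot ℂ).1 this)
  obtain ⟨P, hP, hmax⟩ := WellFounded.has_min (wellFounded_gt (α := Subgroup G)) _ ⟨⊥, hbot⟩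
  refine ⟨P, hP.1, hP.2, fun Q hPQ hQN hQ => ?_⟩
  by_contra hne
  exact hmax Q ⟨hQN, hQ⟩ (lt_of_le_of_ne hPQ (Ne.symm hne))

namespace IsMaxFin

theorem conj [hN : N.Normal] (h : IsMaxFin ρ N P) (g : G) : IsMaxFin ρ N (cj g P) where
  le := by
    have := cj_mono g h.le
    rwa [cj_normal g N] at this
  ne_bot hb := by
    rw [← map_finPart] at hb
    apply h.ne_bot
    have := congrArg (Submodule.map (ρ g⁻¹)) hb
    rwa [rep_map_map, inv_mul_cancel, rep_map_one, Submodule.map_bot] at this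
  eq_of_le Q hPQ hQN hQ := by
    have h1 : P ≤ cj g⁻¹ Q := by
      have := cj_mono g⁻¹ hPQ
      rwa [← cj_mul, inv_mul_cancel, cj_one] at this
    have h2 : cj g⁻¹ Q ≤ N := by
      have := cj_mono g⁻¹ hQN
      rwa [cj_normal g⁻¹ N] at this
    have h3 := h.eq_of_le _ h1 h2 (fun hb => hQ (by
      rw [← map_finPart] at hb
      have := congrArg (Submodule.map (ρ g)) hb
      rwa [rep_map_map, mul_inv_cancel, rep_map_one, Submodule.map_bot] at this))
    rw [← h3, ← cj_mul, mul_inv_cancel, cj_one]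

theorem le_of_normalizes (h : IsMaxFin ρ N P) {Q : Subgroup G} (hQN : Q ≤ N)
    (hQ : Q ≤ normalizer (P : Set G)) {v : V} (hv0 : v ≠ 0) (hvP : v ∈ finPart ρ P)
    (hvQ : v ∈ finPart ρ Q) : Q ≤ P := by
  have h1 := mem_finPart_sup hQ hvP hvQ
  have := h.eq_of_le (P ⊔ Q) le_sup_left (sup_le h.le hQN) (fun hb => hv0 (by
    rw [hb] at h1
    exact (Submodule.mem_bot ℂ).1 h1))
  exact le_sup_right.trans this.le

variable {n : ℕ} {M : ℕ → Subgroup G} (hM : CyclicSeries G n M)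

theorem mem_of_pow_mem (h : IsMaxFin ρ (factorCentralizer n M hM.normal) P) {x : G}
    (hx : x ∈ factorCentralizer n M hM.normal) {k : ℕ} (hk : k ≠ 0) (hxk : x ^ k ∈ P) :
    x ∈ P := by
  have h1 := hM.relIndex_ne_zero_of_pow_mem h.le hx hk hxk
  have h2 := h.eq_of_le (P ⊔ zpowers x) le_sup_left (sup_le h.le (by simpa using hx))
    (fun hb => h.ne_bot (eq_bot_iff.2 ((finPart_le_of_relIndex_ne_zero h1).trans hb.le)))
  exact h2 ▸ mem_sup_right (mem_zpowers x)

theorem eq_of_finite_relIndex (h : IsMaxFin ρ (factorCentralizer n M hM.normal) P)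
    {P' P₁ : Subgroup G} (h' : IsMaxFin ρ (factorCentralizer n M hM.normal) P')
    (hle : P₁ ≤ P') (hfin : P₁.relIndex P' ≠ 0) (hnorm : P₁ ≤ normalizer (P : Set G))
    {v : V} (hv0 : v ≠ 0) (hvP : v ∈ finPart ρ P) (hv : v ∈ finPart ρ P₁) : P' = P := by
  have h1 := h.le_of_normalizes (hle.trans h'.le) hnorm hv0 hvP hv
  refine (h'.eq_of_le P (fun p hp => ?_) h.le h.ne_bot).symm
  have : (P₁.subgroupOf P').FiniteIndex := ⟨hfin⟩
  obtain ⟨k, hk, hpk⟩ := (P₁.subgroupOf P').exists_pow_mem_of_index_ne_zero hfin ⟨p, hp⟩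
  exact h.mem_of_pow_mem hM (h'.le hp) hk.ne' (h1 hpk.2)

end IsMaxFin

/-- The image of the group algebra of a subgroup. -/
def gen (ρ : Representation ℂ G V) (D : Subgroup G) : Subalgebra ℂ (V →ₗ[ℂ] V) :=
  Algebra.adjoin ℂ (ρ '' D)

theorem gen_mono {D D' : Subgroup G} (h : D ≤ D') : gen ρ D ≤ gen ρ D' :=
  Algebra.adjoin_mono (Set.image_mono h)

theorem rep_mem_gen {D : Subgroup G} {g : G} (hg : g ∈ D) : ρ g ∈ gen ρ D :=
  Algebra.subset_adjoin ⟨g, hg, rfl⟩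

theorem gen_apply_mem {D : Subgroup G} {a : V →ₗ[ℂ] V} (ha : a ∈ gen ρ D) {Y : Submodule ℂ V}
    (hY : D ≤ stab ρ Y) {y : V} (hy : y ∈ Y) : a y ∈ Y := by
  induction ha using Algebra.adjoin_induction generalizing y with
  | mem x hx =>
    obtain ⟨g, hg, rfl⟩ := hx
    exact apply_mem_of_mem_stab (hY hg) hy
  | algebraMap r => exact Y.smul_mem r hy
  | add a b _ _ iha ihb => exact add_mem (iha hy) (ihb hy)
  | mul a b _ _ iha ihb => exact iha (ihb hy)

theorem conj_mem_gen {D : Subgroup G} {n : G} (hn : n ∈ normalizer (D : Set G))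
    {a : V →ₗ[ℂ] V} (ha : a ∈ gen ρ D) : ρ n * a * ρ n⁻¹ ∈ gen ρ D := by
  have hinv : ρ n⁻¹ * ρ n = 1 := by rw [← map_mul, inv_mul_cancel, map_one]
  have hinv' : ρ n * ρ n⁻¹ = 1 := by rw [← map_mul, mul_inv_cancel, map_one]
  induction ha using Algebra.adjoin_induction with
  | mem x hx =>
    obtain ⟨g, hg, rfl⟩ := hx
    rw [← map_mul, ← map_mul]
    exact rep_mem_gen ((mem_normalizer_iff.1 hn g).1 hg)
  | algebraMap r =>
    rw [← Algebra.commutes, mul_assoc, hinv', mul_one]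
    exact Subalgebra.algebraMap_mem _ r
  | add a b _ _ iha ihb =>
    rw [mul_add, add_mul]
    exact add_mem iha ihb
  | mul a b _ _ iha ihb =>
    have : ρ n * (a * b) * ρ n⁻¹ = (ρ n * a * ρ n⁻¹) * (ρ n * b * ρ n⁻¹) := by
      simp only [mul_assoc]
      rw [← mul_assoc (ρ n⁻¹), hinv, one_mul]
    rw [this]
    exact mul_mem iha ihb

theorem exists_gen_separating {P : Subgroup G} {v y : V} (hv : v ∈ finPart ρ P)
    (hy : y ∉ finPart ρ P) : ∃ a ∈ gen ρ P, a v = 0 ∧ a y ≠ 0 := by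
  by_contra hne
  push Not at hne
  let ev : V → gen ρ P →ₗ[ℂ] V := fun u =>
    (LinearMap.applyₗ u).comp (gen ρ P).val.toLinearMap
  have hev : ∀ u a, ev u a = (a : V →ₗ[ℂ] V) u := fun u a => rfl
  obtain ⟨Y, hf, hY, hvY⟩ := hv
  have h1 : FiniteDimensional ℂ (LinearMap.range (ev v)) := by
    refine Submodule.finiteDimensional_of_le (S₂ := Y) ?_
    rintro _ ⟨a, rfl⟩
    exact gen_apply_mem a.2 hY hvY
  have h2 : FiniteDimensional ℂ (gen ρ P ⧸ LinearMap.ker (ev v)) :=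
    Module.Finite.equiv (ev v).quotKerEquivRange.symm
  have hker : LinearMap.ker (ev v) ≤ LinearMap.ker (ev y) := fun a ha => hne a a.2 ha
  have h3 : FiniteDimensional ℂ (LinearMap.range (ev y)) := by
    rw [← Submodule.range_liftQ _ _ hker]
    infer_instance
  refine hy ⟨LinearMap.range (ev y), h3, le_stab_iff.2 ?_, 1, ?_⟩
  · rintro p hp _ ⟨a, rfl⟩
    exact ⟨⟨ρ p, rep_mem_gen hp⟩ * a, rfl⟩
  · rfl

theorem exists_finsupp_of_mem_iSup {L : Subgroup G} {U : Submodule ℂ V} (hU : L ≤ stab ρ U)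
    {ι : Type*} (t : ι → G) (C : Set (G ⧸ L)) (ht : ∀ i, (t i : G ⧸ L) ∈ C) {u : V}
    (hu : u ∈ ⨆ i, U.map (ρ (t i))) :
    ∃ f : (G ⧸ L) →₀ V, (∀ c ∈ f.support, c ∈ C) ∧ (∀ c, f c ∈ U.map (ρ c.out)) ∧
      u = f.sum fun _ x => x := by
  classical
  refine Submodule.iSup_induction (motive := fun u => ∃ f : (G ⧸ L) →₀ V,
    (∀ c ∈ f.support, c ∈ C) ∧ (∀ c, f c ∈ U.map (ρ c.out)) ∧ u = f.sum fun _ x => x)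
    _ hu ?_ ?_ ?_
  · intro i x hx
    refine ⟨Finsupp.single (t i : G ⧸ L) x, fun c hc => ?_, fun c => ?_, ?_⟩
    · have := Finsupp.support_single_subset hc
      rw [Finset.mem_singleton] at this
      exact this ▸ ht i
    · by_cases hc : (t i : G ⧸ L) = c
      · subst hc
        rw [Finsupp.single_eq_same]
        obtain ⟨l, hl⟩ := QuotientGroup.mk_out_eq_mul L (t i)
        rwa [hl, ← rep_map_map, mem_stab.1 (hU l.2)]
      · rw [Finsupp.single_eq_of_ne (Ne.symm hc)]
        exact zero_mem _
    · simp
  · exact ⟨0, by simp, by simp, by simp⟩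
  · rintro _ _ ⟨f, hf, hf', rfl⟩ ⟨g, hg, hg', rfl⟩
    refine ⟨f + g, fun c hc => ?_, fun c => ?_, ?_⟩
    · rcases Finset.mem_union.1 (Finsupp.support_add hc) with h | h
      exacts [hf c h, hg c h]
    · exact add_mem (hf' c) (hg' c)
    · rw [Finsupp.sum_add_index'] <;> simp

end SupersolvableRep

/-! ### Blocks from maximal locally finite subgroups -/

namespace SupersolvableRep

open Subgroup

variable {G V : Type*} [Group G] [AddCommGroup V] [Module ℂ V]
variable {ρ : Representation ℂ G V} {P L L' D : Subgroup G} {π : V →ₗ[ℂ] V}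
variable {n : ℕ} {M : ℕ → Subgroup G} (hM : CyclicSeries G n M)

theorem le_normalizer_of_cj_le {K D : Subgroup G} (h : ∀ x ∈ K, cj x D ≤ D) :
    K ≤ normalizer (D : Set G) := fun x hx => by
  rw [← cj_eq_iff_mem_normalizer]
  exact le_antisymm (h x hx) (cj_inv_le_iff.1 (h _ (inv_mem hx)))

theorem exists_conj_gen {D : Subgroup G} {m : G} (hm : m ∈ normalizer (D : Set G))
    {a : V →ₗ[ℂ] V} (ha : a ∈ gen ρ D) : ∃ b ∈ gen ρ D, ∀ v, b (ρ m v) = ρ m (a v) :=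
  ⟨_, conj_mem_gen hm ha, fun v => by simp [Module.End.mul_apply]⟩

/-- The group algebra of `D` moves every nonzero vector of the span of the `L`-translates of
`finPart ρ P` to a nonzero vector of a single translate. -/
def Separates (ρ : Representation ℂ G V) (P L D : Subgroup G) : Prop :=
  ∀ u ∈ orb ρ L (finPart ρ P), u ≠ 0 →
    ∃ a ∈ gen ρ D, ∃ g ∈ L, a u ∈ (finPart ρ P).map (ρ g) ∧ a u ≠ 0

theorem IsMaxFin.mem_of_mem_finPart_cj
    (h : IsMaxFin ρ (factorCentralizer n M hM.normal) P)
    (hB : IsBlock ρ L (normalizer (P : Set G)) (finPart ρ P) π) {n₁ n₂ g : G} (hg : g ∈ L)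
    (hH : cj n₂⁻¹ (cj (n₁ * g) P) ≤ L) {y : V} (hy : y ∈ (orb ρ L (finPart ρ P)).map (ρ n₂))
    (hy0 : y ≠ 0) (hyP : y ∈ finPart ρ (cj (n₁ * g) P)) : n₂⁻¹ * n₁ ∈ L := by
  have hN := factorCentralizer_normal (n := n) hM.normal
  obtain ⟨g', hg', hz, hidx, hzf⟩ := hB.exists_of_mem_finPart (v := ρ n₂⁻¹ y)
    (mem_rep_map.1 hy) (by rwa [Ne, rep_apply_eq_zero_iff]) hH (apply_mem_finPart_cj _ hyP)
  have h2 := ((h.conj (n₁ * g)).conj n₂⁻¹).conj g'⁻¹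
  have heq := h.eq_of_finite_relIndex hM h2 inf_le_right (by
    rw [inf_relIndex_right, ← relIndex_cj g', ← cj_mul g' g'⁻¹, mul_inv_cancel, cj_one]
    exact hidx) inf_le_left hz (hB.proj_mem _) hzf
  rw [← cj_mul, ← cj_mul, cj_eq_iff_mem_normalizer] at heq
  have := hB.le heq
  rwa [← mul_assoc, L.mul_mem_cancel_right hg, mul_assoc,
    L.mul_mem_cancel_left (inv_mem hg')] at this

theorem IsMaxFin.exists_gen_isolating
    (h : IsMaxFin ρ (factorCentralizer n M hM.normal) P)
    (hB : IsBlock ρ L (normalizer (P : Set G)) (finPart ρ P) π) (hS : Separates ρ P L D)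
    (hLL : L ≤ L') (hDL : D ≤ L) (hPD : P ≤ D) (hD : L' ≤ normalizer (D : Set G))
    (f : (G ⧸ L) →₀ V) (hf : ∀ c ∈ f.support, c.out ∈ L')
    (hfU : ∀ c, f c ∈ (orb ρ L (finPart ρ P)).map (ρ c.out)) (hf0 : f ≠ 0) :
    ∃ a ∈ gen ρ D, ∃ c₀ ∈ f.support, a (f c₀) ≠ 0 ∧ ∀ c ≠ c₀, a (f c) = 0 := by
  induction hk : f.support.card using Nat.strong_induction_on generalizing f with
  | _ k ih =>
  obtain ⟨c₁, hc₁⟩ := Finsupp.ne_iff.1 hf0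
  replace hc₁ : f c₁ ≠ 0 := hc₁
  by_cases hone : ∀ c ≠ c₁, f c = 0
  · exact ⟨1, one_mem _, c₁, Finsupp.mem_support_iff.2 hc₁, hc₁, fun c hc => hone c hc⟩
  push Not at hone
  obtain ⟨c₂, hne, hc₂⟩ := hone
  have hm₁ := hf c₁ (Finsupp.mem_support_iff.2 hc₁)
  have hm₂ := hf c₂ (Finsupp.mem_support_iff.2 hc₂)
  have hgenU : ∀ c ∈ f.support, ∀ a ∈ gen ρ D,
      a (f c) ∈ (orb ρ L (finPart ρ P)).map (ρ c.out) := fun c hc a ha =>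
    gen_apply_mem ha (fun x hx => mem_stab_map.2 (le_stab_orb L _ (hDL
      ((mem_normalizer_iff''.1 (hD (hf c hc)) x).1 hx)))) (hfU c)
  have hconj : ∀ x ∈ L', cj x P ≤ D := fun x hx =>
    (cj_mono x hPD).trans (cj_eq_iff_mem_normalizer.2 (hD hx)).le
  have hb : ∃ b ∈ gen ρ D, (∃ c ∈ f.support, b (f c) = 0) ∧ ∃ c, b (f c) ≠ 0 := by
    obtain ⟨a₀, ha₀, g, hg, hag, ha0⟩ := hS (ρ c₁.out⁻¹ (f c₁)) (mem_rep_map.1 (hfU c₁))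
      (by rwa [Ne, rep_apply_eq_zero_iff])
    obtain ⟨a, ha, hav⟩ := exists_conj_gen (hD hm₁) ha₀
    have hac₁ : a (f c₁) = ρ c₁.out (a₀ (ρ c₁.out⁻¹ (f c₁))) := by
      rw [← hav, rep_apply_inv_self]
    have hac₁0 : a (f c₁) ≠ 0 := by rwa [hac₁, Ne, rep_apply_eq_zero_iff]
    by_cases hac₂ : a (f c₂) = 0
    · exact ⟨a, ha, ⟨c₂, Finsupp.mem_support_iff.2 hc₂, hac₂⟩, c₁, hac₁0⟩
    · have hP' : cj (c₁.out * g) P ≤ D := hconj _ (mul_mem hm₁ (hLL hg))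
      have hmem : a (f c₁) ∈ finPart ρ (cj (c₁.out * g) P) := by
        rw [← map_finPart, ← rep_map_map, hac₁]
        exact Submodule.mem_map_of_mem hag
      have hnot : a (f c₂) ∉ finPart ρ (cj (c₁.out * g) P) := fun hin => by
        refine hne ?_
        have := h.mem_of_mem_finPart_cj hM hB hg (n₁ := c₁.out) (n₂ := c₂.out) ?_
          (hgenU c₂ (Finsupp.mem_support_iff.2 hc₂) a ha) hac₂ hin
        · rw [← QuotientGroup.eq, QuotientGroup.out_eq', QuotientGroup.out_eq'] at this
          exact this
        · rw [← cj_mul]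
          exact (hconj _ (mul_mem (inv_mem hm₂) (mul_mem hm₁ (hLL hg)))).trans hDL
      obtain ⟨a', ha', h1, h2⟩ := exists_gen_separating hmem hnot
      exact ⟨a' * a, mul_mem (gen_mono hP' ha') ha,
        ⟨c₁, Finsupp.mem_support_iff.2 hc₁, h1⟩, c₂, h2⟩
  obtain ⟨b, hb, ⟨c, hc, hbc⟩, d, hbd⟩ := hb
  have hsub : (f.mapRange b (map_zero b)).support ⊆ f.support := Finsupp.support_mapRange
  obtain ⟨a, ha, c₀, hc₀, hac₀, hrest⟩ := ih (f.mapRange b (map_zero b)).support.card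
    (hk ▸ Finset.card_lt_card ⟨hsub, fun hle => by simpa [hbc] using hle hc⟩)
    (f.mapRange b (map_zero b)) (fun c hc => hf c (hsub hc)) (fun c => by
      rw [Finsupp.mapRange_apply]
      by_cases hc : f c = 0
      · rw [hc, map_zero]; exact zero_mem _
      · exact hgenU c (Finsupp.mem_support_iff.2 hc) b hb)
    (fun h0 => hbd (by simpa using DFunLike.congr_fun h0 d)) rfl
  exact ⟨a * b, mul_mem ha hb, c₀, hsub hc₀, by simpa using hac₀,
    fun c hc => by simpa using hrest c hc⟩

theorem IsMaxFin.exists_gen_sum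
    (h : IsMaxFin ρ (factorCentralizer n M hM.normal) P)
    (hB : IsBlock ρ L (normalizer (P : Set G)) (finPart ρ P) π) (hS : Separates ρ P L D)
    (hLL : L ≤ L') (hDL : D ≤ L) (hPD : P ≤ D) (hD : L' ≤ normalizer (D : Set G))
    (f : (G ⧸ L) →₀ V) (hf : ∀ c ∈ f.support, c.out ∈ L')
    (hfU : ∀ c, f c ∈ (orb ρ L (finPart ρ P)).map (ρ c.out)) (hf0 : f ≠ 0) :
    ∃ a ∈ gen ρ D, ∃ g ∈ L', a (f.sum fun _ x => x) ∈ (orb ρ L (finPart ρ P)).map (ρ g) ∧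
      a (f.sum fun _ x => x) ≠ 0 := by
  obtain ⟨a, ha, c, hc, hac, hrest⟩ := h.exists_gen_isolating hM hB hS hLL hDL hPD hD f hf hfU hf0
  have hsum : a (f.sum fun _ x => x) = a (f c) := by
    rw [Finsupp.sum, map_sum]
    exact Finset.sum_eq_single c (fun d _ hd => hrest d hd) (fun hc' => absurd hc hc')
  refine ⟨a, ha, c.out, hf c hc, hsum ▸ gen_apply_mem ha (fun x hx => mem_stab_map.2 (le_stab_orb L _ (hDL
      ((mem_normalizer_iff''.1 (hD (hf c hc)) x).1 hx)))) (hfU c), hsum ▸ hac⟩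

theorem out_mem_of_mem (hLL : L ≤ L') {g : G} (hg : g ∈ L') : (g : G ⧸ L).out ∈ L' := by
  obtain ⟨l, hl⟩ := QuotientGroup.mk_out_eq_mul L g
  exact hl ▸ mul_mem hg (hLL l.2)

theorem IsMaxFin.isBlock_step
    (h : IsMaxFin ρ (factorCentralizer n M hM.normal) P)
    (hB : IsBlock ρ L (normalizer (P : Set G)) (finPart ρ P) π) (hS : Separates ρ P L D)
    (hLL : L ≤ L') (hDL : D ≤ L) (hPD : P ≤ D) (hD : L' ≤ normalizer (D : Set G)) :
    (∃ π', IsBlock ρ L' (normalizer (P : Set G)) (finPart ρ P) π') ∧ Separates ρ P L' D := by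
  classical
  constructor
  · have : ∃ π', IsBlock ρ L' L (orb ρ L (finPart ρ P)) π' := by
      refine exists_isBlock hLL (le_stab_orb _ _) fun Z hZ hZ' => ?_
      rw [eq_bot_iff]
      intro z hz
      rw [Submodule.mem_bot]
      by_contra hz0
      obtain ⟨f, hfC, hfU, hfz⟩ := exists_finsupp_of_mem_iSup (le_stab_orb L (finPart ρ P))
        (fun g : {g : G // g ∈ L' ∧ g ∉ L} => (g : G)) {c | c.out ∈ L' ∧ c ≠ ((1 : G) : G ⧸ L)}
        (fun g => ⟨out_mem_of_mem hLL g.2.1, fun h1 => g.2.2 (by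
          rw [eq_comm, QuotientGroup.eq, inv_one, one_mul] at h1; exact h1)⟩) (hZ' hz)
      have hf1 : f ((1 : G) : G ⧸ L) = 0 := by
        by_contra hne
        exact (hfC _ (Finsupp.mem_support_iff.2 hne)).2 rfl
      have := h.exists_gen_sum hM hB hS hLL hDL hPD hD
        (f - Finsupp.single ((1 : G) : G ⧸ L) z) (fun c hc => ?_) (fun c => ?_) (fun h0 => ?_)
      · obtain ⟨a, -, g, -, -, hne⟩ := this
        apply hne
        rw [Finsupp.sum_sub_index (fun _ _ _ => rfl), ← hfz, Finsupp.sum_single_index rfl,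
          sub_self, map_zero]
      · by_cases hc1 : c = ((1 : G) : G ⧸ L)
        · exact hc1 ▸ out_mem_of_mem hLL (one_mem _)
        · refine (hfC c ?_).1
          rw [Finsupp.mem_support_iff] at hc ⊢
          rwa [Finsupp.sub_apply, Finsupp.single_eq_of_ne hc1, sub_zero] at hc
      · rw [Finsupp.sub_apply]
        refine sub_mem (hfU c) ?_
        by_cases hc1 : c = ((1 : G) : G ⧸ L)
        · subst hc1
          rw [Finsupp.single_eq_same,
            mem_stab.1 (le_stab_orb L (finPart ρ P) (out_mem_of_mem le_rfl (one_mem L)))]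
          exact hZ hz
        · rw [Finsupp.single_eq_of_ne hc1]
          exact zero_mem _
      · have := DFunLike.congr_fun h0 ((1 : G) : G ⧸ L)
        rw [Finsupp.sub_apply, hf1, Finsupp.single_eq_same, zero_sub, Finsupp.zero_apply,
          neg_eq_zero] at this
        exact hz0 this
    obtain ⟨π', hπ'⟩ := this
    exact ⟨_, hπ'.trans hB (le_orb _ _)⟩
  · intro u hu hu0
    have hu' : u ∈ ⨆ g : L', (orb ρ L (finPart ρ P)).map (ρ g) :=
      iSup_mono (fun g => Submodule.map_mono (le_orb L (finPart ρ P))) hu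
    obtain ⟨f, hfC, hfU, rfl⟩ := exists_finsupp_of_mem_iSup (le_stab_orb L (finPart ρ P))
      (fun g : L' => (g : G)) {c | c.out ∈ L'} (fun g => out_mem_of_mem hLL g.2) hu'
    obtain ⟨a, ha, m, hm, hmem, hne⟩ := h.exists_gen_sum hM hB hS hLL hDL hPD hD f hfC hfU
      (fun h0 => hu0 (by rw [h0, Finsupp.sum_zero_index]))
    obtain ⟨a₀, ha₀, g, hg, hag, ha0⟩ := hS _ (mem_rep_map.1 hmem)
      (by rwa [Ne, rep_apply_eq_zero_iff])
    obtain ⟨b, hb, hbv⟩ := exists_conj_gen (hD hm) ha₀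
    refine ⟨b * a, mul_mem hb ha, m * g, mul_mem hm (hLL hg), ?_, ?_⟩
    · rw [Module.End.mul_apply, ← rep_apply_inv_self (ρ := ρ) m (a _), hbv, ← rep_map_map]
      exact Submodule.mem_map_of_mem hag
    · rwa [Module.End.mul_apply, ← rep_apply_inv_self (ρ := ρ) m (a _), hbv, Ne,
        rep_apply_eq_zero_iff]

theorem IsMaxFin.exists_isBlock_tower
    (h : IsMaxFin ρ (factorCentralizer n M hM.normal) P) (i : ℕ) (hi : i ≤ n) :
    (∃ π, IsBlock ρ (normalizer (P : Set G) ⊔ (M i ⊓ factorCentralizer n M hM.normal))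
      (normalizer (P : Set G)) (finPart ρ P) π) ∧
    Separates ρ P (normalizer (P : Set G) ⊔ (M i ⊓ factorCentralizer n M hM.normal))
      ((normalizer (P : Set G) ⊓ factorCentralizer n M hM.normal) ⊔
        (M i ⊓ factorCentralizer n M hM.normal)) := by
  have hN := factorCentralizer_normal (n := n) hM.normal
  have hMn := hM.normal
  induction i with
  | zero =>
    rw [hM.zero, bot_inf_eq, sup_bot_eq, sup_bot_eq]
    refine ⟨exists_isBlock le_rfl (normalizer_le_stab_finPart P) fun Z _ hZ => ?_,
      fun u hu hu0 => ⟨1, one_mem _, 1, one_mem _, ?_, hu0⟩⟩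
    · rw [eq_bot_iff]
      exact hZ.trans (iSup_le fun g => absurd g.2.1 g.2.2)
    · rw [rep_map_one]
      exact (orb_le_iff (normalizer_le_stab_finPart P)).2 le_rfl hu
  | succ i ih =>
    obtain ⟨⟨π, hB⟩, hS⟩ := ih (by omega)
    have := h.isBlock_step hM hB hS (L' := normalizer (P : Set G) ⊔
        (M (i + 1) ⊓ factorCentralizer n M hM.normal))
      (sup_le_sup_left (inf_le_inf_right _ (hM.mono i.le_succ)) _)
      (sup_le_sup_right inf_le_left _)
      ((le_inf le_normalizer h.le).trans le_sup_left)
      (sup_le (le_normalizer_of_cj_le fun x hx => ?_) (le_normalizer_of_cj_le fun x hx => ?_))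
    · refine ⟨this.1, fun u hu hu0 => ?_⟩
      obtain ⟨a, ha, hrest⟩ := this.2 u hu hu0
      exact ⟨a, gen_mono (sup_le_sup_left (inf_le_inf_right _ (hM.mono i.le_succ)) _) ha, hrest⟩
    · have h1 : cj x (normalizer (P : Set G)) = normalizer (P : Set G) :=
        cj_eq_iff_mem_normalizer.2 (le_normalizer hx)
      rw [cj, Subgroup.map_sup]
      refine sup_le_sup ((Subgroup.map_inf_le _ _ _).trans (inf_le_inf h1.le ?_))
        ((Subgroup.map_inf_le _ _ _).trans (inf_le_inf ?_ ?_)) <;> exact (cj_normal x _).le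
    · rw [cj, Subgroup.map_sup]
      refine sup_le ?_ (le_sup_of_le_right
        ((Subgroup.map_inf_le _ _ _).trans (inf_le_inf ?_ ?_)))
      · rintro y hy
        replace hy := mem_cj.1 hy
        rw [show y = (x * (x⁻¹ * y * x) * x⁻¹ * (x⁻¹ * y * x)⁻¹) * (x⁻¹ * y * x) by group]
        refine mul_mem (mem_sup_right ⟨?_, ?_⟩) (mem_sup_left hy)
        · have := inv_mem (hy.2 i (by omega) x hx.1)
          simpa [mul_assoc] using this
        · exact Subgroup.mul_mem _ (Subgroup.mul_mem _ (Subgroup.mul_mem _ hx.2 hy.2)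
          (Subgroup.inv_mem _ hx.2)) (Subgroup.inv_mem _ hy.2)
      · exact (cj_normal x _).le
      · exact (cj_normal x _).le

theorem IsMaxFin.exists_isBlock (h : IsMaxFin ρ (factorCentralizer n M hM.normal) P) :
    ∃ π, IsBlock ρ ⊤ (normalizer (P : Set G)) (finPart ρ P) π := by
  have hN := factorCentralizer_normal (n := n) hM.normal
  obtain ⟨⟨π, hB⟩, hS⟩ := h.exists_isBlock_tower hM n le_rfl
  rw [hM.top, top_inf_eq] at hB hS
  rw [sup_eq_right.2 (inf_le_right : _ ⊓ _ ≤ factorCentralizer n M hM.normal)] at hS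
  exact (h.isBlock_step hM hB hS le_top le_sup_right h.le (by rw [normalizer_eq_top])).1

end SupersolvableRep

/-! ### Blocks on which a subgroup acts by scalars -/

namespace SupersolvableRep

open Subgroup

variable {G V : Type*} [Group G] [AddCommGroup V] [Module ℂ V]

/-- The elements acting on a subspace as a scalar. -/
def scal (ρ : Representation ℂ G V) (W : Submodule ℂ V) : Subgroup G where
  carrier := {x | ∃ c : ℂˣ, ∀ w ∈ W, ρ x w = (c : ℂ) • w}
  one_mem' := ⟨1, by simp⟩
  mul_mem' := by
    rintro x y ⟨c, hc⟩ ⟨d, hd⟩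
    refine ⟨c * d, fun w hw => ?_⟩
    rw [rep_mul_apply, hd w hw, map_smul, hc w hw, smul_smul, Units.val_mul, mul_comm]
  inv_mem' := by
    rintro x ⟨c, hc⟩
    refine ⟨c⁻¹, fun w hw => ?_⟩
    have h := congrArg (ρ x⁻¹) (hc w hw)
    rw [rep_inv_apply_self, map_smul] at h
    nth_rw 2 [h]
    rw [smul_smul, Units.inv_mul, one_smul]

variable {ρ : Representation ℂ G V} {S Q : Subgroup G} {W W' : Submodule ℂ V} {π : V →ₗ[ℂ] V}

theorem mem_scal_of_apply_eq {x : G} {c : ℂ} (h : ∀ w ∈ W, ρ x w = c • w) : x ∈ scal ρ W := by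
  by_cases hc : c = 0
  · refine ⟨1, fun w hw => ?_⟩
    have := h w hw
    rw [hc, zero_smul, rep_apply_eq_zero_iff] at this
    simp [this]
  · exact ⟨Units.mk0 c hc, h⟩

theorem scal_anti (h : W' ≤ W) : scal ρ W ≤ scal ρ W' := by
  rintro x ⟨c, hc⟩
  exact ⟨c, fun w hw => hc w (h hw)⟩

theorem scal_le_stab (h : W' ≤ W) : scal ρ W ≤ stab ρ W' := by
  refine le_stab_iff.2 ?_
  rintro x ⟨c, hc⟩ w hw
  rw [hc w (h hw)]
  exact W'.smul_mem _ hw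

theorem exists_eigenvector_of_mem_finPart {b : G} (hb : b ∈ Q) (hbW : b ∈ stab ρ W)
    (hWQ : W ≤ finPart ρ Q) (hW : W ≠ ⊥) : ∃ (μ : ℂ) (v : V), v ∈ W ∧ v ≠ 0 ∧ ρ b v = μ • v := by
  obtain ⟨w, hw, hw0⟩ := Submodule.exists_mem_ne_zero_of_ne_bot hW
  obtain ⟨Y, hf, hY, hwY⟩ := hWQ hw
  have hfd : FiniteDimensional ℂ (Y ⊓ W : Submodule ℂ V) :=
    Submodule.finiteDimensional_of_le inf_le_left
  have hmap : ∀ x ∈ Y ⊓ W, ρ b x ∈ Y ⊓ W := fun x hx =>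
    ⟨apply_mem_of_mem_stab (hY hb) hx.1, apply_mem_of_mem_stab hbW hx.2⟩
  have : Nontrivial (Y ⊓ W : Submodule ℂ V) :=
    ⟨⟨⟨w, hwY, hw⟩, 0, fun h => hw0 (congrArg Subtype.val h)⟩⟩
  obtain ⟨μ, hμ⟩ := Module.End.exists_eigenvalue ((ρ b).restrict hmap)
  obtain ⟨v, hv⟩ := hμ.exists_hasEigenvector
  refine ⟨μ, v, v.2.2, fun h => hv.2 (Subtype.ext h), ?_⟩
  exact congrArg Subtype.val hv.apply_eq_smul

theorem IsBlock.eigenspace_refine (hst : S ≤ stab ρ W) {b : G} {μ : ℂ}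
    (hsc : ∀ s ∈ S, s * b * s⁻¹ ∈ scal ρ (W ⊓ Module.End.eigenspace (ρ b) μ)) :
    ∃ π', IsBlock ρ S (S ⊓ stab ρ (W ⊓ Module.End.eigenspace (ρ b) μ))
      (W ⊓ Module.End.eigenspace (ρ b) μ) π' := by
  set W₁ := W ⊓ Module.End.eigenspace (ρ b) μ with hW₁
  have hb : ∀ w ∈ W₁, ρ b w = μ • w := fun w hw => Module.End.mem_eigenspace_iff.1 hw.2
  have hstep : ∀ s ∈ S, ∃ κ : ℂ, (∀ w ∈ W₁, ρ b (ρ s w) = κ • ρ s w) := fun s hs => by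
    obtain ⟨κ, hκ⟩ := hsc s⁻¹ (inv_mem hs)
    refine ⟨κ, fun w hw => ?_⟩
    have := congrArg (ρ s) (hκ w hw)
    rwa [map_smul, ← rep_mul_apply, show s * (s⁻¹ * b * s⁻¹⁻¹) = b * s by group,
      rep_mul_apply] at this
  have hmap : ∀ s ∈ S, ∀ w ∈ W₁, w ≠ 0 → ρ b (ρ s w) = μ • ρ s w → ∀ w ∈ W₁, ρ s w ∈ W₁ := by
    intro s hs w hw hw0 h x hx
    refine ⟨apply_mem_of_mem_stab (hst hs) hx.1, Module.End.mem_eigenspace_iff.2 ?_⟩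
    obtain ⟨κ, hκ⟩ := hstep s hs
    have : κ = μ := by
      have := (hκ w hw).symm.trans h
      exact smul_left_injective ℂ (by rwa [Ne, rep_apply_eq_zero_iff]) this
    rw [hκ x hx, this]
  refine exists_isBlock inf_le_left inf_le_right fun Z hZ hZ' => ?_
  rw [eq_bot_iff]
  have hind := Module.End.eigenspaces_iSupIndep (ρ b) μ
  refine hind (hZ.trans inf_le_right) (hZ'.trans (iSup_le ?_))
  rintro ⟨g, hg, hgS⟩
  obtain ⟨κ, hκ⟩ := hstep g hg
  have hle : W₁.map (ρ g) ≤ Module.End.eigenspace (ρ b) κ := by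
    rintro _ ⟨w, hw, rfl⟩
    exact Module.End.mem_eigenspace_iff.2 (hκ w hw)
  refine hle.trans (le_iSup₂_of_le κ ?_ le_rfl)
  rintro rfl
  refine hgS ⟨hg, ?_⟩
  by_cases hbot : ∃ w ∈ W₁, w ≠ 0
  · obtain ⟨w, hw, hw0⟩ := hbot
    have h1 := hmap g hg w hw hw0 (hκ w hw)
    refine mem_stab.2 (le_antisymm (Submodule.map_le_iff_le_comap.2 h1) fun v hv => ?_)
    refine mem_rep_map.2 (hmap g⁻¹ (inv_mem hg) _ (h1 w hw) (by rwa [Ne, rep_apply_eq_zero_iff])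
      ?_ v hv)
    rw [rep_inv_apply_self, hb w hw]
  · push Not at hbot
    exact mem_stab.2 (by rw [(Submodule.eq_bot_iff W₁).2 hbot, Submodule.map_bot])

variable {n : ℕ} {M : ℕ → Subgroup G}

theorem IsBlock.exists_scalar_of_le (hM : CyclicSeries G n M) (hB : IsBlock ρ ⊤ S W π)
    (hS : S ≤ normalizer (Q : Set G)) (hWQ : W ≤ finPart ρ Q) (hW : W ≠ ⊥) (i : ℕ) :
    ∃ S' W' π', IsBlock ρ ⊤ S' W' π' ∧ S' ≤ S ∧ W' ≤ W ∧ W' ≠ ⊥ ∧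
      Q ⊓ S' ⊓ M i ≤ scal ρ W' := by
  induction i with
  | zero => exact ⟨S, W, π, hB, le_rfl, le_rfl, hW, by rw [hM.zero, inf_bot_eq]; exact bot_le⟩
  | succ i ih =>
    obtain ⟨S', W', π', hB', hSS, hWW, hW', hsc⟩ := ih
    obtain ⟨b, hb, hgen⟩ := hM.exists_generator (Q ⊓ S') i
    obtain ⟨μ, v, hv, hv0, hvμ⟩ := exists_eigenvector_of_mem_finPart hb.1.1
      (hB'.stable hb.1.2) (hWW.trans hWQ) hW'
    have hbs : b ∈ scal ρ (W' ⊓ Module.End.eigenspace (ρ b) μ) :=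
      mem_scal_of_apply_eq fun w hw => Module.End.mem_eigenspace_iff.1 hw.2
    have hsc' : Q ⊓ S' ⊓ M (i + 1) ≤ scal ρ (W' ⊓ Module.End.eigenspace (ρ b) μ) := by
      intro x hx
      obtain ⟨e, c, hc, rfl⟩ := hgen x hx
      exact mul_mem (zpow_mem hbs e) (scal_anti inf_le_left (hsc hc))
    obtain ⟨π'', hπ⟩ := IsBlock.eigenspace_refine hB'.stable (b := b) (μ := μ) fun s hs =>
      hsc' ⟨⟨(mem_normalizer_iff.1 (hS (hSS hs)) b).1 hb.1.1,
        S'.mul_mem (S'.mul_mem hs hb.1.2) (S'.inv_mem hs)⟩, (hM.normal (i + 1)).conj_mem b hb.2 s⟩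
    refine ⟨_, _, _, hB'.trans hπ inf_le_left, inf_le_left.trans hSS, inf_le_left.trans hWW, ?_,
      (inf_le_inf_right _ (inf_le_inf_left _ inf_le_left)).trans hsc'⟩
    exact Submodule.ne_bot_iff _ |>.2 ⟨v, ⟨hv, Module.End.mem_eigenspace_iff.2 hvμ⟩, hv0⟩

theorem IsBlock.exists_scalar (hM : CyclicSeries G n M) (hB : IsBlock ρ ⊤ S W π)
    (hS : S ≤ normalizer (Q : Set G)) (hWQ : W ≤ finPart ρ Q) (hW : W ≠ ⊥) :
    ∃ S' W' π', IsBlock ρ ⊤ S' W' π' ∧ S' ≤ S ∧ W' ≤ W ∧ W' ≠ ⊥ ∧ Q ⊓ S' ≤ scal ρ W' := by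
  simpa only [hM.top, inf_top_eq] using hB.exists_scalar_of_le hM hS hWQ hW n

end SupersolvableRep

/-! ### Weight vectors -/

namespace SupersolvableRep

open Subgroup

variable {G V : Type*} [Group G] [AddCommGroup V] [Module ℂ V]

/-- The vectors on which a subgroup acts through a given function. -/
def wt (ρ : Representation ℂ G V) (H : Subgroup G) (χ : G → ℂ) : Submodule ℂ V where
  carrier := {v | ∀ h ∈ H, ρ h v = χ h • v}
  zero_mem' := by simp
  add_mem' := fun hu hv h hh => by rw [map_add, hu h hh, hv h hh, smul_add]
  smul_mem' := fun c v hv h hh => by rw [map_smul, hv h hh, smul_comm]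

variable {ρ : Representation ℂ G V} {S H : Subgroup G} {W : Submodule ℂ V} {π : V →ₗ[ℂ] V}
variable {χ : G → ℂ}

theorem mem_wt {v : V} : v ∈ wt ρ H χ ↔ ∀ h ∈ H, ρ h v = χ h • v := Iff.rfl

theorem wt_apply_mul {v : V} (hv : v ∈ wt ρ H χ) (hv0 : v ≠ 0) {x y : G} (hx : x ∈ H)
    (hy : y ∈ H) : χ (x * y) = χ x * χ y := by
  refine smul_left_injective ℂ hv0 ?_
  change χ (x * y) • v = (χ x * χ y) • v
  rw [← hv _ (mul_mem hx hy), rep_mul_apply, hv y hy, map_smul, hv x hx, smul_smul, mul_comm]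

theorem wt_apply_ne_zero {v : V} (hv : v ∈ wt ρ H χ) (hv0 : v ≠ 0) {x : G} (hx : x ∈ H) :
    χ x ≠ 0 := by
  intro h
  have := hv x hx
  rw [h, zero_smul, rep_apply_eq_zero_iff] at this
  exact hv0 this

theorem le_stab_of_le_wt {Y : Submodule ℂ V} (hY : Y ≤ wt ρ H χ) : H ≤ stab ρ Y :=
  le_stab_iff.2 fun h hh v hv => by
    rw [hY hv h hh]
    exact Y.smul_mem _ hv

theorem map_wt (g : G) : (wt ρ H χ).map (ρ g) = wt ρ (cj g H) fun x => χ (g⁻¹ * x * g) := by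
  ext v
  rw [mem_rep_map]
  constructor
  · intro hv x hx
    have := congrArg (ρ g) (hv _ (mem_cj.1 hx))
    rwa [map_smul, ← rep_mul_apply, ← rep_mul_apply, rep_apply_inv_self,
      show g * (g⁻¹ * x * g) * g⁻¹ = x by group] at this
  · intro hv x hx
    have : ρ g⁻¹ (ρ _ v) = ρ g⁻¹ (χ _ • v) := congrArg (ρ g⁻¹) (hv (g * x * g⁻¹) (mem_cj.2 (by simpa [mul_assoc] using hx)))
    rwa [map_smul, ← rep_mul_apply, show g⁻¹ * (g * x * g⁻¹) = x * g⁻¹ by group,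
      rep_mul_apply, inv_mul_cancel_right] at this

theorem mem_finPart_of_mem_wt {v : V} (hv : v ∈ wt ρ H χ) : v ∈ finPart ρ H :=
  ⟨ℂ ∙ v, inferInstance, le_stab_of_le_wt ((Submodule.span_singleton_le_iff_mem _ _).2 hv),
    Submodule.mem_span_singleton_self v⟩

theorem IsBlock.wt_inf_le_map (hB : IsBlock ρ ⊤ S W π) (hidx : S.relIndex H ≠ 0) {u : V}
    (hu : u ∈ wt ρ H χ) (hu0 : u ≠ 0) : wt ρ (S ⊓ H) χ ⊓ W ≤ (wt ρ H χ).map π := by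
  classical
  rintro w ⟨hw, hwW⟩
  have : (S.subgroupOf H).FiniteIndex := ⟨hidx⟩
  let F : H ⧸ S.subgroupOf H → V := fun c => (χ (c.out : H))⁻¹ • ρ (c.out : H) w
  have hF : ∀ q : H, F q = (χ q)⁻¹ • ρ q w := by
    intro q
    obtain ⟨s, hs⟩ := QuotientGroup.mk_out_eq_mul (S.subgroupOf H) q
    have hs' : ((s : H) : G) ∈ S := s.2
    simp only [F]
    rw [hs, Subgroup.coe_mul, wt_apply_mul hu hu0 q.2 (s : H).2, rep_mul_apply,
      hw _ ⟨hs', (s : H).2⟩, map_smul, smul_smul, mul_inv, mul_assoc,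
      inv_mul_cancel₀ (wt_apply_ne_zero hu hu0 (s : H).2), mul_one]
  have := Fintype.ofFinite (H ⧸ S.subgroupOf H)
  refine ⟨∑ c, F c, fun h hh => ?_, ?_⟩
  · rw [map_sum, Finset.smul_sum,
      ← Equiv.sum_comp (MulAction.toPerm (⟨h, hh⟩ : H)) fun c => χ h • F c]
    refine Finset.sum_congr rfl fun c _ => ?_
    induction c using QuotientGroup.induction_on with
    | H q =>
      change ρ h (F q) = χ h • F (((⟨h, hh⟩ : H) * q : H) : H ⧸ S.subgroupOf H)
      rw [hF, hF, Subgroup.coe_mul, wt_apply_mul hu hu0 hh q.2, smul_smul, mul_inv, ← mul_assoc,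
        mul_inv_cancel₀ (wt_apply_ne_zero hu hu0 hh), one_mul, map_smul, rep_mul_apply]
  · rw [map_sum, Finset.sum_eq_single ((1 : H) : H ⧸ S.subgroupOf H)]
    · rw [hF, map_smul, Subgroup.coe_one, map_one, Module.End.one_apply, hB.proj_self w hwW]
      have h1 := wt_apply_mul hu hu0 (one_mem H) (one_mem H)
      rw [mul_one] at h1
      have h2 : χ 1 = 1 := (mul_eq_left₀ (wt_apply_ne_zero hu hu0 (one_mem H))).1 h1.symm
      rw [h2, inv_one, one_smul]
    · intro c _ hc
      induction c using QuotientGroup.induction_on with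
      | H q =>
        rw [hF, map_smul, hB.proj_zero _ trivial _ w hwW, smul_zero]
        intro hq
        refine hc ?_
        rw [eq_comm, QuotientGroup.eq, inv_one, one_mul]
        exact hq
    · exact fun h => absurd (Finset.mem_univ _) h

theorem IsBlock.exists_wt_inf (hB : IsBlock ρ ⊤ S W π) (hρ : Irreducible ρ) (hW : W ≠ ⊥)
    (hne : wt ρ H χ ≠ ⊥) [hfd : FiniteDimensional ℂ (wt ρ H χ)] :
    ∃ H₁ ≤ S, ∃ χ₁ : G → ℂ, wt ρ H₁ χ₁ ⊓ W ≠ ⊥ ∧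
      FiniteDimensional ℂ (wt ρ H₁ χ₁ ⊓ W : Submodule ℂ V) := by
  obtain ⟨v, hv, hv0⟩ := Submodule.exists_mem_ne_zero_of_ne_bot hne
  obtain ⟨g, -, hz, hidx, -⟩ := hB.exists_of_mem_finPart (v := v)
    (by rw [hρ.orb_eq_top hW]; trivial) hv0 le_top (mem_finPart_of_mem_wt hv)
  have hu : ρ g⁻¹ v ∈ wt ρ (cj g⁻¹ H) fun x => χ (g⁻¹⁻¹ * x * g⁻¹) :=
    map_wt (ρ := ρ) (H := H) (χ := χ) g⁻¹ ▸ Submodule.mem_map_of_mem hv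
  have hfd' : FiniteDimensional ℂ (wt ρ (cj g⁻¹ H) fun x => χ (g⁻¹⁻¹ * x * g⁻¹)) := by
    rw [← map_wt]; infer_instance
  refine ⟨S ⊓ cj g⁻¹ H, inf_le_left, _, ?_, Submodule.finiteDimensional_of_le
    (hB.wt_inf_le_map ?_ hu (by rwa [Ne, rep_apply_eq_zero_iff]))⟩
  · refine (Submodule.ne_bot_iff _).2 ⟨_, ⟨fun s hs => ?_, hB.proj_mem _⟩, hz⟩
    rw [← hB.proj_apply hs.1 (by rw [hρ.orb_eq_top hW]; trivial), hu s hs.2, map_smul]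
  · rw [← relIndex_cj g, ← cj_mul, mul_inv_cancel, cj_one]
    exact hidx

end SupersolvableRep

/-! ### Central extensions -/

namespace SupersolvableRep

open Subgroup

section Abstract

variable {Γ A : Type*} [Group Γ] [CommGroup A] {z : A →* Γ}

theorem conj_pow_eq_of_central (hc : ∀ a x, Commute (z a) x) {h b : Γ} {e : ℤ} {γ : A}
    (hb : h * b * h⁻¹ = b ^ e * z γ) (k : ℤ) :
    h * b ^ k * h⁻¹ = b ^ (e * k) * z (γ ^ k) := by
  rw [← conj_zpow, hb, ((hc γ (b ^ e)).symm).mul_zpow, ← zpow_mul, map_zpow]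

theorem pow_eq_one_of_central (hc : ∀ a x, Commute (z a) x) (hz : Function.Injective z) {r : ℕ}
    {h b : Γ} (hr : h ^ r ∈ z.range) {γ : A} (hb : h * b * h⁻¹ = b * z γ) : γ ^ r = 1 := by
  have key : ∀ k : ℕ, h ^ k * b * (h ^ k)⁻¹ = b * z (γ ^ k) := fun k => by
    induction k with
    | zero => simp
    | succ k ih =>
      rw [pow_succ', mul_inv_rev, show h * h ^ k * b * ((h ^ k)⁻¹ * h⁻¹) =
        h * (h ^ k * b * (h ^ k)⁻¹) * h⁻¹ by group, ih, ← mul_assoc,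
        mul_assoc _ (z _), (hc _ h⁻¹).eq, ← mul_assoc, hb, mul_assoc, ← map_mul, ← pow_succ']
  obtain ⟨a, ha⟩ := hr
  have := key r
  rw [← ha, (hc a b).eq, mul_inv_cancel_right, left_eq_mul] at this
  exact hz (by rw [this, map_one])

/-- If a group `H`, of exponent `r` modulo the centre, permutes the powers of `b` up to central
factors, it sends `b ^ r` to itself or to a fixed central multiple of its inverse. -/
theorem exists_conj_pow_eq_or (hc : ∀ a x, Commute (z a) x) (hz : Function.Injective z)
    {H : Subgroup Γ} {b : Γ} {r : ℕ} (hr : ∀ h ∈ H, h ^ r ∈ z.range)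
    (hH : ∀ h ∈ H, ∃ (e : ℤ) (γ : A), h * b * h⁻¹ = b ^ e * z γ)
    (hb : ∀ m : ℤ, b ^ m ∈ z.range → m = 0) :
    ∃ β : A, ∀ h ∈ H, h * b ^ r * h⁻¹ = b ^ r ∨ h * b ^ r * h⁻¹ = z β * (b ^ r)⁻¹ := by
  have hdich : ∀ h ∈ H, (∃ γ : A, h * b * h⁻¹ = b * z γ) ∨ ∃ γ : A, h * b * h⁻¹ = b⁻¹ * z γ := by
    intro h hh
    obtain ⟨e, γ, he⟩ := hH h hh
    obtain ⟨e', γ', he'⟩ := hH h⁻¹ (inv_mem hh)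
    have h1 : b = b ^ (e * e') * z (γ ^ e' * γ') := by
      calc b = h * (h⁻¹ * b * h⁻¹⁻¹) * h⁻¹ := by group
        _ = h * b ^ e' * h⁻¹ * z γ' := by
          rw [he', mul_assoc, mul_assoc, (hc γ' h⁻¹).eq]; group
        _ = _ := by rw [conj_pow_eq_of_central hc he, mul_assoc, ← map_mul]
    have h2 : 1 - e * e' = 0 := hb _ ⟨γ ^ e' * γ', by
      rw [sub_eq_neg_add, zpow_add, zpow_one, zpow_neg]
      nth_rw 2 [h1]
      group⟩
    rcases Int.mul_eq_one_iff_eq_one_or_neg_one.1 (sub_eq_zero.1 h2).symm with h3 | h3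
    · exact Or.inl ⟨γ, by rw [he, h3.1, zpow_one]⟩
    · exact Or.inr ⟨γ, by rw [he, h3.1, zpow_neg_one]⟩
  have hpos : ∀ h ∈ H, ∀ γ : A, h * b * h⁻¹ = b * z γ → h * b ^ r * h⁻¹ = b ^ r := by
    intro h hh γ hγ
    have := conj_pow_eq_of_central hc (e := 1) (by rwa [zpow_one]) (k := r) (γ := γ)
    rwa [one_mul, zpow_natCast, zpow_natCast, pow_eq_one_of_central hc hz (hr h hh) hγ, map_one,
      mul_one] at this
  have hneg : ∀ h, ∀ γ : A, h * b * h⁻¹ = b⁻¹ * z γ → h * b ^ r * h⁻¹ = z (γ ^ r) * (b ^ r)⁻¹ := by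
    intro h γ hγ
    have := conj_pow_eq_of_central hc (e := -1) (by rwa [zpow_neg_one]) (k := r) (γ := γ)
    rwa [neg_one_mul, zpow_neg, zpow_natCast, zpow_natCast, ← (hc _ _).eq] at this
  by_cases hex : ∃ h ∈ H, ∃ γ : A, h * b * h⁻¹ = b⁻¹ * z γ
  · obtain ⟨h₀, hh₀, γ₀, hγ₀⟩ := hex
    refine ⟨γ₀ ^ r, fun h hh => ?_⟩
    rcases hdich h hh with ⟨γ, hγ⟩ | ⟨γ, hγ⟩
    · exact Or.inl (hpos h hh γ hγ)
    · right
      rw [hneg h γ hγ]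
      have h1 : h₀ * h * b * (h₀ * h)⁻¹ = b * z (γ₀⁻¹ * γ) := by
        calc h₀ * h * b * (h₀ * h)⁻¹ = h₀ * (h * b * h⁻¹) * h₀⁻¹ := by group
          _ = (h₀ * b * h₀⁻¹)⁻¹ * z γ := by
            rw [hγ, mul_assoc, mul_assoc, (hc γ h₀⁻¹).eq]; group
          _ = _ := by
            rw [hγ₀, mul_inv_rev, inv_inv, ← map_inv, (hc _ b).eq, mul_assoc, ← map_mul]
      have h2 := pow_eq_one_of_central hc hz (hr _ (mul_mem hh₀ hh)) h1
      rw [mul_pow, inv_pow, inv_mul_eq_one] at h2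
      rw [h2]
  · refine ⟨1, fun h hh => Or.inl ?_⟩
    rcases hdich h hh with ⟨γ, hγ⟩ | ⟨γ, hγ⟩
    · exact hpos h hh γ hγ
    · exact absurd ⟨h, hh, γ, hγ⟩ hex

end Abstract

end SupersolvableRep

/-! ### Finite-dimensional weight spaces -/

namespace SupersolvableRep

open Subgroup

variable {G V : Type*} [Group G] [AddCommGroup V] [Module ℂ V]
variable {ρ : Representation ℂ G V} {P S H : Subgroup G} {W : Submodule ℂ V} {χ : G → ℂ}
variable {n : ℕ} {M : ℕ → Subgroup G} (hM : CyclicSeries G n M)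

/-- The action of a subgroup on a stable subspace. -/
def restrictUnits (hst : S ≤ stab ρ W) : S →* (Module.End ℂ W)ˣ :=
  MonoidHom.toHomUnits
    { toFun := fun s => (ρ s).restrict fun _ hw => apply_mem_of_mem_stab (hst s.2) hw
      map_one' := by ext w; simp
      map_mul' := fun s t => by ext w; simp }

theorem restrictUnits_apply (hst : S ≤ stab ρ W) (s : S) (w : W) :
    (((restrictUnits hst s : Module.End ℂ W) w : W) : V) = ρ s w := rfl

theorem restrictUnits_mem_range_iff (hst : S ≤ stab ρ W) (s : S) :
    restrictUnits hst s ∈ (Units.map (algebraMap ℂ (Module.End ℂ W)).toMonoidHom).range ↔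
      (s : G) ∈ scal ρ W := by
  constructor
  · rintro ⟨c, hc⟩
    refine ⟨c, fun w hw => ?_⟩
    rw [← restrictUnits_apply hst s ⟨w, hw⟩, ← hc]
    rfl
  · rintro ⟨c, hc⟩
    refine ⟨c, ?_⟩
    ext w
    exact (hc w w.2).symm

theorem exists_rep_conj_pow_eq_or (hst : S ≤ stab ρ W) (hW : W ≠ ⊥) (hH : H ≤ S) {b : G}
    (hbS : b ∈ S) {r : ℕ} (hr : ∀ h ∈ H, h ^ r ∈ scal ρ W)
    (hconj : ∀ h ∈ H, ∃ e : ℤ, ∃ c ∈ S ⊓ scal ρ W, h * b * h⁻¹ = b ^ e * c)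
    (hb : ∀ m : ℤ, b ^ m ∈ scal ρ W → m = 0) :
    ∃ β : ℂˣ, ∀ h ∈ H, (∀ w ∈ W, ρ (h * b ^ r * h⁻¹) w = ρ (b ^ r) w) ∨
      ∀ w ∈ W, ρ (h * b ^ r * h⁻¹) w = (β : ℂ) • ρ (b ^ r)⁻¹ w := by
  have : Nontrivial W := Submodule.nontrivial_iff_ne_bot.2 hW
  have hst' : ∀ (s : S) (w : W), (((restrictUnits hst s : Module.End ℂ W) w : W) : V) = ρ s w :=
    restrictUnits_apply hst
  obtain ⟨β, hβ⟩ := exists_conj_pow_eq_or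
    (z := Units.map (algebraMap ℂ (Module.End ℂ W)).toMonoidHom)
    (H := (H.subgroupOf S).map (restrictUnits hst)) (b := restrictUnits hst ⟨b, hbS⟩) (r := r)
    (fun a x => Units.ext (Algebra.commutes (a : ℂ) (x : Module.End ℂ W)))
    (fun a a' h => Units.ext ((algebraMap ℂ (Module.End ℂ W)).injective (congrArg Units.val h)))
    (by
      rintro _ ⟨h, hh, rfl⟩
      rw [← map_pow, restrictUnits_mem_range_iff]
      exact hr h hh)
    (by
      rintro _ ⟨h, hh, rfl⟩
      obtain ⟨e, c, hc, he⟩ := hconj h hh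
      obtain ⟨γ, hγ⟩ := (restrictUnits_mem_range_iff hst ⟨c, hc.1⟩).2 hc.2
      refine ⟨e, γ, ?_⟩
      rw [hγ, ← map_inv, ← map_zpow, ← map_mul, ← map_mul, ← map_mul]
      exact congrArg _ (Subtype.ext he))
    (fun m hm => hb m (by
      rw [← map_zpow, restrictUnits_mem_range_iff] at hm
      exact hm))
  refine ⟨β, fun h hh => (hβ _ ⟨⟨h, hH hh⟩, hh, rfl⟩).imp (fun heq w hw => ?_)
    (fun heq w hw => ?_)⟩
  all_goals
    rw [← map_pow, ← map_inv, ← map_mul, ← map_mul] at heq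
    have := congrArg (fun u : (Module.End ℂ W)ˣ => (((u : Module.End ℂ W) ⟨w, hw⟩ : W) : V)) heq
  · exact this
  · rw [← map_inv] at this
    exact this

theorem IsMaxFin.inf_le_of_finiteDimensional_wt
    (h : IsMaxFin ρ (factorCentralizer n M hM.normal) P) (hst : S ≤ stab ρ W)
    (hSP : S ≤ normalizer (P : Set G)) (hWP : W ≤ finPart ρ P) (hsc : P ⊓ S ≤ scal ρ W)
    (hH : H ≤ S) (hne : wt ρ H χ ⊓ W ≠ ⊥)
    [hfd : FiniteDimensional ℂ (wt ρ H χ ⊓ W : Submodule ℂ V)] :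
    S ⊓ factorCentralizer n M hM.normal ≤ P := by
  have hN := factorCentralizer_normal (n := n) hM.normal
  have hNf := hM.finiteIndex_factorCentralizer
  set N := factorCentralizer n M hM.normal with hNdef
  obtain ⟨v, ⟨hv, hvW⟩, hv0⟩ := Submodule.exists_mem_ne_zero_of_ne_bot hne
  have hW : W ≠ ⊥ := (Submodule.ne_bot_iff _).2 ⟨v, hvW, hv0⟩
  have hHP : H ⊓ N ≤ P := h.le_of_normalizes inf_le_right (inf_le_left.trans (hH.trans hSP)) hv0
    (hWP hvW) (finPart_anti inf_le_left (mem_finPart_of_mem_wt hv))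
  have hpowP : ∀ b ∈ S ⊓ N, ∀ m : ℤ, m ≠ 0 → b ^ m ∈ P → b ∈ P := by
    intro b hb m hm hbm
    refine h.mem_of_pow_mem hM hb.2 (Int.natAbs_ne_zero.2 hm) ?_
    rcases Int.natAbs_eq m with h1 | h1 <;> rw [h1] at hbm
    · rwa [zpow_natCast] at hbm
    · rwa [zpow_neg, zpow_natCast, inv_mem_iff] at hbm
  have hfinP : ∀ b ∈ S ⊓ N, v ∈ finPart ρ (zpowers b) → b ∈ P := fun b hb hvb =>
    h.le_of_normalizes (zpowers_le.2 hb.2) (zpowers_le.2 (hSP hb.1)) hv0 (hWP hvW) hvb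
      (mem_zpowers b)
  have hscP : ∀ b ∈ S ⊓ N, b ∈ scal ρ W → b ∈ P := fun b hb hbs =>
    hfinP b hb ⟨ℂ ∙ v, inferInstance, zpowers_le.2 (scal_le_stab
      ((Submodule.span_singleton_le_iff_mem _ _).2 hvW) hbs), Submodule.mem_span_singleton_self v⟩
  have key : ∀ i, S ⊓ N ⊓ M i ≤ P := fun i => by
    induction i with
    | zero => rw [hM.zero, inf_bot_eq]; exact bot_le
    | succ i ih =>
      obtain ⟨b, hb, hgen⟩ := hM.exists_generator (S ⊓ N) i
      suffices hbP : b ∈ P by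
        intro x hx
        obtain ⟨e, c, hc, rfl⟩ := hgen x hx
        exact mul_mem (zpow_mem hbP e) (ih hc)
      by_contra hbP
      have hr0 : N.index ≠ 0 := hNf.index_ne_zero
      obtain ⟨β, hβ⟩ := exists_rep_conj_pow_eq_or hst hW hH hb.1.1 (r := N.index)
        (fun g hg => hsc ⟨hHP ⟨pow_mem hg _, N.pow_index_mem g⟩, pow_mem (hH hg) _⟩)
        (fun g hg => by
          obtain ⟨e, c, hc, he⟩ := hgen (g * b * g⁻¹)
            ⟨⟨S.mul_mem (S.mul_mem (hH hg) hb.1.1) (S.inv_mem (hH hg)), hN.conj_mem b hb.1.2 g⟩,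
              (hM.normal _).conj_mem b hb.2 g⟩
          exact ⟨e, c, ⟨hc.1.1, hsc ⟨ih hc, hc.1.1⟩⟩, he⟩)
        (fun m hm => by
          by_contra hm0
          exact hbP (hpowP b hb.1 m hm0 (hscP _ (Subgroup.zpow_mem _ hb.1 m) hm)))
      have hcSN : b ^ N.index ∈ S ⊓ N := pow_mem hb.1 _
      refine hbP (hpowP b hb.1 N.index (by exact_mod_cast hr0) ?_)
      rw [zpow_natCast]
      refine hfinP _ hcSN ?_
      generalize b ^ N.index = c at hβ hcSN
      set Y : Submodule ℂ V := wt ρ H χ ⊓ W with hY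
      have hmemW : ∀ s ∈ S, ∀ w ∈ W, ρ s w ∈ W := fun s hs w hw =>
        apply_mem_of_mem_stab (hst hs) hw
      have hΘ : ∀ y ∈ Y, ρ c y + (β : ℂ) • ρ c⁻¹ y ∈ Y := by
        rintro y ⟨hy, hyW⟩
        refine ⟨fun g hg => ?_, add_mem (hmemW c hcSN.1 _ hyW)
          (W.smul_mem _ (hmemW _ (inv_mem hcSN.1) _ hyW))⟩
        have hgy : ρ g (ρ c y + (β : ℂ) • ρ c⁻¹ y) =
            ρ (g * c * g⁻¹) (ρ g y) + (β : ℂ) • ρ (g * c * g⁻¹)⁻¹ (ρ g y) := by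
          rw [map_add, map_smul, ← rep_mul_apply, ← rep_mul_apply, ← rep_mul_apply,
            ← rep_mul_apply, inv_mul_cancel_right,
            show (g * c * g⁻¹)⁻¹ * g = g * c⁻¹ by group]
        have hgW : ρ g y ∈ W := hmemW g (hH hg) y hyW
        suffices ρ g (ρ c y + (β : ℂ) • ρ c⁻¹ y) = ρ c (ρ g y) + (β : ℂ) • ρ c⁻¹ (ρ g y) by
          rw [this, hy g hg, map_smul, map_smul, smul_add, smul_comm (χ g) (β : ℂ)]
        rw [hgy]
        have hinv : ∀ w ∈ W, ρ (g * c * g⁻¹)⁻¹ w ∈ W := fun w hw => hmemW _ (S.inv_mem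
          (S.mul_mem (S.mul_mem (hH hg) hcSN.1) (S.inv_mem (hH hg)))) w hw
        rcases hβ g hg with hc | hc
        · rw [hc _ hgW]
          congr 2
          have := hc _ (hmemW _ (S.inv_mem hcSN.1) _ hgW)
          rw [rep_apply_inv_self] at this
          conv_lhs => rw [← this]
          rw [rep_inv_apply_self]
        · rw [hc _ hgW, add_comm]
          congr 1
          have := hc _ (hmemW _ hcSN.1 _ hgW)
          rw [rep_inv_apply_self] at this
          rw [← map_smul, ← this, rep_inv_apply_self]
      refine ⟨Y ⊔ Y.map (ρ c), inferInstance, zpowers_le.2 (mem_stab.2 (le_antisymm ?_ ?_)),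
        Submodule.mem_sup_left ⟨hv, hvW⟩⟩
      · rw [Submodule.map_sup]
        refine sup_le le_sup_right ?_
        rintro _ ⟨_, ⟨y, hy, rfl⟩, rfl⟩
        have h1 : ρ c (ρ c y) = ρ c (ρ c y + (β : ℂ) • ρ c⁻¹ y) - (β : ℂ) • y := by
          rw [map_add, map_smul, rep_apply_inv_self, add_sub_cancel_right]
        rw [h1]
        exact sub_mem (Submodule.mem_sup_right ⟨_, hΘ y hy, rfl⟩)
          (Submodule.mem_sup_left (Y.smul_mem _ hy))
      · rw [Submodule.map_sup]
        refine sup_le (fun y hy => ?_) le_sup_left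
        rw [← Submodule.map_sup, mem_rep_map]
        have h1 : ρ c⁻¹ y = (β⁻¹ : ℂˣ).val • ((ρ c y + (β : ℂ) • ρ c⁻¹ y) - ρ c y) := by
          rw [add_sub_cancel_left, smul_smul, Units.inv_mul, one_smul]
        rw [h1]
        exact Submodule.smul_mem _ _ (sub_mem (Submodule.mem_sup_left (hΘ y hy))
          (Submodule.mem_sup_right ⟨y, hy, rfl⟩))
  simpa only [hM.top, inf_top_eq] using key n

end SupersolvableRep

/-! ### One-dimensional blocks -/

namespace SupersolvableRep

open Subgroup

variable {G V : Type*} [Group G] [AddCommGroup V] [Module ℂ V]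
variable {ρ : Representation ℂ G V} {H : Subgroup G} {χ : G → ℂ}
variable {n : ℕ} {M : ℕ → Subgroup G}

theorem exists_isBlock_span_singleton [Nontrivial V] (hM : CyclicSeries G n M)
    (hρ : Irreducible ρ) (hne : wt ρ H χ ≠ ⊥) [FiniteDimensional ℂ (wt ρ H χ)] :
    ∃ (S : Subgroup G) (w : V) (π : V →ₗ[ℂ] V), w ≠ 0 ∧ IsBlock ρ ⊤ S (ℂ ∙ w) π := by
  have := hM.wellFoundedGT
  have hNf := hM.finiteIndex_factorCentralizer
  obtain ⟨P, hP⟩ := exists_isMaxFin ρ (factorCentralizer n M hM.normal)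
  obtain ⟨π₀, hB₀⟩ := hP.exists_isBlock hM
  obtain ⟨S, W, π, hB, hS, hWP, hW, hsc⟩ := hB₀.exists_scalar hM le_rfl le_rfl hP.ne_bot
  obtain ⟨H₁, hH₁, χ₁, hne₁, hfd₁⟩ := hB.exists_wt_inf hρ hW hne
  have hSP := hP.inf_le_of_finiteDimensional_wt hM hB.stable hS hWP hsc hH₁ hne₁
  obtain ⟨w, hw, hw0⟩ := Submodule.exists_mem_ne_zero_of_ne_bot hW
  have hidx : (S ⊓ factorCentralizer n M hM.normal).relIndex S ≠ 0 := by
    rw [inf_relIndex_left]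
    exact isFiniteRelIndex_of_finiteIndex.relIndex_ne_zero
  have hspan : S ⊓ factorCentralizer n M hM.normal ≤ stab ρ (ℂ ∙ w) :=
    (le_inf hSP inf_le_left).trans (hsc.trans
      (scal_le_stab ((Submodule.span_singleton_le_iff_mem _ _).2 hw)))
  have hfd := finiteDimensional_orb hidx hspan
  rw [hρ.eq_of_le hB ((orb_le_iff hB.stable).2 ((Submodule.span_singleton_le_iff_mem _ _).2 hw))
    ((Submodule.ne_bot_iff _).2 ⟨w, le_orb _ _ (Submodule.mem_span_singleton_self w), hw0⟩)
    (le_stab_orb _ _)] at hfd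
  obtain ⟨S', W', π', hB', hSS, hWW, hW', hsc'⟩ :=
    hB.exists_scalar hM (Q := S) le_normalizer (le_finPart hB.stable) hW
  obtain ⟨x, hx, hx0⟩ := Submodule.exists_mem_ne_zero_of_ne_bot hW'
  have hx' := (Submodule.span_singleton_le_iff_mem x W').2 hx
  refine ⟨S', x, π', hx0, ?_⟩
  rw [hρ.eq_of_le hB' hx' (by simpa using hx0)
    ((le_inf hSS le_rfl).trans (hsc'.trans (scal_le_stab hx')))]
  exact hB'

end SupersolvableRep

/-! ### Monomial modules from one-dimensional blocks -/

namespace SupersolvableRep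

open Subgroup

variable {G V : Type*} [Group G] [AddCommGroup V] [Module ℂ V]

theorem exists_character {ρ : Representation ℂ G V} {S : Subgroup G} {w : V} (hw : w ≠ 0)
    (hS : S ≤ stab ρ (ℂ ∙ w)) : ∃ χ : S →* ℂˣ, ∀ s : S, ρ s w = (χ s : ℂ) • w := by
  have h : ∀ s : S, ∃ c : ℂ, c • w = ρ s w := fun s =>
    Submodule.mem_span_singleton.1
      (apply_mem_of_mem_stab (hS s.2) (Submodule.mem_span_singleton_self w))
  choose c hc using h
  refine ⟨MonoidHom.toHomUnits
    { toFun := c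
      map_one' := smul_left_injective ℂ hw (by simp [hc])
      map_mul' := fun s t => smul_left_injective ℂ hw ?_ }, fun s => (hc s).symm⟩
  change c (s * t) • w = (c s * c t) • w
  rw [hc, mul_comm, mul_smul, hc, ← map_smul, hc, Subgroup.coe_mul, rep_mul_apply]

section Module

variable [Module (MonoidAlgebra ℂ G) V] [IsScalarTower ℂ (MonoidAlgebra ℂ G) V]

theorem single_smul_eq (g : G) (c : ℂ) (v : V) :
    MonoidAlgebra.single g c • v = c • (Representation.ofModule' (k := ℂ) (G := G) V) g v := by
  rw [← mul_one c, ← smul_eq_mul, ← MonoidAlgebra.smul_single, smul_assoc, smul_eq_mul, mul_one]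
  rfl

theorem irreducible_ofModule' [IsSimpleModule (MonoidAlgebra ℂ G) V] :
    Irreducible (Representation.ofModule' (k := ℂ) (G := G) V) := by
  intro Y hY
  let Y' : Submodule (MonoidAlgebra ℂ G) V :=
    { Y with
      smul_mem' := fun a v hv => by
        change a • v ∈ Y
        induction a using MonoidAlgebra.induction_linear with
        | zero => simp
        | add a b ha hb => rw [add_smul]; exact Y.add_mem ha hb
        | single g c =>
          rw [single_smul_eq]
          exact Y.smul_mem _ (apply_mem_of_mem_stab (hY trivial) hv) }
  have hY' : ∀ v, v ∈ Y' ↔ v ∈ Y := fun v => Iff.rfl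
  rcases eq_bot_or_eq_top Y' with h | h
  · left
    ext v
    rw [← hY', h, Submodule.mem_bot, Submodule.mem_bot]
  · right
    ext v
    rw [← hY', h]
    simp

theorem weightSpace_eq_wt (H : Subgroup G) (χ : H →* ℂˣ) :
    ∃ ψ : G → ℂ,
      weightSpace H χ V = wt (Representation.ofModule' (k := ℂ) (G := G) V) H ψ := by
  classical
  refine ⟨fun g => if h : g ∈ H then χ ⟨g, h⟩ else 0, ?_⟩
  ext v
  rw [mem_wt]
  constructor
  · intro hv h hh
    rw [dif_pos hh]
    exact hv ⟨h, hh⟩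
  · intro hv h
    have := hv h h.2
    rw [dif_pos h.2] at this
    exact this

/-- The left ideal by which `IndChar H χ` is the quotient of the group algebra. -/
noncomputable abbrev charIdeal (H : Subgroup G) (χ : H →* ℂˣ) :
    Submodule (MonoidAlgebra ℂ G) (MonoidAlgebra ℂ G) :=
  Submodule.span (MonoidAlgebra ℂ G)
    {x : MonoidAlgebra ℂ G | ∃ h : H,
      x = MonoidAlgebra.single (h : G) (1 : ℂ) - (χ h : ℂ) • (1 : MonoidAlgebra ℂ G)}

theorem charIdeal_le_ker {H : Subgroup G} {χ : H →* ℂˣ} {v : V} (hv : v ∈ weightSpace H χ V) :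
    charIdeal H χ ≤ LinearMap.ker (LinearMap.toSpanSingleton (MonoidAlgebra ℂ G) V v) := by
  rw [Submodule.span_le]
  rintro _ ⟨h, rfl⟩
  rw [SetLike.mem_coe, LinearMap.mem_ker, LinearMap.toSpanSingleton_apply, sub_smul, smul_assoc,
    one_smul, hv h, sub_self]

theorem exists_sub_sum_mem_charIdeal (H : Subgroup G) (χ : H →* ℂˣ) (a : MonoidAlgebra ℂ G) :
    ∃ f : G ⧸ H →₀ ℂ, a - f.sum (fun c z => MonoidAlgebra.single c.out z) ∈ charIdeal H χ := by
  classical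
  induction a using MonoidAlgebra.induction_linear with
  | zero => exact ⟨0, by simp⟩
  | add a b ha hb =>
    obtain ⟨f, hf⟩ := ha
    obtain ⟨f', hf'⟩ := hb
    refine ⟨f + f', ?_⟩
    rw [Finsupp.sum_add_index' (by simp) (fun c x y => MonoidAlgebra.single_add _ _ _),
      add_sub_add_comm]
    exact Submodule.add_mem _ hf hf'
  | single g r =>
    have hs : (g : G ⧸ H).out⁻¹ * g ∈ H := QuotientGroup.eq.1 (QuotientGroup.out_eq' _)
    refine ⟨Finsupp.single (g : G ⧸ H) (r * χ ⟨_, hs⟩), ?_⟩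
    rw [Finsupp.sum_single_index (by simp)]
    convert Submodule.smul_mem (charIdeal H χ) (MonoidAlgebra.single (g : G ⧸ H).out r)
      (Submodule.subset_span ⟨⟨_, hs⟩, rfl⟩) using 1
    rw [smul_sub, smul_eq_mul, smul_eq_mul, MonoidAlgebra.single_mul_single, mul_smul_comm,
      mul_one, mul_one, MonoidAlgebra.smul_single, smul_eq_mul, mul_comm r, mul_inv_cancel_left]

theorem isMonomial_of_isBlock [IsSimpleModule (MonoidAlgebra ℂ G) V] {S : Subgroup G} {w : V}
    {π : V →ₗ[ℂ] V} (hw : w ≠ 0)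
    (hB : IsBlock (Representation.ofModule' (k := ℂ) (G := G) V) ⊤ S (ℂ ∙ w) π) :
    IsMonomial G V := by
  classical
  obtain ⟨χ, hχ⟩ := exists_character hw hB.stable
  have hle : charIdeal S χ ≤ LinearMap.ker (LinearMap.toSpanSingleton (MonoidAlgebra ℂ G) V w) :=
    charIdeal_le_ker fun s => hχ s
  have hker : LinearMap.ker (LinearMap.toSpanSingleton (MonoidAlgebra ℂ G) V w) =
      charIdeal S χ := by
    refine le_antisymm (fun a ha => ?_) hle
    obtain ⟨f, hf⟩ := exists_sub_sum_mem_charIdeal S χ a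
    have hsum : f.sum (fun c z => MonoidAlgebra.single c.out z) • w = 0 := by
      have h1 := hle hf
      rw [LinearMap.mem_ker, LinearMap.toSpanSingleton_apply] at ha h1
      rwa [sub_smul, ha, zero_sub, neg_eq_zero] at h1
    have hf0 : f = 0 := by
      ext c
      have h2 := congrArg
        (fun v => π ((Representation.ofModule' (k := ℂ) (G := G) V) c.out⁻¹ v)) hsum
      simp only [Finsupp.sum, Finset.sum_smul, single_smul_eq, map_sum, map_smul, map_zero,
        ← rep_mul_apply] at h2
      rw [Finset.sum_eq_single c] at h2
      · rw [inv_mul_cancel, map_one, Module.End.one_apply,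
          hB.proj_self w (Submodule.mem_span_singleton_self w)] at h2
        simpa [hw] using h2
      · intro d _ hd
        rw [hB.proj_zero _ trivial (fun h => hd ?_) w (Submodule.mem_span_singleton_self w),
          smul_zero]
        rw [← QuotientGroup.out_eq' d, ← QuotientGroup.out_eq' c]
        exact (QuotientGroup.eq.2 h).symm
      · intro h
        rw [Finsupp.notMem_support_iff.1 h, zero_smul]
    simpa [hf0] using hf
  exact ⟨S, χ, ⟨((Submodule.quotEquivOfEq _ _ hker.symm).trans
    (LinearMap.quotKerEquivOfSurjective _
      (IsSimpleModule.toSpanSingleton_surjective _ hw))).symm⟩⟩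

end Module

end SupersolvableRep

/-! ### Schur lemma and induced modules -/

namespace SupersolvableRep

open Subgroup Polynomial Cardinal

section Schur

variable {A V : Type*} [Ring A] [Algebra ℂ A] [AddCommGroup V] [Module ℂ V] [Module A V]
  [IsScalarTower ℂ A V]

theorem linearIndependent_of_isUnit_aeval {T : Module.End A V}
    (hT : ∀ p : ℂ[X], p ≠ 0 → IsUnit (aeval T p)) {w : V} (hw : w ≠ 0) {v : ℂ → V}
    (hv : ∀ c, aeval T (X - C c) (v c) = w) : LinearIndependent ℂ v := by
  classical
  rw [linearIndependent_iff']
  intro s a hs c hc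
  let q : ℂ[X] := ∑ i ∈ s, C (a i) * ∏ j ∈ s.erase i, (X - C j)
  have hq : aeval T q w = 0 := by
    have h := congrArg (aeval T (∏ j ∈ s, (X - C j))) hs
    rw [map_zero, map_sum] at h
    rw [← h, map_sum, LinearMap.sum_apply]
    refine Finset.sum_congr rfl fun i hi => ?_
    rw [map_mul, aeval_C, Module.End.mul_apply, Module.algebraMap_end_apply,
      LinearMap.map_smul_of_tower, ← Finset.prod_erase_mul _ _ hi, map_mul,
      Module.End.mul_apply, hv]
  have hq0 : q = 0 := by
    by_contra h
    exact hw (((Module.End.isUnit_iff _).1 (hT q h)).1 (by rw [hq, map_zero]))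
  have he := congrArg (eval c) hq0
  rw [eval_finsetSum, Finset.sum_eq_single c, eval_zero, eval_mul, eval_C, eval_prod] at he
  · refine (mul_eq_zero.1 he).resolve_right (Finset.prod_ne_zero_iff.2 fun j hj => ?_)
    simpa [sub_eq_zero] using (Finset.ne_of_mem_erase hj).symm
  · intro i _ hic
    rw [eval_mul, eval_prod,
      Finset.prod_eq_zero (Finset.mem_erase.2 ⟨hic.symm, hc⟩) (by simp), mul_zero]
  · exact fun h => absurd hc h

theorem exists_scalar_or_isUnit_aeval [IsSimpleModule A V] (T : Module.End A V) :
    (∃ c : ℂ, ∀ v, T v = c • v) ∨ ∀ p : ℂ[X], p ≠ 0 → IsUnit (aeval T p) := by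
  rcases Set.eq_empty_or_nonempty (spectrum ℂ T) with h | ⟨c, hc⟩
  · refine Or.inr fun p hp => ?_
    rcases (natDegree p).eq_zero_or_pos with hd | hd
    · rw [natDegree_eq_zero] at hd
      obtain ⟨c, rfl⟩ := hd
      rw [aeval_C]
      exact (IsUnit.mk0 c (by simpa using hp)).map _
    · have := spectrum.map_polynomial_aeval_of_degree_pos T p (natDegree_pos_iff_degree_pos.1 hd)
      rw [h, Set.image_empty] at this
      have h0 : (0 : ℂ) ∉ spectrum ℂ (aeval T p) := by simp [this]
      exact spectrum.zero_notMem_iff ℂ |>.1 h0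
  · refine Or.inl ⟨c, fun v => ?_⟩
    rw [spectrum.mem_iff, Module.End.isUnit_iff] at hc
    have := (LinearMap.bijective_or_eq_zero _).resolve_left hc
    have := LinearMap.congr_fun this v
    rw [LinearMap.sub_apply, LinearMap.zero_apply, sub_eq_zero] at this
    exact this.symm

/-- Schur's lemma for simple modules of countable dimension. -/
theorem exists_scalar_of_rank_le_aleph0 [IsSimpleModule A V]
    (hr : Module.rank ℂ V ≤ ℵ₀) (T : Module.End A V) :
    ∃ c : ℂ, ∀ v, T v = c • v := by
  refine (exists_scalar_or_isUnit_aeval T).resolve_right fun hT => ?_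
  have := IsSimpleModule.nontrivial A V
  obtain ⟨w, hw⟩ := exists_ne (0 : V)
  have hsurj : ∀ c : ℂ, ∃ v, aeval T (X - C c) v = w := fun c =>
    ((Module.End.isUnit_iff _).1 (hT _ (X_sub_C_ne_zero c))).2 w
  choose v hv using hsurj
  have h := (linearIndependent_of_isUnit_aeval hT hw hv).cardinal_lift_le_rank
  rw [Cardinal.mk_complex, lift_continuum] at h
  refine absurd (h.trans (lift_le.2 hr)) ?_
  rw [lift_aleph0, not_le]
  exact aleph0_lt_continuum

end Schur

variable {G V : Type*} [Group G] [AddCommGroup V] [Module ℂ V]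
  [Module (MonoidAlgebra ℂ G) V] [IsScalarTower ℂ (MonoidAlgebra ℂ G) V]

theorem rank_le_aleph0 [Countable G] [IsSimpleModule (MonoidAlgebra ℂ G) V] :
    Module.rank ℂ V ≤ ℵ₀ := by
  have := IsSimpleModule.nontrivial (MonoidAlgebra ℂ G) V
  obtain ⟨w, hw⟩ := exists_ne (0 : V)
  have hspan : Submodule.span ℂ
      (Set.range fun g : G => MonoidAlgebra.single g (1 : ℂ) • w) = ⊤ := by
    rw [eq_top_iff]
    intro v _
    obtain ⟨a, rfl⟩ := IsSimpleModule.toSpanSingleton_surjective (MonoidAlgebra ℂ G) hw v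
    rw [LinearMap.toSpanSingleton_apply]
    induction a using MonoidAlgebra.induction_linear with
    | zero => simp
    | add a b ha hb =>
      rw [add_smul]
      exact Submodule.add_mem _ (ha trivial) (hb trivial)
    | single g c =>
      rw [single_smul_eq]
      exact Submodule.smul_mem _ _ (Submodule.subset_span ⟨g, rfl⟩)
  rw [← rank_top, ← hspan]
  exact (rank_span_le _).trans (Set.countable_range _).le_aleph0

theorem hasFiniteWeight_of_isMonomial [Countable G] [IsSimpleModule (MonoidAlgebra ℂ G) V]
    (h : IsMonomial G V) : HasFiniteWeight G V := by
  have := IsSimpleModule.nontrivial (MonoidAlgebra ℂ G) V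
  obtain ⟨H, χ, ⟨e⟩⟩ := h
  let u : IndChar H χ := Submodule.Quotient.mk 1
  have hgen : ∀ a : MonoidAlgebra ℂ G, Submodule.Quotient.mk a = a • u := fun a => by
    rw [← Submodule.Quotient.mk_smul, smul_eq_mul, mul_one]
  have hu : u ≠ 0 := fun h0 => by
    obtain ⟨v, hv⟩ := exists_ne (0 : V)
    obtain ⟨a, ha⟩ := Submodule.Quotient.mk_surjective _ (e v)
    rw [hgen, h0, smul_zero] at ha
    exact hv (e.map_eq_zero_iff.1 ha.symm)
  have hw0 : e.symm u ≠ 0 := fun h0 => hu (e.symm.map_eq_zero_iff.1 h0)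
  have hw : e.symm u ∈ weightSpace H χ V := fun h => by
    rw [← map_smul, ← hgen, ← algebraMap_smul (MonoidAlgebra ℂ G) (χ h : ℂ) (e.symm u),
      ← map_smul, ← hgen]
    congr 1
    rw [Submodule.Quotient.eq, Algebra.algebraMap_eq_smul_one]
    exact Submodule.subset_span ⟨h, rfl⟩
  refine ⟨H, χ, (Submodule.ne_bot_iff _).2 ⟨_, hw, hw0⟩, ?_⟩
  have hle : weightSpace H χ V ≤ ℂ ∙ e.symm u := fun v hv => by
    obtain ⟨c, hc⟩ := exists_scalar_of_rank_le_aleph0 (A := MonoidAlgebra ℂ G)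
      (rank_le_aleph0 (G := G))
      (((charIdeal H χ).liftQ _ (charIdeal_le_ker hv)).comp e.toLinearMap)
    refine Submodule.mem_span_singleton.2 ⟨c, ?_⟩
    rw [← hc, LinearMap.comp_apply, LinearEquiv.coe_coe, LinearEquiv.apply_symm_apply,
      Submodule.liftQ_apply, LinearMap.toSpanSingleton_apply, one_smul]
  exact Submodule.finiteDimensional_of_le hle

theorem exists_cyclicSeries (hG : IsSupersolvable G) :
    ∃ (n : ℕ) (M : ℕ → Subgroup G), CyclicSeries G n M := by
  obtain ⟨k, N, h0, hk, hle, hN, hstep⟩ := hG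
  refine ⟨k + 1, fun i => N (k + 1 - i), by simpa using hk, by simpa using h0, ?_,
    fun i => hN _, fun i => ?_⟩
  · exact fun i j hij => antitone_nat_of_succ_le hle (by omega)
  · rcases Nat.lt_or_ge i (k + 1) with hi | hi
    · obtain ⟨b, hb⟩ := hstep (k - i) (by omega)
      refine ⟨b, ?_⟩
      rw [zpowers_eq_closure, show k + 1 - (i + 1) = k - i by omega, hb,
        show k + 1 - i = k - i + 1 by omega]
    · refine ⟨1, ?_⟩
      rw [Nat.sub_eq_zero_of_le hi, Nat.sub_eq_zero_of_le (by omega), h0]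
      simp

theorem isMonomial_of_hasFiniteWeight (hG : IsSupersolvable G)
    [IsSimpleModule (MonoidAlgebra ℂ G) V] (h : HasFiniteWeight G V) : IsMonomial G V := by
  have := IsSimpleModule.nontrivial (MonoidAlgebra ℂ G) V
  obtain ⟨n, M, hM⟩ := exists_cyclicSeries hG
  obtain ⟨H, χ, hne, hfd⟩ := h
  obtain ⟨ψ, hψ⟩ := weightSpace_eq_wt (V := V) H χ
  rw [hψ] at hne hfd
  obtain ⟨S, w, π, hw, hB⟩ := exists_isBlock_span_singleton hM irreducible_ofModule' hne
  exact isMonomial_of_isBlock hw hB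

end SupersolvableRep

/-- An irreducible representation of a supersolvable group is monomial if and only if
it has finite weight. -/
theorem isMonomial_iff_hasFiniteWeight (G : Type*) [Group G] (hG : IsSupersolvable G)
    (V : Type*) [AddCommGroup V] [Module ℂ V] [Module (MonoidAlgebra ℂ G) V]
    [IsScalarTower ℂ (MonoidAlgebra ℂ G) V]
    (hV : IsSimpleModule (MonoidAlgebra ℂ G) V) :
    IsMonomial G V ↔ HasFiniteWeight G V := by
  obtain ⟨n, M, hM⟩ := SupersolvableRep.exists_cyclicSeries hG
  have := hM.countable
  exact ⟨SupersolvableRep.hasFiniteWeight_of_isMonomial,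
    SupersolvableRep.isMonomial_of_hasFiniteWeight hG⟩
end

section
/- Let G be a supersolvable group, H a subgroup of G, and χ : H →* ℂˣ a character such that the induced representation V = Ind_H^G(χ) is a simple ℂ[G]-module. Then the weight space V_H(χ) = {v ∈ V | h • v = χ(h) v for all h ∈ H} is a one-dimensional ℂ-subspace of V. -/
open scoped TensorProduct

theorem IsSupersolvable.group_fg {G : Type*} [Group G] (hG : IsSupersolvable G) :
    Group.FG G := by
  obtain ⟨k, N, h_top, h_bot, -, -, h_step⟩ := hG
  have key : ∀ i ≤ k + 1, (N i).FG := fun i hi ↦ by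
    induction hi using Nat.decreasingInduction with
    | self => exact h_bot ▸ ⟨∅, by simp⟩
    | of_succ i hi ih =>
      obtain ⟨g, hg⟩ := h_step i (Nat.lt_succ_iff.mp hi)
      exact hg ▸ ih.sup ⟨{g}, by simp⟩
  exact Group.fg_def.2 (h_top ▸ key 0 (Nat.zero_le _))

theorem Group.FG.countable {G : Type*} [Group G] (hG : Group.FG G) : Countable G := by
  obtain ⟨s, hs, f, hf⟩ := Group.fg_iff_exists_freeGroup_hom_surjective.1 hG
  have : Countable (FreeGroup s) := by
    have := hs.countable.to_subtype
    infer_instance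
  exact Function.Surjective.countable hf

open Polynomial in
/-- Over an algebraically closed field, a nonzero polynomial in an element with empty spectrum
is a unit. -/
theorem spectrum.isUnit_aeval_of_eq_empty {K A : Type*} [Field K] [IsAlgClosed K] [Ring A]
    [Algebra K A] {x : A} (hx : spectrum K x = ∅) {p : K[X]} (hp : p ≠ 0) :
    IsUnit (aeval x p) := by
  rcases Nat.eq_zero_or_pos p.natDegree with h | h
  · rw [eq_C_of_natDegree_eq_zero h, aeval_C]
    refine (IsUnit.mk0 _ fun h0 ↦ hp ?_).map (algebraMap K A)
    rw [eq_C_of_natDegree_eq_zero h, h0, C_0]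
  · have := spectrum.map_polynomial_aeval_of_degree_pos x p (natDegree_pos_iff_degree_pos.1 h)
    rw [hx, Set.image_empty] at this
    exact (spectrum.zero_notMem_iff K).1 (this ▸ Set.notMem_empty _)

open Polynomial in
/-- If `x` has empty spectrum, the vectors `(x - a)⁻¹ • e` are linearly independent. -/
theorem linearIndependent_of_sub_smul_eq {K A M : Type*} [Field K] [IsAlgClosed K] [Ring A]
    [Algebra K A] [AddCommGroup M] [Module K M] [Module A M] [IsScalarTower K A M] {x : A}
    (hx : spectrum K x = ∅) {e : M} (he : e ≠ 0) {v : K → M}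
    (hv : ∀ a, (x - algebraMap K A a) • v a = e) : LinearIndependent K v := by
  classical
  refine linearIndependent_iff'.2 fun s m hm i hi ↦ ?_
  let p : K[X] := ∑ j ∈ s, C (m j) * ∏ l ∈ s.erase j, (X - C l)
  have hpe : aeval x p • e = 0 := by
    have h : ∀ j ∈ s, aeval x (C (m j) * ∏ l ∈ s.erase j, (X - C l)) • e =
        aeval x (∏ l ∈ s, (X - C l)) • m j • v j := fun j hj ↦ by
      rw [← s.prod_erase_mul _ hj, map_mul, map_mul, mul_smul, mul_smul, ← hv j, aeval_C,
        algebraMap_smul]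
      simp only [map_sub, aeval_X, aeval_C]
      rw [smul_comm (m j), smul_comm (m j)]
    rw [map_sum, Finset.sum_smul, Finset.sum_congr rfl h, ← Finset.smul_sum, hm, smul_zero]
  have hp : p = 0 := by
    by_contra hp
    exact he ((spectrum.isUnit_aeval_of_eq_empty hx hp).smul_eq_zero.1 hpe)
  have h_eval := congr_arg (eval i) hp
  have h_zero : ∀ j ∈ s, j ≠ i → eval i (C (m j) * ∏ l ∈ s.erase j, (X - C l)) = 0 :=
    fun j _ hji ↦ by
      rw [eval_mul, eval_prod, Finset.prod_eq_zero (Finset.mem_erase.2 ⟨hji.symm, hi⟩) (by simp),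
        mul_zero]
  rw [eval_finsetSum, Finset.sum_eq_single_of_mem i hi h_zero, eval_zero, eval_mul, eval_C,
    eval_prod] at h_eval
  refine (mul_eq_zero.1 h_eval).resolve_right (Finset.prod_ne_zero_iff.2 fun j hj ↦ ?_)
  simpa using sub_ne_zero.2 (Finset.ne_of_mem_erase hj).symm

/-- **Dixmier's version of Schur's lemma**: over an algebraically closed field `K`, every
endomorphism of a simple module of `K`-dimension less than the cardinality of `K` is a scalar. -/
theorem Module.End.exists_eq_algebraMap_of_rank_lt.{u, v} {K : Type u} {R : Type*} {M : Type v}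
    [Field K] [IsAlgClosed K] [Ring R] [AddCommGroup M] [Module K M] [Module R M]
    [Algebra K R] [IsScalarTower K R M] [IsSimpleModule R M]
    (h_rank : Cardinal.lift.{u} (Module.rank K M) < Cardinal.lift.{v} (Cardinal.mk K))
    (f : Module.End R M) : ∃ c : K, f = algebraMap K (Module.End R M) c := by
  obtain ⟨c, hc⟩ : (spectrum K f).Nonempty := by
    by_contra h
    rw [Set.not_nonempty_iff_eq_empty] at h
    have := IsSimpleModule.nontrivial R M
    obtain ⟨e, he⟩ := exists_ne (0 : M)
    have h_surj : ∀ a : K, ∃ v : M, (f - algebraMap K (Module.End R M) a) • v = e := fun a ↦ by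
      have ha : IsUnit (f - algebraMap K (Module.End R M) a) := by
        rw [← neg_sub, IsUnit.neg_iff]
        exact spectrum.notMem_iff.1 (h ▸ Set.notMem_empty a)
      exact ⟨ha.unit⁻¹ • e, smul_inv_smul ha.unit e⟩
    choose v hv using h_surj
    exact h_rank.not_ge (linearIndependent_of_sub_smul_eq h he hv).cardinal_lift_le_rank
  refine ⟨c, ?_⟩
  by_contra hne
  refine spectrum.mem_iff.1 hc ((Module.End.isUnit_iff _).2 ?_)
  exact LinearMap.bijective_of_ne_zero (sub_ne_zero.2 (Ne.symm hne))

theorem MonoidAlgebra.rank_quotient_le_aleph0 {K G : Type*} [Field K] [Group G] [Countable G]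
    (N : Submodule (MonoidAlgebra K G) (MonoidAlgebra K G)) :
    Module.rank K (MonoidAlgebra K G ⧸ N) ≤ Cardinal.aleph0 := by
  have h := LinearMap.lift_rank_le_of_surjective
    ((N.mkQ.restrictScalars K) ∘ₗ (MonoidAlgebra.coeffLinearEquiv K).symm.toLinearMap)
    (N.mkQ_surjective.comp (MonoidAlgebra.coeffLinearEquiv K).symm.surjective)
  refine Cardinal.lift_le_aleph0.1 (h.trans (Cardinal.lift_le_aleph0.2 ?_))
  simp

/-- If `Ind_H^G χ` is a simple `ℂ[G]`-module for a supersolvable group `G`, then its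
weight space with respect to `(H, χ)` is one-dimensional over `ℂ`. -/
theorem finrank_weightSpace_indChar_eq_one (G : Type*) [Group G]
    (hG : IsSupersolvable G) (H : Subgroup G) (χ : H →* ℂˣ)
    (hV : IsSimpleModule (MonoidAlgebra ℂ G) (IndChar H χ)) :
    Module.finrank ℂ (weightSpace H χ (IndChar H χ)) = 1 := by
  have := hG.group_fg.countable
  let V := IndChar H χ
  let e : V := Submodule.Quotient.mk 1
  have h_rank : Cardinal.lift (Module.rank ℂ V) < Cardinal.lift (Cardinal.mk ℂ) := by
    refine lt_of_le_of_lt (Cardinal.lift_le_aleph0.2 (MonoidAlgebra.rank_quotient_le_aleph0 _)) ?_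
    simpa using Cardinal.aleph0_lt_continuum
  have he : e ∈ weightSpace H χ V := fun h ↦ by
    refine (Submodule.Quotient.eq _).2 (Submodule.subset_span ⟨h, ?_⟩)
    simp
  have he0 : e ≠ 0 := fun h0 ↦ by
    have := IsSimpleModule.nontrivial (MonoidAlgebra ℂ G) V
    obtain ⟨v, hv⟩ := exists_ne (0 : V)
    obtain ⟨a, rfl⟩ := Submodule.Quotient.mk_surjective _ v
    refine hv ?_
    rw [← mul_one a, ← smul_eq_mul, Submodule.Quotient.mk_smul]
    exact (congr_arg (a • ·) h0).trans (smul_zero a)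
  refine finrank_eq_one (⟨e, he⟩ : weightSpace H χ V) (by simpa using he0) ?_
  rintro ⟨w, hw⟩
  let f : Module.End (MonoidAlgebra ℂ G) V :=
    Submodule.liftQ _ (LinearMap.toSpanSingleton (MonoidAlgebra ℂ G) V w) <| by
      rw [Submodule.span_le]
      rintro _ ⟨h, rfl⟩
      simp [sub_smul, hw h]
  obtain ⟨c, hc⟩ := Module.End.exists_eq_algebraMap_of_rank_lt h_rank f
  refine ⟨c, Subtype.ext ?_⟩
  have hfe : f e = w := one_smul (MonoidAlgebra ℂ G) w
  exact (LinearMap.congr_fun hc e).symm.trans hfe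
end

section
/- Let G be a supersolvable group with Fitting subgroup F, let H be a subgroup of G and χ : H →* ℂˣ a character. Suppose that for every g lying in the set-normalizer N_G(√[F](H ∩ F)) of the radical of H ∩ F in F but not in H, there exists x ∈ H^g ∩ H with χ^g(x) ≠ χ(x). Then the induced representation Ind_H^G(χ) is Schur irreducible, i.e. every ℂ[G]-module endomorphism of Ind_H^G(χ) is multiplication by a complex scalar. -/
open scoped TensorProduct

/-- A `ℂ[G]`-module is Schur irreducible if every `ℂ[G]`-linear endomorphism of it is
multiplication by a complex scalar. -/
def SchurIrreducible (G : Type*) [Group G] (V : Type*) [AddCommGroup V] [Module ℂ V]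
    [Module (MonoidAlgebra ℂ G) V] [IsScalarTower ℂ (MonoidAlgebra ℂ G) V] : Prop :=
  ∀ f : V →ₗ[MonoidAlgebra ℂ G] V, ∃ c : ℂ, ∀ v : V, f v = c • v

/-- The Fitting subgroup: the subgroup generated by all nilpotent normal subgroups. -/
def fittingSubgroup (G : Type*) [Group G] : Subgroup G :=
  ⨆ (N : Subgroup G) (_ : N.Normal) (_ : Group.IsNilpotent N), N

/-- The radical `√[F] K` of `K` in `F`: the set of elements of `F` some positive power
of which lies in `K` (this need not be a subgroup). -/
def radical {G : Type*} [Group G] (F K : Subgroup G) : Set G :=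
  {g : G | g ∈ F ∧ ∃ n : ℕ, 0 < n ∧ g ^ n ∈ K}

section GroupTheory

variable {G : Type*} [Group G]

theorem Subgroup.relIndex_sup_inf_of_le {A B M : Subgroup G} [M.Normal] (hAB : A ≤ B) :
    A.relIndex ((M ⊔ A) ⊓ B) = A.relIndex (M ⊓ B) := by
  have hle : M ⊓ B ≤ (M ⊔ A) ⊓ B := inf_le_inf_right B le_sup_left
  refine (Nat.card_congr (Equiv.ofBijective (Subgroup.quotientSubgroupOfEmbeddingOfLE A hle)
    ⟨(Subgroup.quotientSubgroupOfEmbeddingOfLE A hle).injective, ?_⟩)).symm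
  intro q
  induction q using QuotientGroup.induction_on with
  | H x =>
    obtain ⟨x, hxs, hxB⟩ := x
    obtain ⟨m, hm, a, ha, rfl⟩ := Subgroup.mem_sup_of_normal_left.mp hxs
    have hmB : m ∈ B := by simpa using B.mul_mem hxB (B.inv_mem (hAB ha))
    refine ⟨QuotientGroup.mk ⟨m, hm, hmB⟩, ?_⟩
    rw [Subgroup.quotientSubgroupOfEmbeddingOfLE_apply_mk, QuotientGroup.eq]
    simpa [Subgroup.mem_subgroupOf] using ha

theorem Subgroup.relIndex_ne_zero_of_map_mk {A B M : Subgroup G} [M.Normal] (hAB : A ≤ B)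
    (hM : A.relIndex (M ⊓ B) ≠ 0)
    (hmap : (A.map (QuotientGroup.mk' M)).relIndex (B.map (QuotientGroup.mk' M)) ≠ 0) :
    A.relIndex B ≠ 0 := by
  rw [← Subgroup.relIndex_comap, QuotientGroup.comap_map_mk', ← Subgroup.inf_relIndex_right] at hmap
  rw [← Subgroup.relIndex_sup_inf_of_le hAB] at hM
  exact Subgroup.relIndex_ne_zero_trans hM hmap

theorem Subgroup.normal_of_le_zpowers {C : Subgroup G} {t : G} (ht : (Subgroup.zpowers t).Normal)
    (hC : C ≤ Subgroup.zpowers t) : C.Normal := by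
  refine ⟨fun x hx g ↦ ?_⟩
  obtain ⟨j, rfl⟩ := Subgroup.mem_zpowers_iff.mp (hC hx)
  obtain ⟨m, hm⟩ := Subgroup.mem_zpowers_iff.mp (ht.conj_mem t (Subgroup.mem_zpowers t) g)
  rw [← conj_zpow, ← hm, ← zpow_mul, mul_comm, zpow_mul]
  exact C.zpow_mem hx m

/-- In a supersolvable group, if `H ∩ gHg⁻¹` has finite index in `H`, then it also has finite
index in `gHg⁻¹`. -/
theorem IsSupersolvable.relIndex_map_conj_ne_zero (hG : IsSupersolvable G) (H : Subgroup G)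
    (g : G) (h : (H.map (MulAut.conj g).toMonoidHom).relIndex H ≠ 0) :
    H.relIndex (H.map (MulAut.conj g).toMonoidHom) ≠ 0 := by
  obtain ⟨k, N, hN0, hNk, hle, hnorm, hcyc⟩ := hG
  set H' := H.map (MulAut.conj g).toMonoidHom
  suffices key : ∀ j ≤ k + 1, (H ⊓ H').relIndex (N (k + 1 - j) ⊓ H') ≠ 0 by
    have := key (k + 1) le_rfl
    rwa [Nat.sub_self, hN0, top_inf_eq, Subgroup.inf_relIndex_right] at this
  intro j
  induction j with
  | zero => simp [hNk]
  | succ j ih =>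
    intro hj
    have ih := ih (by omega)
    obtain ⟨i, hi⟩ : ∃ i, i = k + 1 - (j + 1) := ⟨_, rfl⟩
    rw [show k + 1 - j = i + 1 by omega] at ih
    rw [← hi]
    obtain ⟨t, ht⟩ := hcyc i (by omega)
    have := hnorm i
    have := hnorm (i + 1)
    set M := N (i + 1)
    set π := QuotientGroup.mk' M
    have hMN : M ≤ N i := hle i
    -- the images of `N i ⊓ H` and `N i ⊓ H'` in the quotient agree
    have hNmap : (N i).map π = Subgroup.zpowers (π t) := by
      rw [ht, Subgroup.map_sup, QuotientGroup.map_mk'_self, bot_sup_eq, MonoidHom.map_closure,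
        Set.image_singleton, Subgroup.zpowers_eq_closure]
    have hzn : (Subgroup.zpowers (π t)).Normal := by
      rw [← hNmap]
      exact Subgroup.Normal.map (hnorm i) π (QuotientGroup.mk'_surjective M)
    have hCn : ((N i ⊓ H).map π).Normal :=
      Subgroup.normal_of_le_zpowers hzn (hNmap ▸ Subgroup.map_mono inf_le_left)
    have himg : (N i ⊓ H').map π ≤ (N i ⊓ H).map π := by
      rintro _ ⟨_, ⟨hyN, x, hx, rfl⟩, rfl⟩
      have hxN : x ∈ N i := by
        simpa [mul_assoc] using (hnorm i).conj_mem _ hyN g⁻¹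
      simpa using hCn.conj_mem (π x) ⟨x, ⟨hxN, hx⟩, rfl⟩ (π g)
    have hfin : ((N i ⊓ (H ⊓ H')).map π).relIndex ((N i ⊓ H).map π) ≠ 0 := by
      have h1 : (N i ⊓ (H ⊓ H')).relIndex (N i ⊓ H) ≠ 0 := by
        have := Subgroup.relIndex_inter_ne_zero h (N i)
        rw [← Subgroup.inf_relIndex_right] at this
        convert this using 2
        · ext; simp; tauto
        · rw [inf_comm]
      rw [← Subgroup.relIndex_comap]
      exact fun h0 ↦ h1 (Subgroup.relIndex_eq_zero_of_le_left (Subgroup.le_comap_map π _) h0)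
    have hle' : N i ⊓ (H ⊓ H') ≤ N i ⊓ H' := inf_le_inf_left _ inf_le_right
    have main : (N i ⊓ (H ⊓ H')).relIndex (N i ⊓ H') ≠ 0 := by
      refine Subgroup.relIndex_ne_zero_of_map_mk (M := M) hle' ?_
        (fun h0 ↦ hfin (Subgroup.relIndex_eq_zero_of_le_right himg h0))
      rw [← inf_assoc M, inf_eq_left.mpr hMN]
      rw [← Subgroup.inf_relIndex_right] at ih ⊢
      convert ih using 2
      ext x
      simp only [Subgroup.mem_inf]
      exact ⟨fun ⟨⟨a, b⟩, c⟩ ↦ ⟨b, c⟩, fun ⟨b, c⟩ ↦ ⟨⟨hMN c.1, b⟩, c⟩⟩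
    exact fun h0 ↦ main (Subgroup.relIndex_eq_zero_of_le_left inf_le_right h0)

theorem radical_subset_of_relIndex_ne_zero {F K L : Subgroup G} [F.Normal]
    (h : L.relIndex K ≠ 0) {x : G} (hx : x ∈ radical F (K ⊓ F)) : x ∈ radical F (L ⊓ F) := by
  obtain ⟨hxF, n, hn, hxn⟩ := hx
  obtain ⟨m, hm, -, hxm⟩ := Subgroup.exists_pow_mem_of_relIndex_ne_zero h hxn.1
  exact ⟨hxF, n * m, Nat.mul_pos hn hm, by rw [pow_mul]; exact ⟨hxm.1, F.pow_mem hxn.2 m⟩⟩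

instance fittingSubgroup_normal : (fittingSubgroup G).Normal := by
  unfold fittingSubgroup
  have h (N : Subgroup G) (hN : N.Normal) : (⨆ _ : Group.IsNilpotent N, N).Normal := inferInstance
  have h' (N : Subgroup G) : (⨆ (_ : N.Normal) (_ : Group.IsNilpotent N), N).Normal :=
    @Subgroup.iSup_normal _ _ _ _ (h N)
  exact @Subgroup.iSup_normal _ _ _ _ h'

theorem conj_mem_radical_iff {F : Subgroup G} [hF : F.Normal] (H : Subgroup G) (g x : G) :
    g * x * g⁻¹ ∈ radical F (H.map (MulAut.conj g).toMonoidHom ⊓ F) ↔ x ∈ radical F (H ⊓ F) := by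
  have hFc (y : G) : g * y * g⁻¹ ∈ F ↔ y ∈ F :=
    ⟨fun h ↦ by simpa [mul_assoc] using hF.conj_mem _ h g⁻¹, fun h ↦ hF.conj_mem _ h g⟩
  simp only [radical, Set.mem_ofPred_eq, conj_pow, Subgroup.mem_inf, hFc, Subgroup.mem_map]
  simp

theorem mem_normalizer_radical {F : Subgroup G} [F.Normal] (hG : IsSupersolvable G)
    (H : Subgroup G) (g : G) (h : (H.map (MulAut.conj g).toMonoidHom).relIndex H ≠ 0) :
    g ∈ Subgroup.normalizer (radical F (H ⊓ F)) := by
  rw [Subgroup.mem_set_normalizer_iff]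
  intro x
  rw [← conj_mem_radical_iff H g x]
  exact ⟨radical_subset_of_relIndex_ne_zero (hG.relIndex_map_conj_ne_zero H g h),
    radical_subset_of_relIndex_ne_zero h⟩

end GroupTheory

section Induced

variable {G : Type*} [Group G] {H : Subgroup G} (χ : H →* ℂˣ)

open scoped Classical in
/-- The extension of a character `χ` of `H` to all of `G` by zero. -/
noncomputable def extendZero (y : G) : ℂ := if h : y ∈ H then (χ ⟨y, h⟩ : ℂ) else 0

theorem extendZero_of_mem {y : G} (h : y ∈ H) : extendZero χ y = χ ⟨y, h⟩ := dif_pos h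

theorem extendZero_of_notMem {y : G} (h : y ∉ H) : extendZero χ y = 0 := dif_neg h

theorem extendZero_mul_right (y : G) (h : H) :
    extendZero χ (y * h) = extendZero χ y * χ h := by
  by_cases hy : y ∈ H
  · rw [extendZero_of_mem χ hy, extendZero_of_mem χ (H.mul_mem hy h.2), ← Units.val_mul,
      ← map_mul]
    rfl
  · rw [extendZero_of_notMem χ hy, extendZero_of_notMem χ (fun h' ↦ hy <|
      (Subgroup.mul_mem_cancel_right H h.2).mp h'), zero_mul]

theorem extendZero_mul_left (y : G) (h : H) :
    extendZero χ (h * y) = χ h * extendZero χ y := by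
  by_cases hy : y ∈ H
  · rw [extendZero_of_mem χ hy, extendZero_of_mem χ (H.mul_mem h.2 hy), ← Units.val_mul,
      ← map_mul]
    rfl
  · rw [extendZero_of_notMem χ hy, extendZero_of_notMem χ (fun h' ↦ hy <|
      (Subgroup.mul_mem_cancel_left H h.2).mp h'), mul_zero]

/-- The coefficient at the coset `gH`, relative to the representative `g`, of the class of an
element of `ℂ[G]` in `Ind_H^G χ`. -/
noncomputable def cosetCoeff (g : G) : MonoidAlgebra ℂ G →ₗ[ℂ] ℂ :=
  Finsupp.lift ℂ ℂ G (fun y ↦ extendZero χ (g⁻¹ * y)) ∘ₗ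
    (MonoidAlgebra.coeffLinearEquiv ℂ).toLinearMap

@[simp]
theorem cosetCoeff_single (g y : G) (c : ℂ) :
    cosetCoeff χ g (MonoidAlgebra.single y c) = c * extendZero χ (g⁻¹ * y) := by
  simp [cosetCoeff]

theorem cosetCoeff_single_mul (g y : G) (u : MonoidAlgebra ℂ G) :
    cosetCoeff χ g (MonoidAlgebra.single y 1 * u) = cosetCoeff χ (y⁻¹ * g) u := by
  induction u using MonoidAlgebra.induction_linear with
  | zero => simp
  | add a b ha hb => rw [mul_add, map_add, map_add, ha, hb]
  | single z c => simp [MonoidAlgebra.single_mul_single, mul_assoc]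

theorem cosetCoeff_mul_single (g : G) (u : MonoidAlgebra ℂ G) (h : H) :
    cosetCoeff χ g (u * MonoidAlgebra.single (h : G) 1) = χ h * cosetCoeff χ g u := by
  induction u using MonoidAlgebra.induction_linear with
  | zero => simp
  | add a b ha hb => rw [add_mul, map_add, map_add, ha, hb, mul_add]
  | single z c =>
    simp only [MonoidAlgebra.single_mul_single, mul_one, cosetCoeff_single, ← mul_assoc,
      extendZero_mul_right]
    ring

theorem cosetCoeff_mul_mem (g : G) (h : H) (u : MonoidAlgebra ℂ G) :
    cosetCoeff χ (g * h) u = χ h⁻¹ * cosetCoeff χ g u := by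
  induction u using MonoidAlgebra.induction_linear with
  | zero => simp
  | add a b ha hb => rw [map_add, map_add, ha, hb, mul_add]
  | single z c =>
    rw [cosetCoeff_single, cosetCoeff_single, mul_inv_rev, mul_assoc, ← H.coe_inv,
      extendZero_mul_left]
    ring

theorem cosetCoeff_eq_zero_of_mk_eq_zero (g : G) {v : MonoidAlgebra ℂ G}
    (hv : (Submodule.Quotient.mk v : IndChar H χ) = 0) : cosetCoeff χ g v = 0 := by
  rw [Submodule.Quotient.mk_eq_zero] at hv
  induction hv using Submodule.closure_induction with
  | zero => exact map_zero _
  | add x y _ _ hx hy => rw [map_add, hx, hy, add_zero]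
  | smul_mem a x hx =>
    obtain ⟨h, rfl⟩ := hx
    rw [smul_eq_mul, mul_sub, mul_smul_comm, mul_one, map_sub, cosetCoeff_mul_single, map_smul,
      smul_eq_mul, sub_self]

theorem cosetCoeff_eq_of_mk_eq (g : G) {u w : MonoidAlgebra ℂ G}
    (h : (Submodule.Quotient.mk u : IndChar H χ) = Submodule.Quotient.mk w) :
    cosetCoeff χ g u = cosetCoeff χ g w := by
  rw [← sub_eq_zero, ← map_sub]
  exact cosetCoeff_eq_zero_of_mk_eq_zero χ g (by rw [Submodule.Quotient.mk_sub, h, sub_self])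

theorem mk_single_mul_mem (y : G) (h : H) :
    (Submodule.Quotient.mk (MonoidAlgebra.single (y * h) 1) : IndChar H χ) =
      (χ h : ℂ) • Submodule.Quotient.mk (MonoidAlgebra.single y 1) := by
  rw [← Submodule.Quotient.mk_smul, Submodule.Quotient.eq]
  have := Submodule.smul_mem _ (MonoidAlgebra.single y (1 : ℂ)) (Submodule.subset_span ⟨h, rfl⟩ :
    MonoidAlgebra.single (h : G) (1 : ℂ) - (χ h : ℂ) • (1 : MonoidAlgebra ℂ G) ∈
      Submodule.span (MonoidAlgebra ℂ G) {x : MonoidAlgebra ℂ G | ∃ h : H,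
        x = MonoidAlgebra.single (h : G) (1 : ℂ) - (χ h : ℂ) • (1 : MonoidAlgebra ℂ G)})
  convert this using 1
  rw [smul_eq_mul, mul_sub, MonoidAlgebra.single_mul_single, mul_one, mul_smul_comm, mul_one]

/-- The coordinates of the class of an element of `ℂ[G]` in `Ind_H^G χ`, with respect to the basis
given by representatives of the cosets of `H`. -/
noncomputable def cosetExpansion : MonoidAlgebra ℂ G →ₗ[ℂ] (G ⧸ H →₀ ℂ) :=
  Finsupp.lift (G ⧸ H →₀ ℂ) ℂ G (fun y ↦ Finsupp.single (y : G ⧸ H)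
    (extendZero χ ((y : G ⧸ H).out⁻¹ * y))) ∘ₗ (MonoidAlgebra.coeffLinearEquiv ℂ).toLinearMap

@[simp]
theorem cosetExpansion_single (y : G) (c : ℂ) :
    cosetExpansion χ (MonoidAlgebra.single y c) =
      Finsupp.single (y : G ⧸ H) (c * extendZero χ ((y : G ⧸ H).out⁻¹ * y)) := by
  simp [cosetExpansion]

theorem cosetExpansion_apply (u : MonoidAlgebra ℂ G) (q : G ⧸ H) :
    cosetExpansion χ u q = cosetCoeff χ q.out u := by
  induction u using MonoidAlgebra.induction_linear with
  | zero => simp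
  | add a b ha hb => rw [map_add, map_add, Finsupp.add_apply, ha, hb]
  | single y c =>
    rw [cosetExpansion_single, cosetCoeff_single]
    by_cases hq : (y : G ⧸ H) = q
    · rw [hq, Finsupp.single_eq_same]
    · rw [Finsupp.single_eq_of_ne' hq, extendZero_of_notMem, mul_zero]
      rw [← QuotientGroup.eq, QuotientGroup.out_eq']
      exact Ne.symm hq

theorem mk_eq_cosetExpansion_sum (u : MonoidAlgebra ℂ G) :
    (Submodule.Quotient.mk u : IndChar H χ) = (cosetExpansion χ u).sum fun q c ↦
      c • Submodule.Quotient.mk (MonoidAlgebra.single q.out 1) := by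
  induction u using MonoidAlgebra.induction_linear with
  | zero => simp
  | add a b ha hb =>
    rw [map_add, Finsupp.sum_add_index' (by simp) (by simp [add_smul]),
      ← ha, ← hb, Submodule.Quotient.mk_add]
  | single y c =>
    have hy : (y : G ⧸ H).out⁻¹ * y ∈ H := by
      rw [← QuotientGroup.eq, QuotientGroup.out_eq']
    rw [cosetExpansion_single, Finsupp.sum_single_index (by simp), extendZero_of_mem χ hy,
      mul_smul, ← mk_single_mul_mem, ← Submodule.Quotient.mk_smul]
    simp

theorem mk_eq_smul_mk_one {u : MonoidAlgebra ℂ G} (hu : ∀ g ∉ H, cosetCoeff χ g u = 0) :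
    ∃ c : ℂ, (Submodule.Quotient.mk u : IndChar H χ) = c • Submodule.Quotient.mk 1 := by
  have h1 : ((1 : G) : G ⧸ H).out ∈ H := by
    simpa using QuotientGroup.eq.mp (QuotientGroup.out_eq' ((1 : G) : G ⧸ H)).symm
  have h2 := mk_single_mul_mem χ 1 ⟨_, h1⟩
  rw [one_mul, ← MonoidAlgebra.one_def] at h2
  rw [mk_eq_cosetExpansion_sum,
    Finsupp.sum_eq_single ((1 : G) : G ⧸ H) ?_ (fun _ ↦ zero_smul ℂ _), h2, smul_smul]
  · exact ⟨_, rfl⟩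
  intro q hq hne
  rw [cosetExpansion_apply] at hq
  refine absurd (hu _ fun hmem ↦ hne ?_) hq
  rw [← QuotientGroup.out_eq' q, eq_comm, QuotientGroup.eq]
  simpa using hmem

theorem cosetCoeff_mem_mul {χ : H →* ℂˣ} {u : MonoidAlgebra ℂ G}
    (hu : ∀ h : H, (Submodule.Quotient.mk (MonoidAlgebra.single (h : G) 1 * u) : IndChar H χ) =
      (χ h : ℂ) • Submodule.Quotient.mk u)
    (h : H) (g : G) :
    cosetCoeff χ (h * g) u = χ h⁻¹ * cosetCoeff χ g u := by
  have := cosetCoeff_eq_of_mk_eq χ g ((hu h⁻¹).trans (Submodule.Quotient.mk_smul ..).symm)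
  rwa [cosetCoeff_single_mul, map_smul, smul_eq_mul, H.coe_inv, inv_inv] at this

theorem relIndex_ne_zero_of_cosetCoeff_ne_zero {χ : H →* ℂˣ} {u : MonoidAlgebra ℂ G}
    (hu : ∀ h : H, (Submodule.Quotient.mk (MonoidAlgebra.single (h : G) 1 * u) : IndChar H χ) =
      (χ h : ℂ) • Submodule.Quotient.mk u)
    {g : G} (hg : cosetCoeff χ g u ≠ 0) :
    (H.map (MulAut.conj g).toMonoidHom).relIndex H ≠ 0 := by
  have hsub : MulAction.orbit H (g : G ⧸ H) ⊆ (cosetExpansion χ u).support := by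
    rintro _ ⟨h, rfl⟩
    obtain ⟨h', hh'⟩ := QuotientGroup.mk_out_eq_mul H (h * g)
    have : h • (g : G ⧸ H) = ((h * g : G) : G ⧸ H) := rfl
    rw [Finset.mem_coe, Finsupp.mem_support_iff, cosetExpansion_apply]
    simp only [this]
    rw [hh', cosetCoeff_mul_mem, cosetCoeff_mem_mul hu]
    simp [hg]
  have hfin : (MulAction.orbit H (g : G ⧸ H)).Finite := (Finset.finite_toSet _).subset hsub
  have hstab : MulAction.stabilizer G (g : G ⧸ H) = H.map (MulAut.conj g).toMonoidHom := by
    have := MulAction.stabilizer_smul_eq_stabilizer_map_conj g ((1 : G) : G ⧸ H)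
    rwa [MulAction.stabilizer_quotient, MulAction.Quotient.smul_coe, smul_eq_mul, mul_one] at this
  have hidx := MulAction.index_stabilizer H (g : G ⧸ H)
  rw [← hstab]
  change (MulAction.stabilizer H (g : G ⧸ H)).index ≠ 0
  rw [hidx]
  exact ((Set.ncard_pos hfin).mpr (MulAction.nonempty_orbit _)).ne'

theorem map_conj_eq_of_cosetCoeff_ne_zero {χ : H →* ℂˣ} {u : MonoidAlgebra ℂ G}
    (hu : ∀ h : H, (Submodule.Quotient.mk (MonoidAlgebra.single (h : G) 1 * u) : IndChar H χ) =
      (χ h : ℂ) • Submodule.Quotient.mk u)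
    {g : G} (hg : cosetCoeff χ g u ≠ 0)
    {x : G} (hx : x ∈ H) (hgx : g * x * g⁻¹ ∈ H) : χ ⟨g * x * g⁻¹, hgx⟩ = χ ⟨x, hx⟩ := by
  have h1 := cosetCoeff_mem_mul hu ⟨_, hgx⟩ g
  have h2 := cosetCoeff_mul_mem χ g ⟨x, hx⟩ u
  rw [inv_mul_cancel_right, h2] at h1
  have := Units.ext (mul_right_cancel₀ hg h1)
  simpa using this.symm

end Induced

/-- If `χ^g ≠ χ` on `H^g ∩ H` for every `g` in the set-normalizer of the radical
`√[F](H ∩ F)` (with `F` the Fitting subgroup) which lies outside `H`, then `Ind_H^G χ`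
is Schur irreducible. -/
theorem schurIrreducible_indChar_of_conj_ne (G : Type*) [Group G]
    (hG : IsSupersolvable G) (H : Subgroup G) (χ : H →* ℂˣ)
    (hχ : ∀ g ∈ Subgroup.setNormalizer
        (radical (fittingSubgroup G) (H ⊓ fittingSubgroup G)), g ∉ H →
      ∃ (x : G) (hx : x ∈ H) (hgx : g * x * g⁻¹ ∈ H),
        χ ⟨g * x * g⁻¹, hgx⟩ ≠ χ ⟨x, hx⟩) :
    SchurIrreducible G (IndChar H χ) := by
  intro f
  obtain ⟨u, hu⟩ := Submodule.Quotient.mk_surjective _ (f (Submodule.Quotient.mk 1))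
  have hinv (h : H) : (Submodule.Quotient.mk (MonoidAlgebra.single (h : G) 1 * u) : IndChar H χ) =
      (χ h : ℂ) • Submodule.Quotient.mk u := by
    have h1 := mk_single_mul_mem χ 1 h
    rw [one_mul, ← MonoidAlgebra.one_def] at h1
    rw [← smul_eq_mul, Submodule.Quotient.mk_smul, hu, ← map_smul, ← Submodule.Quotient.mk_smul,
      smul_eq_mul, mul_one, h1]
    exact LinearMap.map_smul_of_tower f _ _
  obtain ⟨c, hc⟩ := mk_eq_smul_mk_one χ (u := u) fun g hgH ↦ by
    by_contra hg
    obtain ⟨x, hx, hgx, hne⟩ := hχ g (mem_normalizer_radical hG H g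
      (relIndex_ne_zero_of_cosetCoeff_ne_zero hinv hg)) hgH
    exact hne (map_conj_eq_of_cosetCoeff_ne_zero hinv hg hx hgx)
  refine ⟨c, fun v ↦ ?_⟩
  obtain ⟨x, rfl⟩ := Submodule.Quotient.mk_surjective _ v
  have hx : (Submodule.Quotient.mk x : IndChar H χ) = x • Submodule.Quotient.mk 1 := by
    rw [← Submodule.Quotient.mk_smul, smul_eq_mul, mul_one]
  rw [hx, map_smul, ← hu, hc, smul_comm]
end

section
/- Let H be a proximate normal subgroup of a group G and let W be an irreducible representation of H over ℂ (a simple ℂ[H]-module) such that the induced representation Ind_H^G(W) = ℂ[G] ⊗_{ℂ[H]} W is Schur irreducible. Then Ind_H^G(W) is a simple ℂ[G]-module. -/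
open scoped TensorProduct

/-- `H` is proximate normal in `G`: for every `g ∈ G`, the subgroup `H ∩ gHg⁻¹` is a
normal subgroup of `H` of finite index and the quotient `H/(H ∩ gHg⁻¹)` is abelian
(i.e. all commutators of elements of `H` lie in `H ∩ gHg⁻¹`). -/
def IsProximateNormal {G : Type*} [Group G] (H : Subgroup G) : Prop :=
  ∀ g : G,
    (∀ k ∈ H ⊓ Subgroup.map (MulAut.conj g).toMonoidHom H,
      ∀ h ∈ H, h * k * h⁻¹ ∈ H ⊓ Subgroup.map (MulAut.conj g).toMonoidHom H) ∧
    ((H ⊓ Subgroup.map (MulAut.conj g).toMonoidHom H).subgroupOf H).index ≠ 0 ∧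
    (∀ a ∈ H, ∀ b ∈ H, a * b * a⁻¹ * b⁻¹ ∈ H ⊓ Subgroup.map (MulAut.conj g).toMonoidHom H)

/-- `Ind_H^G W = ℂ[G] ⊗_{ℂ[H]} W`, realized as the quotient of `ℂ[G] ⊗_ℂ W` by the
`ℂ[G]`-submodule generated by the elements `h ⊗ w - 1 ⊗ (h • w)` for `h ∈ H`, `w ∈ W`. -/
noncomputable abbrev IndMod (G : Type*) [Group G] (H : Subgroup G) (W : Type*)
    [AddCommGroup W] [Module ℂ W] [Module (MonoidAlgebra ℂ ↥H) W]
    [IsScalarTower ℂ (MonoidAlgebra ℂ ↥H) W] :=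
  (MonoidAlgebra ℂ G ⊗[ℂ] W) ⧸ Submodule.span (MonoidAlgebra ℂ G)
    {x : MonoidAlgebra ℂ G ⊗[ℂ] W | ∃ (h : H) (w : W),
      x = (MonoidAlgebra.single (h : G) (1 : ℂ)) ⊗ₜ[ℂ] w
          - (1 : MonoidAlgebra ℂ G) ⊗ₜ[ℂ]
              ((MonoidAlgebra.single h (1 : ℂ) : MonoidAlgebra ℂ ↥H) • w)}

section Socle

variable {R M N : Type*} [Ring R] [AddCommGroup M] [Module R M] [AddCommGroup N] [Module R N]

variable (R M) in
/-- The socle of a module: the sum of its simple submodules. -/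
def Module.socle : Submodule R M := sSup {m | IsSimpleModule R m}

namespace Module

lemma le_socle (p : Submodule R M) [IsSemisimpleModule R p] : p ≤ socle R M := by
  rw [← p.range_subtype, ← Submodule.map_top, ← IsSemisimpleModule.sSup_simples_eq_top R p,
    (Submodule.gc_map_comap _).l_sSup]
  exact iSup₂_le fun q (hq : IsSimpleModule R q) ↦
    le_sSup (.congr (q.equivMapOfInjective _ p.subtype_injective).symm)

instance isSemisimpleModule_socle : IsSemisimpleModule R (socle R M) := by
  rw [socle, sSup_eq_iSup]
  exact isSemisimpleModule_biSup_of_isSemisimpleModule_submodule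
    fun _ (hm : IsSimpleModule R _) ↦ inferInstance

lemma apply_mem_socle [IsSemisimpleModule R M] (f : M →ₗ[R] N) (m : M) : f m ∈ socle R N :=
  have := IsSemisimpleModule.range f
  le_socle _ (LinearMap.mem_range_self f m)

lemma isSemisimpleModule_of_injective_of_mem_socle (f : M →ₗ[R] N) (hf : Function.Injective f)
    (h : ∀ m, f m ∈ socle R N) : IsSemisimpleModule R M :=
  .of_injective (f.codRestrict _ h) fun _ _ e ↦ hf (congrArg Subtype.val e)

lemma apply_mem_socle_of_bijective {S N : Type*} [Ring S] [AddCommGroup N] [Module S N]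
    {σ : R →+* S} [RingHomSurjective σ] (f : M →ₛₗ[σ] N) (hf : Function.Bijective f) {m : M}
    (hm : m ∈ socle R M) : f m ∈ socle S N := by
  suffices socle R M ≤ (socle S N).comap f from this hm
  refine sSup_le fun p (hp : IsSimpleModule R p) ↦ ?_
  rw [← Submodule.map_le_iff_le_comap]
  refine le_sSup ?_
  rw [Set.mem_ofPred_eq, isSimpleModule_iff_isAtom]
  exact ((Submodule.orderIsoMapComapOfBijective f hf).isAtom_iff p).2
    (isSimpleModule_iff_isAtom.1 hp)

end Module

end Socle

namespace Representation

open MonoidAlgebra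

variable {k G H V W : Type*} [Field k] [Group G] [Group H] [AddCommGroup V] [Module k V]
  [AddCommGroup W] [Module k W]

/-- A linear map intertwining two representations along `φ : G →* H`, as a semilinear map. -/
noncomputable def asModuleMap (ρ : Representation k G V) (σ : Representation k H W)
    (φ : G →* H) (f : V →ₗ[k] W) (h : ∀ g v, f (ρ g v) = σ (φ g) (f v)) :
    ρ.asModule →ₛₗ[mapDomainRingHom k φ] σ.asModule where
  toFun v := σ.asModuleEquiv.symm (f (ρ.asModuleEquiv v))
  map_add' := by simp
  map_smul' r v := by
    induction r using MonoidAlgebra.induction_linear with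
    | zero => simp
    | add x y hx hy => rw [add_smul, map_add, map_add, map_add, hx, hy, map_add, add_smul]
    | single g a =>
      rw [single_smul, mapDomainRingHom_apply, mapDomain_single, single_smul]
      exact (map_smul f a _).trans (congrArg (a • ·) (h g _))

/-- The subspace of a representation spanned by its irreducible subrepresentations. -/
noncomputable def socle (ρ : Representation k G V) : Subrepresentation ρ :=
  .ofSubmodule' (Module.socle k[G] ρ.asModule)

lemma apply_mem_socle {ρ : Representation k G V} {σ : Representation k H W} (φ : G ≃* H)
    (f : V ≃ₗ[k] W) (h : ∀ g v, f (ρ g v) = σ (φ g) (f v)) {v : V} (hv : v ∈ ρ.socle) :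
    f v ∈ σ.socle := by
  have : RingHomSurjective (mapDomainRingHom k (φ : G →* H)) :=
    ⟨(mapDomainRingEquiv k φ).surjective⟩
  exact Module.apply_mem_socle_of_bijective (asModuleMap ρ σ φ f h) f.bijective hv

lemma apply_mem_socle_of_isSemisimple {ρ : Representation k G V} {σ : Representation k G W}
    [IsSemisimpleModule k[G] ρ.asModule] (f : IntertwiningMap ρ σ) (v : V) : f v ∈ σ.socle :=
  Module.apply_mem_socle (IntertwiningMap.equivLinearMapAsModule ρ σ f) (ρ.asModuleEquiv.symm v)

lemma isSemisimple_of_injective_of_mem_socle {ρ : Representation k G V} {σ : Representation k G W}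
    (f : IntertwiningMap ρ σ) (hf : Function.Injective f) (h : ∀ v, f v ∈ σ.socle) :
    IsSemisimpleModule k[G] ρ.asModule :=
  Module.isSemisimpleModule_of_injective_of_mem_socle
    (IntertwiningMap.equivLinearMapAsModule ρ σ f) hf h

/-- The restriction of a representation to a subgroup. -/
abbrev restrictTo (ρ : Representation k G V) (N : Subgroup G) : Representation k N V :=
  ρ.comp N.subtype

lemma isSemisimple_restrictTo_of_isSimple (ρ : Representation k G V)
    [IsSimpleModule k[G] ρ.asModule] (N : Subgroup G) [N.Normal] [N.FiniteIndex] :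
    IsSemisimpleModule k[N] (ρ.restrictTo N).asModule := by
  have hrep (g : G) : ∃ n : N, g = n * (g : G ⧸ N).out := by
    obtain ⟨n, hn⟩ := QuotientGroup.mk_out_eq_mul N g
    refine ⟨⟨g * n⁻¹ * g⁻¹, ‹N.Normal›.conj_mem _ (inv_mem n.2) g⟩, ?_⟩
    simp [hn]
  let σ := ρ.restrictTo N
  have hfin : Module.Finite k[N] σ.asModule := by
    have := IsSimpleModule.nontrivial k[G] ρ.asModule
    obtain ⟨x, hx⟩ := exists_ne (0 : ρ.asModule)
    let t (c : G ⧸ N) : σ.asModule := ρ c.out x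
    let S : Submodule k[N] σ.asModule := Submodule.span k[N] (Set.range t)
    have hS (g : G) : σ.asModuleEquiv.symm (ρ g x) ∈ S := by
      obtain ⟨n, hn⟩ := hrep g
      rw [hn, map_mul]
      have := S.smul_mem (single n 1) (Submodule.subset_span ⟨(g : G ⧸ N), rfl⟩)
      rwa [single_smul, one_smul] at this
    refine ⟨⟨(Set.finite_range t).toFinset, ?_⟩⟩
    rw [Set.Finite.coe_toFinset, eq_top_iff]
    intro y _
    change y ∈ S
    have hy : (ρ.asModuleEquiv.symm y : ρ.asModule) ∈ Submodule.span k[G] {x} :=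
      IsSimpleModule.span_singleton_eq_top k[G] hx ▸ Submodule.mem_top
    obtain ⟨r, hr⟩ := Submodule.mem_span_singleton.1 hy
    suffices ∀ r : k[G], σ.asModuleEquiv.symm (ρ.asModuleEquiv (r • x)) ∈ S by
      simpa [hr] using! this r
    intro r
    induction r using MonoidAlgebra.induction_linear with
    | zero => simp
    | add a b ha hb => rw [add_smul, map_add, map_add]; exact S.add_mem ha hb
    | single g a =>
      rw [single_smul]
      exact S.smul_of_tower_mem a (hS g)
  have : Nontrivial σ.asModule := IsSimpleModule.nontrivial k[G] ρ.asModule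
  obtain ⟨M, hM⟩ := IsCoatomic.exists_coatom (Submodule k[N] σ.asModule)
  let φ (g : G) : N ≃* N := MulAut.conjNormal g
  let f (g : G) : σ.asModule →ₛₗ[mapDomainRingHom k (φ g : N →* N)] σ.asModule :=
    asModuleMap σ σ (φ g) (ρ g) fun n v ↦ by
      simp [σ, φ, MulAut.conjNormal_apply, ← Module.End.mul_apply, ← map_mul]
  have (g : G) : RingHomSurjective (mapDomainRingHom k (φ g : N →* N)) :=
    ⟨(mapDomainRingEquiv k (φ g)).surjective⟩
  have hsimple (g : G) : IsSimpleModule k[N] (σ.asModule ⧸ M.comap (f g)) := by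
    rw [isSimpleModule_iff_isCoatom]
    exact ((Submodule.orderIsoMapComapOfBijective (f g) (ρ.apply_bijective g)).symm.isCoatom_iff
      M).2 hM
  refine .of_injective (LinearMap.pi fun c : G ⧸ N ↦ (M.comap (f c.out)).mkQ) ?_
  rw [← LinearMap.ker_eq_bot, eq_bot_iff]
  intro x hx
  let K : Subrepresentation ρ :=
    { toSubmodule := ⨅ g, (Subrepresentation.ofSubmodule' M).toSubmodule.comap (ρ g)
      apply_mem_toSubmodule g v hv := by
        simp only [Submodule.mem_iInf, Submodule.mem_comap] at hv ⊢
        intro h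
        rw [← Module.End.mul_apply, ← map_mul]
        exact hv _ }
  have hK : K.asSubmodule = ⊥ := by
    refine (eq_bot_or_eq_top _).resolve_right fun h ↦ hM.1 ?_
    rw [eq_top_iff]
    intro y _
    have hy : (show V from y) ∈ K := h.ge (Submodule.mem_top (x := (show ρ.asModule from y)))
    simpa using! (Submodule.mem_iInf _).1 hy 1
  suffices (show V from x) ∈ K from hK.le this
  refine (Submodule.mem_iInf _).2 fun g ↦ ?_
  obtain ⟨n, hn⟩ := hrep g
  have hx' : f (g : G ⧸ N).out x ∈ M :=
    (Submodule.Quotient.mk_eq_zero (M.comap (f (g : G ⧸ N).out))).1 (congrFun hx (g : G ⧸ N))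
  have := M.smul_mem (single n 1) hx'
  rw [single_smul, one_smul] at this
  rw [hn, map_mul]
  exact this

lemma isSemisimple_of_restrictTo (ρ : Representation k G V) (N : Subgroup G) [N.FiniteIndex]
    (hN : (N.index : k) ≠ 0) [IsSemisimpleModule k[N] (ρ.restrictTo N).asModule] :
    IsSemisimpleModule k[G] ρ.asModule where
  exists_isCompl p := by
    let σ := ρ.restrictTo N
    let P := Subrepresentation.ofSubmodule' p
    let p' : Submodule k[N] σ.asModule :=
      Subrepresentation.asSubmodule ⟨P.toSubmodule, fun n ↦ P.apply_mem_toSubmodule n⟩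
    obtain ⟨h, hh⟩ := IsSemisimpleModule.extension_property p'.subtype p'.subtype_injective .id
    let π : IntertwiningMap σ σ :=
      (IntertwiningMap.equivLinearMapAsModule σ σ).symm (p'.subtype ∘ₗ h)
    have hπ_mem (v : V) : π v ∈ P := (h v).2
    have hπ_id (v : V) (hv : v ∈ P) : π v = v :=
      congrArg Subtype.val (LinearMap.congr_fun hh ⟨v, hv⟩)
    let F (g : G) : V →ₗ[k] V := ρ g ∘ₗ π.toLinearMap ∘ₗ ρ g⁻¹
    have hF_mul (g : G) (n : N) : F (g * n) = F g := by
      ext v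
      have h1 : ρ n (π (ρ ((n : G)⁻¹ * g⁻¹) v)) = π (ρ n (ρ ((n : G)⁻¹ * g⁻¹) v)) :=
        (IntertwiningMap.isIntertwining _ _ π n _).symm
      rw [← Module.End.mul_apply (ρ n), ← map_mul, mul_inv_cancel_left] at h1
      change ρ (g * n) (π (ρ (g * n)⁻¹ v)) = ρ g (π (ρ g⁻¹ v))
      rw [map_mul, Module.End.mul_apply, mul_inv_rev, h1]
    have hF_out (g : G) : F (g : G ⧸ N).out = F g := by
      obtain ⟨n, hn⟩ := QuotientGroup.mk_out_eq_mul N g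
      rw [hn, hF_mul]
    have hF_id (g : G) (v : V) (hv : v ∈ P) : F g v = v := by
      change ρ g (π (ρ g⁻¹ v)) = v
      rw [hπ_id _ (P.apply_mem_toSubmodule g⁻¹ hv), self_inv_apply]
    have := Fintype.ofFinite (G ⧸ N)
    let A : IntertwiningMap ρ ρ := LinearMap.intertwiningMap_of_isIntertwiningMap ρ ρ
      ((N.index : k)⁻¹ • ∑ c : G ⧸ N, F c.out) fun g v ↦ by
        simp only [LinearMap.smul_apply, LinearMap.sum_apply, map_smul, map_sum]
        congr 1
        refine (Fintype.sum_equiv (MulAction.toPerm g) _ _ fun c ↦ ?_).symm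
        induction c using QuotientGroup.induction_on with | H x
        rw [MulAction.toPerm_apply, MulAction.Quotient.smul_mk, smul_eq_mul, hF_out, hF_out]
        change ρ g (F x v) = ρ (g * x) (π (ρ (g * x)⁻¹ (ρ g v)))
        simp [F, mul_inv_rev, map_mul]
    have hA_mem (v : V) : A v ∈ P := P.toSubmodule.smul_mem _
      (by rw [LinearMap.sum_apply]
          exact sum_mem fun c _ ↦ P.apply_mem_toSubmodule _ (hπ_mem _))
    have hA_id (v : V) (hv : v ∈ P) : A v = v := by
      change (N.index : k)⁻¹ • (∑ c : G ⧸ N, F c.out) v = v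
      rw [LinearMap.sum_apply, Finset.sum_congr rfl fun c _ ↦ hF_id c.out v hv]
      rw [Finset.sum_const, Finset.card_univ, ← Nat.card_eq_fintype_card, ← Subgroup.index,
        ← Nat.cast_smul_eq_nsmul k, smul_smul, inv_mul_cancel₀ hN, one_smul]
    exact ⟨_, LinearMap.isCompl_of_proj (p := p)
      (f := (IntertwiningMap.equivLinearMapAsModule ρ ρ A).codRestrict p hA_mem)
      fun x ↦ Subtype.ext (hA_id x.1 x.2)⟩

/-- The inclusion of a subrepresentation, as an intertwining map. -/
def _root_.Subrepresentation.incl {ρ : Representation k G V} (Y : Subrepresentation ρ) :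
    IntertwiningMap Y.toRepresentation ρ :=
  LinearMap.intertwiningMap_of_isIntertwiningMap _ _ Y.toSubmodule.subtype fun _ _ ↦ rfl

/-- An intertwining map, viewed as intertwining the restrictions to a subgroup. -/
def IntertwiningMap.restrictTo {ρ : Representation k G V} {σ : Representation k G W}
    (f : IntertwiningMap ρ σ) (N : Subgroup G) :
    IntertwiningMap (ρ.restrictTo N) (σ.restrictTo N) :=
  LinearMap.intertwiningMap_of_isIntertwiningMap _ _ f.toLinearMap
    fun n ↦ IntertwiningMap.isIntertwining _ _ f n

/-- The socle of the restriction to a normal subgroup is stable under the whole group. -/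
noncomputable def socleRestrictTo (ρ : Representation k G V) (N : Subgroup G) [N.Normal] :
    Subrepresentation ρ where
  toSubmodule := (ρ.restrictTo N).socle.toSubmodule
  apply_mem_toSubmodule g _ hv :=
    apply_mem_socle (MulAut.conjNormal g)
      (LinearEquiv.ofBijective (ρ g) (ρ.apply_bijective g))
      (fun n v ↦ by simp [MulAut.conjNormal_apply]) hv

lemma socle_restrictTo_of_mem_socle {ρ : Representation k G V} (N : Subgroup G) [N.Normal]
    [N.FiniteIndex] {v : V} (hv : v ∈ ρ.socle) : v ∈ (ρ.restrictTo N).socle := by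
  suffices Module.socle k[G] ρ.asModule ≤ (ρ.socleRestrictTo N).asSubmodule from this hv
  refine sSup_le fun X (hX : IsSimpleModule k[G] X) x hx ↦ ?_
  let Y := Subrepresentation.ofSubmodule' X
  have : IsSimpleModule k[G] Y.toRepresentation.asModule :=
    .congr (N := X) <| LinearEquiv.ofBijective
      ((IntertwiningMap.equivLinearMapAsModule _ _ Y.incl).codRestrict X fun y ↦ y.2)
      ⟨fun _ _ h ↦ Subtype.ext (congrArg Subtype.val h), fun y ↦ ⟨⟨y.1, y.2⟩, rfl⟩⟩
  have := Y.toRepresentation.isSemisimple_restrictTo_of_isSimple N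
  exact apply_mem_socle_of_isSemisimple (Y.incl.restrictTo N) ⟨x, hx⟩

lemma mem_socle_of_mem_socle_restrictTo {ρ : Representation k G V} (N : Subgroup G) [N.Normal]
    [N.FiniteIndex] (hN : (N.index : k) ≠ 0) {v : V} (hv : v ∈ (ρ.restrictTo N).socle) :
    v ∈ ρ.socle := by
  let Y := ρ.socleRestrictTo N
  have : IsSemisimpleModule k[N] (Y.toRepresentation.restrictTo N).asModule :=
    isSemisimple_of_injective_of_mem_socle (Y.incl.restrictTo N) Subtype.val_injective
      fun y ↦ y.2
  have := isSemisimple_of_restrictTo Y.toRepresentation N hN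
  exact apply_mem_socle_of_isSemisimple Y.incl ⟨v, hv⟩

lemma apply_mem_socle_restrictTo [CharZero k] {ρ : Representation k G V} {H : Subgroup G}
    (hnormal : ∀ g : G, ((H ⊓ H.map (MulAut.conj g).toMonoidHom).subgroupOf H).Normal)
    (hindex : ∀ g : G, ((H ⊓ H.map (MulAut.conj g).toMonoidHom).subgroupOf H).FiniteIndex)
    (g : G) {v : V} (hv : v ∈ (ρ.restrictTo H).socle) : ρ g v ∈ (ρ.restrictTo H).socle := by
  let K (g : G) : Subgroup H := (H ⊓ H.map (MulAut.conj g).toMonoidHom).subgroupOf H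
  have hK (g : G) (x : H) : x ∈ K g ↔ g⁻¹ * x * g ∈ H := by
    simp only [K, Subgroup.mem_subgroupOf, Subgroup.mem_inf, x.2, true_and, Subgroup.mem_map,
      MulEquiv.toMonoidHom_eq_coe, MonoidHom.coe_coe, MulAut.conj_apply]
    exact ⟨by rintro ⟨y, hy, h⟩; simpa [← h, mul_assoc] using hy, fun h ↦ ⟨_, h, by group⟩⟩
  have hKconj (g : G) (x : H) (hx : x ∈ K g⁻¹) : g * x * g⁻¹ ∈ H := by
    simpa using (hK _ _).1 hx
  let φ : K g⁻¹ ≃* K g :=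
    { toFun x := ⟨⟨g * x * g⁻¹, hKconj g x x.2⟩, (hK _ _).2 (by simp [mul_assoc])⟩
      invFun x := ⟨⟨g⁻¹ * x * g, (hK _ _).1 x.2⟩, (hK _ _).2 (by simp [mul_assoc])⟩
      left_inv x := by ext; simp [mul_assoc]
      right_inv x := by ext; simp [mul_assoc]
      map_mul' x y := by ext; simp [mul_assoc] }
  have : (K g).Normal := hnormal g
  have : (K g⁻¹).Normal := hnormal g⁻¹
  have : (K g).FiniteIndex := hindex g
  have : (K g⁻¹).FiniteIndex := hindex g⁻¹
  refine mem_socle_of_mem_socle_restrictTo (K g)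
    (Nat.cast_ne_zero.2 Subgroup.FiniteIndex.index_ne_zero) ?_
  exact apply_mem_socle φ (LinearEquiv.ofBijective (ρ g) (ρ.apply_bijective g))
    (fun n v ↦ by simp [φ]) (socle_restrictTo_of_mem_socle (K g⁻¹) hv)

lemma isSemisimple_of_forall_mem_socle {ρ : Representation k G V} (h : ∀ v, v ∈ ρ.socle) :
    IsSemisimpleModule k[G] ρ.asModule :=
  isSemisimple_of_injective_of_mem_socle
    (LinearMap.intertwiningMap_of_isIntertwiningMap ρ ρ .id fun _ _ ↦ rfl)
    Function.injective_id h

lemma isSimpleModule_ofModule' (M : Type*) [AddCommGroup M] [Module k M] [Module k[G] M]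
    [IsScalarTower k k[G] M] [IsSimpleModule k[G] M] :
    IsSimpleModule k[G] (ofModule' (k := k) (G := G) M).asModule := by
  let ρ := ofModule' (k := k) (G := G) M
  refine .congr (N := M) (AddEquiv.toLinearEquiv ρ.asModuleEquiv.toAddEquiv fun r x ↦ ?_)
  change ρ.asModuleEquiv (r • x) = r • ρ.asModuleEquiv x
  induction r using MonoidAlgebra.induction_linear with
  | zero => simp
  | add a b ha hb => rw [add_smul, add_smul, map_add, ha, hb]
  | single g a =>
    rw [single_smul]
    change a • (single g 1 : k[G]) • ρ.asModuleEquiv x = _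
    rw [← smul_assoc, smul_single, smul_eq_mul, mul_one]

end Representation

namespace IndMod

open MonoidAlgebra Representation

variable {G : Type*} [Group G] {H : Subgroup G} {W : Type*} [AddCommGroup W] [Module ℂ W]
  [Module (MonoidAlgebra ℂ H) W] [IsScalarTower ℂ (MonoidAlgebra ℂ H) W]

variable (G H W) in
/-- The map `w ↦ 1 ⊗ w` from a representation to its induced representation. -/
noncomputable def unit : W →ₗ[ℂ] IndMod G H W :=
  (Submodule.mkQ _).restrictScalars ℂ ∘ₗ TensorProduct.mk ℂ (MonoidAlgebra ℂ G) W 1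

lemma single_smul_unit (h : H) (w : W) :
    (single (h : G) 1 : MonoidAlgebra ℂ G) • unit G H W w =
      unit G H W ((single h 1 : MonoidAlgebra ℂ H) • w) := by
  refine (Submodule.Quotient.eq _).2 (Submodule.subset_span ⟨h, w, ?_⟩)
  simp [TensorProduct.smul_tmul']

@[elab_as_elim]
lemma induction {P : IndMod G H W → Prop} (add : ∀ x y, P x → P y → P (x + y))
    (single_smul : ∀ g w, P ((single g 1 : MonoidAlgebra ℂ G) • unit G H W w))
    (x : IndMod G H W) : P x := by
  have zero : P 0 := by simpa using single_smul 1 0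
  obtain ⟨x, rfl⟩ := Submodule.mkQ_surjective _ x
  induction x using TensorProduct.induction_on with
  | zero => simpa using zero
  | add x y hx hy => simpa using add _ _ hx hy
  | tmul r w =>
    induction r using MonoidAlgebra.induction_linear with
    | zero => simpa using zero
    | add a b ha hb => simpa [TensorProduct.add_tmul] using add _ _ ha hb
    | single g a =>
      convert single_smul g (a • w)
      refine congrArg (Submodule.mkQ _) ?_
      change _ = (single g 1 : MonoidAlgebra ℂ G) • (1 ⊗ₜ[ℂ] (a • w))
      rw [TensorProduct.smul_tmul', smul_eq_mul, mul_one,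
        ← TensorProduct.smul_tmul, smul_single, smul_eq_mul, mul_one]

/-- Frobenius reciprocity: an `H`-equivariant map from `W` extends to the induced module. -/
noncomputable def lift {M : Type*} [AddCommGroup M] [Module ℂ M] [Module (MonoidAlgebra ℂ G) M]
    [IsScalarTower ℂ (MonoidAlgebra ℂ G) M] (f : W →ₗ[ℂ] M)
    (hf : ∀ (h : H) w, f ((single h 1 : MonoidAlgebra ℂ H) • w) =
      (single (h : G) 1 : MonoidAlgebra ℂ G) • f w) :
    IndMod G H W →ₗ[MonoidAlgebra ℂ G] M :=
  Submodule.liftQ _ (TensorProduct.AlgebraTensorModule.lift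
    (LinearMap.toSpanSingleton (MonoidAlgebra ℂ G) (W →ₗ[ℂ] M) f)) <| by
    rw [Submodule.span_le]
    rintro _ ⟨h, w, rfl⟩
    simp [hf]

@[simp]
lemma lift_unit {M : Type*} [AddCommGroup M] [Module ℂ M] [Module (MonoidAlgebra ℂ G) M]
    [IsScalarTower ℂ (MonoidAlgebra ℂ G) M] (f : W →ₗ[ℂ] M)
    (hf : ∀ (h : H) w, f ((single h 1 : MonoidAlgebra ℂ H) • w) =
      (single (h : G) 1 : MonoidAlgebra ℂ G) • f w) (w : W) :
    lift f hf (unit G H W w) = f w := by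
  simp [lift, unit]

open Classical in
variable (H W) in
/-- The action of an element of `G` on `W`, extended by zero outside of `H`. -/
noncomputable def extendByZero (g : G) : W →ₗ[ℂ] W :=
  if h : g ∈ H then ofModule' (k := ℂ) (G := H) W ⟨g, h⟩ else 0

lemma extendByZero_of_mem {g : G} (hg : g ∈ H) (w : W) :
    extendByZero H W g w = (single ⟨g, hg⟩ 1 : MonoidAlgebra ℂ H) • w := by
  rw [extendByZero, dif_pos hg]
  rfl

lemma extendByZero_of_notMem {g : G} (hg : g ∉ H) : extendByZero H W g = 0 := dif_neg hg

lemma extendByZero_mul (g : G) (h : H) (w : W) :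
    extendByZero H W (g * h) w =
      extendByZero H W g ((single h 1 : MonoidAlgebra ℂ H) • w) := by
  by_cases hg : g ∈ H
  · rw [extendByZero_of_mem hg, extendByZero_of_mem (mul_mem hg h.2), ← mul_smul,
      single_mul_single, one_mul]
    rfl
  · rw [extendByZero_of_notMem hg, extendByZero_of_notMem]
    · rfl
    · rwa [Subgroup.mul_mem_cancel_right H h.2]

variable (G H W) in
/-- The projection of `ℂ[G] ⊗ W` to `W` which sends `g ⊗ w` to `g • w` for `g ∈ H` and to `0`
for `g ∉ H`. -/
noncomputable def tensorProj : MonoidAlgebra ℂ G ⊗[ℂ] W →ₗ[ℂ] W :=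
  TensorProduct.lift (Finsupp.linearCombination ℂ (extendByZero H W) ∘ₗ
    (coeffLinearEquiv (S := ℂ) (M := G) ℂ).toLinearMap)

lemma tensorProj_single (g : G) (a : ℂ) (w : W) :
    tensorProj G H W (single g a ⊗ₜ w) = a • extendByZero H W g w := by
  simp [tensorProj]

variable (G H W) in
/-- The projection of the induced module to its summand `1 ⊗ W`. -/
noncomputable def proj : IndMod G H W →ₗ[ℂ] W :=
  Submodule.liftQ (Submodule.restrictScalars ℂ _) (tensorProj G H W) (by
    intro x hx
    suffices ∀ r : MonoidAlgebra ℂ G, tensorProj G H W (r • x) = 0 by simpa using this 1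
    rw [Submodule.restrictScalars_mem] at hx
    induction hx using Submodule.span_induction with
    | zero => simp
    | add x y _ _ hx hy => intro r; rw [smul_add, map_add, hx, hy, add_zero]
    | smul a x _ hx => intro r; rw [← mul_smul]; exact hx _
    | mem x hx =>
      obtain ⟨h, w, rfl⟩ := hx
      intro r
      induction r using MonoidAlgebra.induction_linear with
      | zero => simp
      | add a b ha hb => rw [add_smul, map_add, ha, hb, add_zero]
      | single g a =>
        rw [smul_sub, TensorProduct.smul_tmul', TensorProduct.smul_tmul', smul_eq_mul,
          smul_eq_mul, single_mul_single, mul_one, mul_one, map_sub, tensorProj_single,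
          tensorProj_single, extendByZero_mul, sub_self]) ∘ₗ
    (Submodule.Quotient.restrictScalarsEquiv ℂ _).symm.toLinearMap

lemma proj_single_smul_unit (g : G) (w : W) :
    proj G H W ((single g 1 : MonoidAlgebra ℂ G) • unit G H W w) = extendByZero H W g w := by
  change tensorProj G H W ((single g 1 : MonoidAlgebra ℂ G) • (1 ⊗ₜ w)) = _
  rw [TensorProduct.smul_tmul', smul_eq_mul, mul_one, tensorProj_single, one_smul]

lemma proj_single_smul_unit_of_mem {g : G} (hg : g ∈ H) (w : W) :
    proj G H W ((single g 1 : MonoidAlgebra ℂ G) • unit G H W w) =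
      (single ⟨g, hg⟩ 1 : MonoidAlgebra ℂ H) • w := by
  rw [proj_single_smul_unit, extendByZero_of_mem]

lemma proj_single_smul_unit_of_notMem {g : G} (hg : g ∉ H) (w : W) :
    proj G H W ((single g 1 : MonoidAlgebra ℂ G) • unit G H W w) = 0 := by
  rw [proj_single_smul_unit, extendByZero_of_notMem hg, LinearMap.zero_apply]

lemma proj_unit (w : W) : proj G H W (unit G H W w) = w := by
  have := proj_single_smul_unit_of_mem (one_mem H) w
  rw [← one_def, one_smul] at this
  rw [this]
  exact one_smul (MonoidAlgebra ℂ H) w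

lemma proj_single_smul (h : H) (x : IndMod G H W) :
    proj G H W ((single (h : G) 1 : MonoidAlgebra ℂ G) • x) =
      (single h 1 : MonoidAlgebra ℂ H) • proj G H W x := by
  induction x using induction with
  | add x y hx hy => simp_all
  | single_smul g w =>
    rw [← mul_smul, single_mul_single, one_mul]
    by_cases hg : g ∈ H
    · rw [proj_single_smul_unit_of_mem (mul_mem h.2 hg), proj_single_smul_unit_of_mem hg,
        ← mul_smul, single_mul_single, one_mul]
      rfl
    · rw [proj_single_smul_unit_of_notMem hg, proj_single_smul_unit_of_notMem, smul_zero]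
      rwa [Subgroup.mul_mem_cancel_left H h.2]

lemma exists_proj_single_smul_ne_zero {x : IndMod G H W} (hx : x ≠ 0) :
    ∃ g : G, proj G H W ((single g 1 : MonoidAlgebra ℂ G) • x) ≠ 0 := by
  classical
  contrapose! hx
  have key (x : IndMod G H W) : ∃ s : Finset (G ⧸ H), ∀ t, s ⊆ t →
      ∑ c ∈ t, (single c.out 1 : MonoidAlgebra ℂ G) •
        unit G H W (proj G H W ((single c.out⁻¹ 1 : MonoidAlgebra ℂ G) • x)) = x := by
    induction x using induction with
    | add x y hx hy =>
      obtain ⟨s, hs⟩ := hx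
      obtain ⟨t, ht⟩ := hy
      refine ⟨s ∪ t, fun u hu ↦ ?_⟩
      simp only [smul_add, map_add, Finset.sum_add_distrib]
      rw [hs u (Finset.union_subset_left hu), ht u (Finset.union_subset_right hu)]
    | single_smul g w =>
      refine ⟨{(g : G ⧸ H)}, fun t ht ↦ ?_⟩
      rw [Finset.sum_eq_single_of_mem (g : G ⧸ H) (by simpa using ht)]
      · obtain ⟨h, hh⟩ := QuotientGroup.mk_out_eq_mul H g
        have hmem : (g : G ⧸ H).out⁻¹ * g ∈ H := by simp [hh]
        rw [← mul_smul, single_mul_single, one_mul, proj_single_smul_unit_of_mem hmem,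
          ← single_smul_unit, ← mul_smul, single_mul_single, one_mul, mul_inv_cancel_left]
      · intro c _ hc
        rw [← mul_smul, single_mul_single, one_mul, proj_single_smul_unit_of_notMem, map_zero,
          smul_zero]
        rwa [← QuotientGroup.eq, QuotientGroup.out_eq']
  obtain ⟨s, hs⟩ := key x
  rw [← hs s subset_rfl]
  simp [hx]

end IndMod

/-- If `H` is proximate normal in `G`, `W` is a simple `ℂ[H]`-module, and `Ind_H^G W`
is Schur irreducible, then `Ind_H^G W` is a simple `ℂ[G]`-module. -/
theorem isSimpleModule_indMod_of_schurIrreducible (G : Type*) [Group G]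
    (H : Subgroup G) (hH : IsProximateNormal H) (W : Type*) [AddCommGroup W]
    [Module ℂ W] [Module (MonoidAlgebra ℂ ↥H) W]
    [IsScalarTower ℂ (MonoidAlgebra ℂ ↥H) W]
    (hW : IsSimpleModule (MonoidAlgebra ℂ ↥H) W)
    (hschur : SchurIrreducible G (IndMod G H W)) :
    IsSimpleModule (MonoidAlgebra ℂ G) (IndMod G H W) := by
  open MonoidAlgebra Representation in
  have : Nontrivial W := IsSimpleModule.nontrivial (MonoidAlgebra ℂ H) W
  have : Nontrivial (IndMod G H W) :=
    (Function.LeftInverse.injective (IndMod.proj_unit (G := G) (H := H) (W := W))).nontrivial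
  refine (isSimpleModule_iff _ _).2 ⟨fun U ↦ or_iff_not_imp_left.2 fun hU ↦ ?_⟩
  let τ : Representation ℂ H W := ofModule' W
  let ρ : Representation ℂ G (IndMod G H W) := ofModule' _
  let σ := ρ.restrictTo H
  have : IsSimpleModule ℂ[H] τ.asModule := isSimpleModule_ofModule' W
  let ι : IntertwiningMap τ σ := LinearMap.intertwiningMap_of_isIntertwiningMap τ σ
    (IndMod.unit G H W) fun h w ↦ (IndMod.single_smul_unit h w).symm
  let π : IntertwiningMap σ τ := LinearMap.intertwiningMap_of_isIntertwiningMap σ τ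
    (IndMod.proj G H W) IndMod.proj_single_smul
  have hsocle (v : IndMod G H W) : v ∈ σ.socle := by
    induction v using IndMod.induction with
    | add x y hx hy => exact σ.socle.toSubmodule.add_mem hx hy
    | single_smul g w =>
      refine apply_mem_socle_restrictTo (ρ := ρ) (fun g ↦ ⟨fun x hx y ↦ ?_⟩)
        (fun g ↦ ⟨(hH g).2.1⟩) g (apply_mem_socle_of_isSemisimple ι w)
      exact (hH g).1 _ hx _ y.2
  have : IsSemisimpleModule ℂ[H] σ.asModule := isSemisimple_of_forall_mem_socle hsocle
  let U' : Submodule ℂ[H] σ.asModule := Subrepresentation.asSubmodule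
    ⟨U.restrictScalars ℂ, fun h _ hv ↦ U.smul_mem (single (h : G) 1) hv⟩
  let p : U' →ₗ[ℂ[H]] τ.asModule :=
    (IntertwiningMap.equivLinearMapAsModule σ τ π).domRestrict U'
  have hp : p ≠ 0 := by
    obtain ⟨u, hu, hu0⟩ := U.exists_mem_ne_zero_of_ne_bot hU
    obtain ⟨g, hg⟩ := IndMod.exists_proj_single_smul_ne_zero hu0
    exact fun h ↦ hg (LinearMap.congr_fun h ⟨_, U.smul_mem (single g 1) hu⟩)
  have hp_surj : Function.Surjective p :=
    LinearMap.surjective_of_ne_zero (M := U') (N := τ.asModule) hp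
  obtain ⟨s, hs⟩ := IsSemisimpleModule.lifting_property (M := U') (N := τ.asModule)
    (P := τ.asModule) p hp_surj .id
  let f : IntertwiningMap τ σ :=
    (IntertwiningMap.equivLinearMapAsModule τ σ).symm (U'.subtype ∘ₗ s)
  have hf_mem (w : W) : f w ∈ U := (s w).2
  have hf_proj (w : W) : IndMod.proj G H W (f w) = w := LinearMap.congr_fun hs w
  obtain ⟨c, hc⟩ := hschur (IndMod.lift f.toLinearMap (IntertwiningMap.isIntertwining _ _ f))
  have hcf (w : W) : f w = c • IndMod.unit G H W w := by
    rw [← hc]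
    exact (IndMod.lift_unit _ _ w).symm
  have hc1 : c = 1 := by
    obtain ⟨w, hw⟩ := exists_ne (0 : W)
    have := hf_proj w
    rw [hcf, map_smul, IndMod.proj_unit] at this
    exact smul_left_injective ℂ hw (this.trans (one_smul ℂ w).symm)
  rw [eq_top_iff]
  rintro x -
  induction x using IndMod.induction with
  | add x y hx hy => exact U.add_mem hx hy
  | single_smul g w =>
    refine U.smul_mem _ ?_
    have := hf_mem w
    rwa [hcf, hc1, one_smul] at this
end
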